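/- Let n, k ≥ 1 be integers and let M ≥ 0 be an integer. Suppose that for every set V' ⊆ ℝ² of n distinct points and every v ∈ V', every finite family of pairwise non-homotopic v-loops in which each loop has fewer than 5k self-intersections and every two distinct loops have fewer than 5k intersections has at most M members. Then for every set V ⊆ ℝ² of n distinct points and every point x ∉ V, every finite family of pairwise non-homotopic x-loops in which each loop has fewer than k self-intersections and every two distinct loops have fewer than k intersections has at most 484·k²·M members. (In the notation of the paper: f(n,k) ≤ 484·k²·g(n,5k).) -/

import Mathlib

/-- An `x`-loop with respect to the obstacle set `V`: a continuous function on `[0,1]`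
with both endpoints at `x`, avoiding `V` on the open interval `(0,1)`. -/
def IsLoop (V : Set (ℝ × ℝ)) (x : ℝ × ℝ) (f : ℝ → ℝ × ℝ) : Prop :=
  ContinuousOn f (Set.Icc 0 1) ∧ f 0 = x ∧ f 1 = x ∧ ∀ t ∈ Set.Ioo (0:ℝ) 1, f t ∉ V

/-- Two `x`-loops are homotopic (relative to the obstacle set `V`). -/
def LoopHomotopic (V : Set (ℝ × ℝ)) (x : ℝ × ℝ) (f g : ℝ → ℝ × ℝ) : Prop :=
  ∃ H : ℝ → ℝ → ℝ × ℝ,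
    ContinuousOn (fun p : ℝ × ℝ => H p.1 p.2) (Set.Icc 0 1 ×ˢ Set.Icc 0 1) ∧
    (∀ t ∈ Set.Icc (0:ℝ) 1, H 0 t = f t ∧ H 1 t = g t) ∧
    (∀ s ∈ Set.Icc (0:ℝ) 1, H s 0 = x ∧ H s 1 = x) ∧
    (∀ s ∈ Set.Ioo (0:ℝ) 1, ∀ t ∈ Set.Ioo (0:ℝ) 1, H s t ∉ V)

/-- The set of self-intersections of a loop: unordered pairs `{t,u} ⊆ (0,1)`, `t ≠ u`,
`f t = f u`, encoded as ordered pairs with `t < u`. -/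
def SelfIntersections (f : ℝ → ℝ × ℝ) : Set (ℝ × ℝ) :=
  {p | p.1 ∈ Set.Ioo (0:ℝ) 1 ∧ p.2 ∈ Set.Ioo (0:ℝ) 1 ∧ p.1 < p.2 ∧ f p.1 = f p.2}

/-- The set of intersections of two loops: ordered pairs `(t,u) ∈ (0,1)²` with
`f t = g u`. -/
def Intersections (f g : ℝ → ℝ × ℝ) : Set (ℝ × ℝ) :=
  {p | p.1 ∈ Set.Ioo (0:ℝ) 1 ∧ p.2 ∈ Set.Ioo (0:ℝ) 1 ∧ f p.1 = g p.2}

/-- Loop `f` has fewer than `k` self-intersections. -/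
def FewerSelfInterThan (k : ℕ) (f : ℝ → ℝ × ℝ) : Prop :=
  (SelfIntersections f).Finite ∧ (SelfIntersections f).ncard < k

/-- Loops `f` and `g` have fewer than `k` intersections. -/
def FewerInterThan (k : ℕ) (f g : ℝ → ℝ × ℝ) : Prop :=
  (Intersections f g).Finite ∧ (Intersections f g).ncard < k

section

open Set Topology unitInterval

/-- A nowhere vanishing continuous function on a star-shaped set has a continuous logarithm. -/
theorem exists_continuousOn_log {E : Type*} [AddCommGroup E] [Module ℝ E] [TopologicalSpace E]
    [ContinuousAdd E] [ContinuousSMul ℝ E] {K : Set E} {a : E} (hK : StarConvex ℝ a K) (ha : a ∈ K)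
    {h : E → ℂ} (hc : ContinuousOn h K) (h0 : ∀ z ∈ K, h z ≠ 0) {w : ℂ} (hw : Complex.exp w = h a) :
    ∃ L : E → ℂ, ContinuousOn L K ∧ (∀ z ∈ K, Complex.exp (L z) = h z) ∧ L a = w := by
  have key : ∀ p : I × K, (1 - (p.1 : ℝ)) • a + (p.1 : ℝ) • (p.2 : E) ∈ K := fun p =>
    hK p.2.2 (by linarith [p.1.2.2]) p.1.2.1 (by ring)
  let H : C(I × K, {z : ℂ // z ≠ 0}) :=
    ⟨fun p => ⟨h ((1 - (p.1 : ℝ)) • a + (p.1 : ℝ) • (p.2 : E)), h0 _ (key p)⟩, by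
      refine Continuous.subtype_mk (hc.comp_continuous (by fun_prop) key) _⟩
  let f : C(K, ℂ) := .const _ w
  have H0 : ∀ k : K, H (0, k) = ⟨Complex.exp (f k), Complex.exp_ne_zero _⟩ := fun k => by
    apply Subtype.ext; simp [H, f, hw]
  let Λ := Complex.isCoveringMap_exp.liftHomotopy H f H0
  have hΛ : ∀ p, Complex.exp (Λ p) = H p := fun p =>
    congrArg Subtype.val (congrFun (Complex.isCoveringMap_exp.liftHomotopy_lifts H f H0) p)
  classical
  refine ⟨fun z => if hz : z ∈ K then Λ (1, ⟨z, hz⟩) else 0, ?_, ?_, ?_⟩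
  · rw [continuousOn_iff_continuous_domRestrict]
    have : Continuous fun k : K => Λ (1, k) := by fun_prop
    convert this using 2 with k
    simp
  · intro z hz
    simp [hz, hΛ, H]
  · simp only [ha, dif_pos]
    have h1 : ∀ t t', Λ (t, ⟨a, ha⟩) = Λ (t', ⟨a, ha⟩) := by
      intro t t'
      refine Complex.isCoveringMap_exp.const_of_comp (g := fun t : I => Λ (t, ⟨a, ha⟩))
        (by fun_prop) (fun s s' => ?_) t t'
      apply Subtype.ext
      show Complex.exp _ = Complex.exp _
      rw [hΛ, hΛ]
      simp only [H, ContinuousMap.coe_mk, ← add_smul]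
      ring_nf
    rw [h1 1 0]
    exact Complex.isCoveringMap_exp.liftHomotopy_zero H f H0 _

/-- Two continuous logarithms of proportional functions on a preconnected set differ by a
constant. -/
theorem log_sub_eq_of_preconnected {E : Type*} [TopologicalSpace E] {K : Set E}
    (hK : IsPreconnected K) {L₁ L₂ : E → ℂ} (h₁ : ContinuousOn L₁ K) (h₂ : ContinuousOn L₂ K)
    {κ : ℂ} (h : ∀ z ∈ K, Complex.exp (L₁ z) = κ * Complex.exp (L₂ z))
    {x y : E} (hx : x ∈ K) (hy : y ∈ K) : L₁ x - L₂ x = L₁ y - L₂ y := by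
  have : PreconnectedSpace K := Subtype.preconnectedSpace hK
  refine Complex.isCoveringMap_exp.const_of_comp (g := fun z : K => L₁ z - L₂ z)
    ((h₁.sub h₂) |>.domRestrict) ?_ ⟨x, hx⟩ ⟨y, hy⟩
  rintro ⟨z, hz⟩ ⟨z', hz'⟩
  apply Subtype.ext
  show Complex.exp (L₁ z - L₂ z) = Complex.exp (L₁ z' - L₂ z')
  rw [Complex.exp_sub, Complex.exp_sub, h z hz, h z' hz', mul_div_assoc, mul_div_assoc,
    div_self (Complex.exp_ne_zero _), div_self (Complex.exp_ne_zero _)]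

/-- `w` is the increment over `[a, b]` of a continuous logarithm of `h`. -/
def LogIncrement (a b : ℝ) (h : ℝ → ℂ) (w : ℂ) : Prop :=
  ∃ L : ℝ → ℂ, ContinuousOn L (Icc a b) ∧ (∀ t ∈ Icc a b, Complex.exp (L t) = h t) ∧
    L b - L a = w

theorem LogIncrement.congr_mul {a b : ℝ} (hab : a ≤ b) {h₁ h₂ : ℝ → ℂ} {w₁ w₂ κ : ℂ}
    (H₁ : LogIncrement a b h₁ w₁) (H₂ : LogIncrement a b h₂ w₂)
    (h : ∀ t ∈ Icc a b, h₁ t = κ * h₂ t) : w₁ = w₂ := by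
  obtain ⟨L₁, c₁, e₁, rfl⟩ := H₁
  obtain ⟨L₂, c₂, e₂, rfl⟩ := H₂
  have := log_sub_eq_of_preconnected isPreconnected_Icc c₁ c₂ (κ := κ)
    (fun t ht => by rw [e₁ t ht, e₂ t ht, h t ht]) (left_mem_Icc.2 hab) (right_mem_Icc.2 hab)
  linear_combination -this

theorem logIncrement_of_re_nonneg {a b : ℝ} {h : ℝ → ℂ} (hc : ContinuousOn h (Icc a b))
    (h0 : ∀ t ∈ Icc a b, h t ≠ 0) (hre : ∀ t ∈ Icc a b, 0 ≤ (h t).re) :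
    LogIncrement a b h (Complex.log (h b) - Complex.log (h a)) := by
  refine ⟨fun t => Complex.log (h t), ?_, fun t ht => Complex.exp_log (h0 t ht), rfl⟩
  refine hc.clog fun t ht => ?_
  rw [Complex.mem_slitPlane_iff]
  rcases (hre t ht).lt_or_eq with h1 | h1
  · exact .inl h1
  · refine .inr fun h2 => h0 t ht (Complex.ext h1.symm h2)

/-- The four boundary logarithm increments of a nonvanishing function on a square. -/
theorem exists_logIncrement_square {a b : ℝ} (hab : a ≤ b) {Φ : ℝ → ℝ → ℂ}
    (hc : ContinuousOn (fun p : ℝ × ℝ => Φ p.1 p.2) (Icc a b ×ˢ Icc a b))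
    (h0 : ∀ t ∈ Icc a b, ∀ u ∈ Icc a b, Φ t u ≠ 0) :
    ∃ w₁ w₂ w₃ w₄, LogIncrement a b (fun t => Φ t a) w₁ ∧ LogIncrement a b (fun u => Φ b u) w₂ ∧
      LogIncrement a b (fun t => Φ t b) w₃ ∧ LogIncrement a b (fun u => Φ a u) w₄ ∧
      w₁ + w₂ = w₃ + w₄ := by
  have ha := left_mem_Icc.2 hab
  have hb := right_mem_Icc.2 hab
  have hconv : StarConvex ℝ ((a, a) : ℝ × ℝ) (Icc a b ×ˢ Icc a b) :=
    ((convex_Icc a b).prod (convex_Icc a b)).starConvex ⟨ha, ha⟩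
  obtain ⟨L, cL, eL, -⟩ := exists_continuousOn_log hconv ⟨ha, ha⟩ hc
    (fun z hz => h0 _ hz.1 _ hz.2) (Complex.exp_log (h0 a ha a ha))
  refine ⟨_, _, _, _, ⟨fun t => L (t, a), ?_, fun t ht => eL (t, a) ⟨ht, ha⟩, rfl⟩,
    ⟨fun t => L (b, t), ?_, fun t ht => eL (b, t) ⟨hb, ht⟩, rfl⟩,
    ⟨fun t => L (t, b), ?_, fun t ht => eL (t, b) ⟨ht, hb⟩, rfl⟩,
    ⟨fun t => L (a, t), ?_, fun t ht => eL (a, t) ⟨ha, ht⟩, rfl⟩, by ring⟩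
  · exact cL.comp (by fun_prop) fun t ht => ⟨ht, ha⟩
  · exact cL.comp (by fun_prop) fun t ht => ⟨hb, ht⟩
  · exact cL.comp (by fun_prop) fun t ht => ⟨ht, hb⟩
  · exact cL.comp (by fun_prop) fun t ht => ⟨ha, ht⟩

theorem log_imag_sub_log_imag {r : ℝ} (hr : 0 < r) :
    Complex.log (-(r * (2 * Real.pi * Complex.I))) - Complex.log (r * (2 * Real.pi * Complex.I))
      = -(Real.pi * Complex.I) := by
  have h2 : (0:ℝ) < 2 * Real.pi * r := by positivity
  have e1 : -((r:ℂ) * (2 * Real.pi * Complex.I)) = ((2 * Real.pi * r : ℝ) : ℂ) * (-Complex.I) := by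
    push_cast; ring
  have e2 : ((r:ℂ) * (2 * Real.pi * Complex.I)) = ((2 * Real.pi * r : ℝ) : ℂ) * (Complex.I) := by
    push_cast; ring
  rw [e1, e2, Complex.log_ofReal_mul h2 (by simp), Complex.log_ofReal_mul h2 (by simp),
    Complex.log_I, Complex.log_neg_I]
  ring

/-- A crossing principle: if two paths in a half-plane from a common boundary point end at points
which differ by `A` periods, then for every `0 < m < A` some pair of translates meets. -/
theorem exists_crossing {a b : ℝ} (hab : a ≤ b) {f g : ℝ → ℂ} (hf : ContinuousOn f (Icc a b))
    (hg : ContinuousOn g (Icc a b)) {z e : ℂ} (hfa : f a = z) (hga : g a = z) {A m : ℝ}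
    (hgb : g b = e) (hfb : f b = e + A * (2 * Real.pi * Complex.I))
    (hfre : ∀ t ∈ Icc a b, z.re ≤ (f t).re) (hgre : ∀ t ∈ Icc a b, z.re ≤ (g t).re)
    (hm : 0 < m) (hmA : m < A) :
    ∃ t ∈ Icc a b, ∃ u ∈ Icc a b,
      f t = g u + (A - m) * (2 * Real.pi * Complex.I) ∨
      f t = g u + (A + m) * (2 * Real.pi * Complex.I) ∨
      f t = f u + m * (2 * Real.pi * Complex.I) ∨ g t = g u + m * (2 * Real.pi * Complex.I) := by
  by_contra! hcon
  set τ : ℂ := 2 * Real.pi * Complex.I with hτ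
  have hre : ∀ (r : ℝ), ((r : ℂ) * τ).re = 0 := fun r => by simp [hτ]
  have ha := left_mem_Icc.2 hab
  have hb := right_mem_Icc.2 hab
  have cf1 : ContinuousOn (fun p : ℝ × ℝ => f p.1) (Icc a b ×ˢ Icc a b) :=
    hf.comp continuousOn_fst fun p hp => hp.1
  have cf2 : ContinuousOn (fun p : ℝ × ℝ => f p.2) (Icc a b ×ˢ Icc a b) :=
    hf.comp continuousOn_snd fun p hp => hp.2
  have cg1 : ContinuousOn (fun p : ℝ × ℝ => g p.1) (Icc a b ×ˢ Icc a b) :=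
    hg.comp continuousOn_fst fun p hp => hp.1
  have cg2 : ContinuousOn (fun p : ℝ × ℝ => g p.2) (Icc a b ×ˢ Icc a b) :=
    hg.comp continuousOn_snd fun p hp => hp.2
  have side : ∀ (h : ℝ → ℂ), ContinuousOn h (Icc a b) → h a = z →
      (∀ t ∈ Icc a b, z.re ≤ (h t).re) → ∀ (r : ℝ) (κ : ℂ) (Ψ : ℝ → ℂ) (w : ℂ), κ ≠ 0 →
      LogIncrement a b Ψ w → (∀ t ∈ Icc a b, Ψ t = κ * (h t - z + r * τ)) →
      w = Complex.log (h b - z + r * τ) - Complex.log (r * τ) := by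
    intro h hc hz hr r κ Ψ w hκ hΨ hk
    have h0 : ∀ t ∈ Icc a b, h t - z + r * τ ≠ 0 := by
      intro t ht h0
      obtain ⟨L, -, eL, -⟩ := hΨ
      have := eL t ht
      rw [hk t ht, h0, mul_zero] at this
      exact Complex.exp_ne_zero _ this
    have := logIncrement_of_re_nonneg (h := fun t => h t - z + r * τ)
      ((hc.sub continuousOn_const).add continuousOn_const) h0 (fun t ht => by
        have := hr t ht
        simp only [Complex.add_re, Complex.sub_re, hre]
        linarith)
    have := hΨ.congr_mul hab this hk
    simpa [hz] using this
  obtain ⟨p1, p2, p3, p4, P1, P2, P3, P4, P⟩ := exists_logIncrement_square hab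
    (Φ := fun t u => f t - g u - (A - m) * τ) ((cf1.sub cg2).sub continuousOn_const)
    (fun t ht u hu h => (hcon t ht u hu).1 (by linear_combination h))
  obtain ⟨q1, q2, q3, q4, Q1, Q2, Q3, Q4, Q⟩ := exists_logIncrement_square hab
    (Φ := fun t u => f t - g u - (A + m) * τ) ((cf1.sub cg2).sub continuousOn_const)
    (fun t ht u hu h => (hcon t ht u hu).2.1 (by linear_combination h))
  obtain ⟨r1, r2, r3, r4, R1, R2, R3, R4, R⟩ := exists_logIncrement_square hab
    (Φ := fun t u => f t - f u - m * τ) ((cf1.sub cf2).sub continuousOn_const)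
    (fun t ht u hu h => (hcon t ht u hu).2.2.1 (by linear_combination h))
  obtain ⟨s1, s2, s3, s4, S1, S2, S3, S4, S⟩ := exists_logIncrement_square hab
    (Φ := fun t u => g t - g u - m * τ) ((cg1.sub cg2).sub continuousOn_const)
    (fun t ht u hu h => (hcon t ht u hu).2.2.2 (by linear_combination h))
  have b1 := side f hf hfa hfre (-(A - m)) 1 _ _ one_ne_zero P1 (fun t _ => by
    rw [hga]; push_cast; ring)
  have b2 := side f hf hfa hfre (-(A + m)) 1 _ _ one_ne_zero Q1 (fun t _ => by
    rw [hga]; push_cast; ring)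
  have b3 := side f hf hfa hfre (-m) 1 _ _ one_ne_zero R1 (fun t _ => by
    rw [hfa]; push_cast; ring)
  have b4 := side g hg hga hgre (-m) 1 _ _ one_ne_zero S1 (fun t _ => by
    rw [hga]; push_cast; ring)
  have d1 := side g hg hga hgre (A - m) (-1) _ _ (by simp) P4 (fun t _ => by
    rw [hfa]; push_cast; ring)
  have d2 := side g hg hga hgre (A + m) (-1) _ _ (by simp) Q4 (fun t _ => by
    rw [hfa]; push_cast; ring)
  have d3 := side f hf hfa hfre m (-1) _ _ (by simp) R4 (fun t _ => by
    rw [hfa]; ring)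
  have d4 := side g hg hga hgre m (-1) _ _ (by simp) S4 (fun t _ => by
    rw [hga]; ring)
  have x1 : p2 = s3 := P2.congr_mul hab S3 (κ := -1) (fun t _ => by rw [hfb, hgb]; ring)
  have x2 : p3 = r2 := P3.congr_mul hab R2 (κ := -1) (fun t _ => by rw [hfb, hgb]; ring)
  have x3 : q2 = s2 := Q2.congr_mul hab S2 (κ := 1) (fun t _ => by rw [hfb, hgb]; ring)
  have x4 : q3 = r3 := Q3.congr_mul hab R3 (κ := 1) (fun t _ => by rw [hfb, hgb]; ring)
  have l1 := log_imag_sub_log_imag (sub_pos.2 hmA)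
  have l2 := log_imag_sub_log_imag (by linarith : 0 < A + m)
  have l3 := log_imag_sub_log_imag hm
  rw [← hτ] at l1 l2 l3
  have hπ : (Real.pi : ℂ) * Complex.I ≠ 0 := by simp [Real.pi_ne_zero]
  apply hπ
  rw [hfb] at b1 b2 b3 d3
  rw [hgb] at b4 d1 d2 d4
  have y1 : e + A * τ - z + ((-(A - m) : ℝ) : ℂ) * τ = e - z + (m : ℝ) * τ := by push_cast; ring
  have y2 : e + A * τ - z + ((-(A + m) : ℝ) : ℂ) * τ = e - z + ((-m : ℝ) : ℂ) * τ := by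
    push_cast; ring
  have y3 : e + A * τ - z + ((-m : ℝ) : ℂ) * τ = e - z + ((A - m : ℝ) : ℂ) * τ := by push_cast; ring
  have y4 : e + A * τ - z + (m : ℂ) * τ = e - z + ((A + m : ℝ) : ℂ) * τ := by push_cast; ring
  rw [y1] at b1
  rw [y2] at b2
  rw [y3] at b3
  rw [y4] at d3
  have n1 : ((-(A - m) : ℝ) : ℂ) * τ = -(((A - m : ℝ) : ℂ) * τ) := by push_cast; ring
  have n2 : ((-(A + m) : ℝ) : ℂ) * τ = -(((A + m : ℝ) : ℂ) * τ) := by push_cast; ring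
  have n3 : ((-m : ℝ) : ℂ) * τ = -((m : ℂ) * τ) := by push_cast; ring
  rw [n1] at b1
  rw [n2, n3] at b2
  rw [n3] at b3 b4
  subst x1 x2 x3 x4 b1 b2 b3 b4 d1 d2 d3 d4
  linear_combination (1/2) * (P - Q + R + S + l1 - l2 + 2 * l3)

/-- Iterated logarithmic coverings of the complement of `V`. -/
inductive LogCover (V : Set ℂ) : (ℂ → ℂ) → Prop
  | id : LogCover V (fun z => z)
  | unwrap {π : ℂ → ℂ} {s : ℂ} : LogCover V π → π s ∈ V →
      LogCover V (fun z => π (s + Complex.exp z))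

namespace LogCover

theorem continuous {V : Set ℂ} {π : ℂ → ℂ} (h : LogCover V π) : Continuous π := by
  induction h with
  | id => exact continuous_id
  | unwrap _ _ ih => exact ih.comp (by fun_prop)

theorem exists_lift {V : Set ℂ} {π : ℂ → ℂ} (hπ : LogCover V π)
    {E : Type*} [AddCommGroup E] [Module ℝ E] [TopologicalSpace E]
    [ContinuousAdd E] [ContinuousSMul ℝ E] {K : Set E} {a : E} (hK : StarConvex ℝ a K) (ha : a ∈ K)
    {h : E → ℂ} (hc : ContinuousOn h K) (h0 : ∀ z ∈ K, h z ∉ V) {w : ℂ} (hw : π w = h a) :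
    ∃ L : E → ℂ, ContinuousOn L K ∧ (∀ z ∈ K, π (L z) = h z) ∧ L a = w := by
  induction hπ generalizing w with
  | id => exact ⟨h, hc, fun _ _ => rfl, hw.symm⟩
  | @unwrap π s _ hs ih =>
    obtain ⟨L, hL, hL1, hL2⟩ := ih hw
    obtain ⟨L', h1, h2, h3⟩ := exists_continuousOn_log hK ha (h := fun z => L z - s)
      (hL.sub continuousOn_const) (fun z hz h => h0 z hz (by
        rw [← hL1 z hz, sub_eq_zero.1 h]; exact hs)) (w := w) (by simp [hL2])
    exact ⟨L', h1, fun z hz => by simp [h2 z hz, hL1 z hz], h3⟩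

theorem lift_unique {V : Set ℂ} {π : ℂ → ℂ} (hπ : LogCover V π)
    {E : Type*} [TopologicalSpace E] {K : Set E} (hK : IsPreconnected K) {L₁ L₂ : E → ℂ}
    (h₁ : ContinuousOn L₁ K) (h₂ : ContinuousOn L₂ K) (h : ∀ z ∈ K, π (L₁ z) = π (L₂ z))
    (hV : ∀ z ∈ K, π (L₁ z) ∉ V) {x : E} (hx : x ∈ K) (hxe : L₁ x = L₂ x) {y : E} (hy : y ∈ K) :
    L₁ y = L₂ y := by
  induction hπ generalizing L₁ L₂ y with
  | id => exact h y hy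
  | @unwrap π s _ hs ih =>
    have key : ∀ z ∈ K, Complex.exp (L₁ z) = Complex.exp (L₂ z) := fun z hz =>
      add_left_cancel (ih (L₁ := fun z => s + Complex.exp (L₁ z))
        (L₂ := fun z => s + Complex.exp (L₂ z)) (by fun_prop) (by fun_prop) h hV
        (by simp [hxe]) hz)
    have := log_sub_eq_of_preconnected hK h₁ h₂ (κ := 1) (fun z hz => by rw [key z hz, one_mul])
      hx hy
    rw [hxe, sub_self] at this
    exact (sub_eq_zero.1 this.symm)

end LogCover

/-- The class of a loop in the fundamental group. -/
noncomputable def loopClass {X : Type*} [TopologicalSpace X] {x : X} (p : Path x x) :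
    FundamentalGroup X x :=
  .fromPath (.mk p)

section LoopClass

variable {X : Type*} [TopologicalSpace X] {x : X}

theorem loopClass_surjective (g : FundamentalGroup X x) : ∃ p : Path x x, loopClass p = g :=
  Path.Homotopic.Quotient.mk_surjective g

theorem loopClass_eq_iff {p q : Path x x} : loopClass p = loopClass q ↔ p.Homotopic q :=
  Path.Homotopic.Quotient.eq

theorem loopClass_mul (p q : Path x x) : loopClass p * loopClass q = loopClass (q.trans p) := rfl

theorem loopClass_inv (p : Path x x) : (loopClass p)⁻¹ = loopClass p.symm := rfl

theorem loopClass_refl : loopClass (Path.refl x) = 1 := rfl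

end LoopClass

/-- The lift along `π`, starting at `y`, of the elements of the class `g` ends at `y'`. -/
def LiftEnds {V : Set ℂ} (x₀ : {z : ℂ // z ∉ V}) (π : ℂ → ℂ) (y : ℂ)
    (g : FundamentalGroup {z : ℂ // z ∉ V} x₀) (y' : ℂ) : Prop :=
  ∃ (p : Path x₀ x₀) (L : Path y y'), loopClass p = g ∧ ∀ t, π (L t) = p t

namespace LiftEnds

variable {V : Set ℂ} {x₀ : {z : ℂ // z ∉ V}} {π : ℂ → ℂ}
  {g h : FundamentalGroup {z : ℂ // z ∉ V} x₀} {y y' y'' : ℂ}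

theorem source_eq (H : LiftEnds x₀ π y g y') : π y = x₀ := by
  obtain ⟨p, L, -, h⟩ := H
  simpa using h 0

theorem one (hy : π y = x₀) : LiftEnds x₀ π y 1 y :=
  ⟨.refl _, .refl _, loopClass_refl, fun t => by simp [hy]⟩

theorem mul (H₁ : LiftEnds x₀ π y g y') (H₂ : LiftEnds x₀ π y' h y'') :
    LiftEnds x₀ π y (h * g) y'' := by
  obtain ⟨p, L, rfl, hp⟩ := H₁
  obtain ⟨q, L', rfl, hq⟩ := H₂
  refine ⟨p.trans q, L.trans L', (loopClass_mul _ _).symm, fun t => ?_⟩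
  rw [Path.trans_apply, Path.trans_apply]
  split_ifs
  · exact hp _
  · exact hq _

theorem inv (H : LiftEnds x₀ π y g y') : LiftEnds x₀ π y' g⁻¹ y := by
  obtain ⟨p, L, rfl, hp⟩ := H
  exact ⟨p.symm, L.symm, (loopClass_inv _).symm, fun t => hp _⟩

theorem exists_target (hπ : LogCover V π) (hy : π y = x₀)
    (g : FundamentalGroup {z : ℂ // z ∉ V} x₀) : ∃ y', LiftEnds x₀ π y g y' := by
  obtain ⟨p, rfl⟩ := loopClass_surjective g
  obtain ⟨L, hL, h1, h2⟩ := hπ.exists_lift (E := ℝ) ((convex_Icc 0 1).starConvex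
    (left_mem_Icc.2 zero_le_one)) (left_mem_Icc.2 zero_le_one) (h := fun t => p.extend t)
    (by fun_prop) (fun t _ => (p.extend t).2) (w := y) (by simp [hy])
  refine ⟨L 1, p, ⟨⟨fun t => L t, ?_⟩, by simp [h2], by simp⟩, rfl, fun t => ?_⟩
  · exact hL.comp_continuous (by fun_prop) fun t => t.2
  · simpa using h1 t t.2

theorem unique (hπ : LogCover V π) (H₁ : LiftEnds x₀ π y g y') (H₂ : LiftEnds x₀ π y g y'') :
    y' = y'' := by
  have hy := H₁.source_eq
  obtain ⟨p, L, rfl, hp⟩ := H₁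
  obtain ⟨q, L', e, hq⟩ := H₂
  obtain ⟨F⟩ := loopClass_eq_iff.1 e.symm
  let h : ℝ × ℝ → ℂ := fun z => F (projIcc 0 1 zero_le_one z.1, projIcc 0 1 zero_le_one z.2)
  have hV : ∀ z, h z ∉ V := fun z =>
    (F (projIcc 0 1 zero_le_one z.1, projIcc 0 1 zero_le_one z.2)).2
  have m0 : (0:ℝ) ∈ Icc (0:ℝ) 1 := left_mem_Icc.2 zero_le_one
  have m1 : (1:ℝ) ∈ Icc (0:ℝ) 1 := right_mem_Icc.2 zero_le_one
  obtain ⟨Λ, hΛ, h1, h2⟩ := hπ.exists_lift (E := ℝ × ℝ) (a := 0) (K := Icc 0 1 ×ˢ Icc 0 1) (h := h)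
    (((convex_Icc 0 1).prod (convex_Icc 0 1)).starConvex ⟨m0, m0⟩) ⟨m0, m0⟩
    (by fun_prop) (fun z _ => hV z) (w := y) (by simp [h, hy])
  replace h2 : Λ (0, 0) = y := h2
  have cI : Continuous fun t : I => (t : ℝ) := continuous_subtype_val
  have a1 : ∀ t : I, Λ (0, t) = L t := fun t =>
    hπ.lift_unique isPreconnected_univ (L₁ := fun t : I => Λ (0, t)) (L₂ := L)
      (hΛ.comp_continuous (by fun_prop) fun t => ⟨m0, t.2⟩).continuousOn L.continuous.continuousOn
      (fun t _ => by rw [h1 _ ⟨m0, t.2⟩, hp]; simp [h])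
      (fun t _ => by rw [h1 _ ⟨m0, t.2⟩]; exact hV _) (mem_univ 0)
      (by simpa using h2) (mem_univ t)
  have a2 : ∀ t : I, Λ (t, 0) = y := fun t =>
    hπ.lift_unique isPreconnected_univ (L₁ := fun t : I => Λ (t, 0)) (L₂ := fun _ => y)
      (hΛ.comp_continuous (by fun_prop) fun t => ⟨t.2, m0⟩).continuousOn continuousOn_const
      (fun t _ => by rw [h1 _ ⟨t.2, m0⟩]; simp [h, hy])
      (fun t _ => by rw [h1 _ ⟨t.2, m0⟩]; exact hV _) (mem_univ 0)
      (by simpa using h2) (mem_univ t)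
  have a3 : ∀ t : I, Λ (1, t) = L' t := fun t =>
    hπ.lift_unique isPreconnected_univ (L₁ := fun t : I => Λ (1, t)) (L₂ := L')
      (hΛ.comp_continuous (by fun_prop) fun t => ⟨m1, t.2⟩).continuousOn L'.continuous.continuousOn
      (fun t _ => by rw [h1 _ ⟨m1, t.2⟩, hq]; simp [h])
      (fun t _ => by rw [h1 _ ⟨m1, t.2⟩]; exact hV _) (mem_univ 0)
      (by simpa using a2 1) (mem_univ t)
  have a4 : ∀ t : I, Λ (t, 1) = y' := fun t =>
    hπ.lift_unique isPreconnected_univ (L₁ := fun t : I => Λ (t, 1)) (L₂ := fun _ => y')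
      (hΛ.comp_continuous (by fun_prop) fun t => ⟨t.2, m1⟩).continuousOn continuousOn_const
      (fun t _ => by rw [h1 _ ⟨t.2, m1⟩]; simpa [h] using (hp 1).symm)
      (fun t _ => by rw [h1 _ ⟨t.2, m1⟩]; exact hV _) (mem_univ 0)
      (by simpa using a1 1) (mem_univ t)
  have b3 := a3 1
  have b4 := a4 1
  rw [Icc.coe_one] at b3 b4
  rw [← b4, b3, L'.target]

theorem zpow_of_fixed (H : LiftEnds x₀ π y g y) (n : ℤ) : LiftEnds x₀ π y (g ^ n) y := by
  induction n with
  | zero => simpa using one H.source_eq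
  | succ n ih => rw [zpow_add_one]; exact H.mul ih
  | pred n ih => rw [zpow_sub_one]; exact H.inv.mul ih

/-- Translation invariance of a logarithmic covering. -/
theorem add_period {s : ℂ} (H : LiftEnds x₀ (fun z => π (s + Complex.exp z)) y g y') (n : ℤ) :
    LiftEnds x₀ (fun z => π (s + Complex.exp z)) (y + n * (2 * Real.pi * Complex.I)) g
      (y' + n * (2 * Real.pi * Complex.I)) := by
  obtain ⟨p, L, rfl, hp⟩ := H
  refine ⟨p, L.map (f := fun z => z + n * (2 * Real.pi * Complex.I)) (by fun_prop), rfl,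
    fun t => ?_⟩
  rw [← hp t]
  simp [Complex.exp_add, Complex.exp_int_mul_two_pi_mul_I]

theorem zpow_of_period {s : ℂ} (H : LiftEnds x₀ (fun z => π (s + Complex.exp z)) y g
      (y + 2 * Real.pi * Complex.I)) (n : ℤ) :
    LiftEnds x₀ (fun z => π (s + Complex.exp z)) y (g ^ n) (y + n * (2 * Real.pi * Complex.I)) := by
  have key : ∀ n : ℤ, LiftEnds x₀ (fun z => π (s + Complex.exp z))
      (y + n * (2 * Real.pi * Complex.I)) g (y + (n + 1 : ℤ) * (2 * Real.pi * Complex.I)) := by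
    intro n
    convert H.add_period n using 1
    push_cast; ring
  induction n with
  | zero =>
    rw [zpow_zero, Int.cast_zero, zero_mul, add_zero]
    exact one H.source_eq
  | succ n ih =>
    rw [add_comm (n : ℤ) 1, zpow_one_add, add_comm 1 (n : ℤ)]
    exact ih.mul (key n)
  | pred n ih =>
    rw [sub_eq_neg_add, zpow_add, zpow_neg_one, neg_add_eq_sub]
    have := (key (-(n : ℤ) - 1)).inv
    rw [sub_add_cancel] at this
    exact ih.mul this

end LiftEnds

theorem Path.Homotopic.of_family {X : Type*} [TopologicalSpace X] {x y : X} {p q : Path x y}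
    (H : I → I → X) (hc : Continuous fun z : I × I => H z.1 z.2) (h0 : ∀ t, H 0 t = p t)
    (h1 : ∀ t, H 1 t = q t) (hs : ∀ s, H s 0 = x) (ht : ∀ s, H s 1 = y) : p.Homotopic q :=
  ⟨{ toFun := fun z => H z.1 z.2
     continuous_toFun := hc
     map_zero_left := h0
     map_one_left := h1
     prop' := by
      rintro s t (rfl | rfl)
      · simpa using hs s
      · simpa using ht s }⟩

/-- The closed convex cone around the ray through `v`, of slope `κ`. -/
def rayCone (κ : ℝ) (v : ℂ) : Set ℂ := {z | |(z / v).im| ≤ κ * (z / v).re}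

theorem convex_rayCone (κ : ℝ) (v : ℂ) : Convex ℝ (rayCone κ v) := by
  intro z hz w hw a b ha hb hab
  simp only [rayCone, mem_ofPred_eq] at *
  have e : (a • z + b • w) / v = a • (z / v) + b • (w / v) := by
    simp only [Complex.real_smul]; ring
  rw [e]
  simp only [Complex.add_im, Complex.add_re, Complex.real_smul, Complex.re_ofReal_mul,
    Complex.im_ofReal_mul]
  calc _ ≤ |a * (z / v).im| + |b * (w / v).im| := abs_add_le _ _
    _ = a * |(z / v).im| + b * |(w / v).im| := by
      rw [abs_mul, abs_mul, abs_of_nonneg ha, abs_of_nonneg hb]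
    _ ≤ a * (κ * (z / v).re) + b * (κ * (w / v).re) := by gcongr
    _ = _ := by ring

theorem zero_mem_rayCone (κ : ℝ) (v : ℂ) : (0 : ℂ) ∈ rayCone κ v := by simp [rayCone]

theorem self_mem_rayCone {κ : ℝ} (hκ : 0 ≤ κ) {v : ℂ} (hv : v ≠ 0) : v ∈ rayCone κ v := by
  simp [rayCone, hv, hκ]

theorem real_mul_mem_rayCone_iff {κ : ℝ} {v z : ℂ} {t : ℝ} (ht : 0 < t) :
    (t : ℂ) * z ∈ rayCone κ v ↔ z ∈ rayCone κ v := by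
  simp only [rayCone, mem_ofPred_eq, mul_div_assoc, Complex.re_ofReal_mul, Complex.im_ofReal_mul,
    abs_mul, abs_of_pos ht]
  rw [mul_left_comm]
  exact mul_le_mul_iff_right₀ ht

/-- Logarithmic coordinates `ζ ↦ v - v * exp ζ` of a cone punctured at `v`. -/
def coneLog (κ : ℝ) : Set ℂ := {ζ | |(Complex.exp ζ).im| ≤ κ * (1 - (Complex.exp ζ).re)}

theorem mem_coneLog_iff {κ : ℝ} {v : ℂ} (hv : v ≠ 0) {ζ : ℂ} :
    ζ ∈ coneLog κ ↔ v - v * Complex.exp ζ ∈ rayCone κ v := by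
  have : (v - v * Complex.exp ζ) / v = 1 - Complex.exp ζ := by field_simp
  simp [coneLog, rayCone, this]

theorem zero_mem_coneLog (κ : ℝ) : (0 : ℂ) ∈ coneLog κ := by simp [coneLog]

theorem add_int_mem_coneLog_iff {κ : ℝ} {ζ : ℂ} (n : ℤ) :
    ζ + n * (2 * Real.pi * Complex.I) ∈ coneLog κ ↔ ζ ∈ coneLog κ := by
  simp [coneLog, Complex.exp_add, Complex.exp_int_mul_two_pi_mul_I]

theorem int_mem_coneLog (κ : ℝ) (n : ℤ) : (n : ℂ) * (2 * Real.pi * Complex.I) ∈ coneLog κ := by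
  simp [coneLog, Complex.exp_int_mul_two_pi_mul_I]

theorem sub_real_mem_coneLog {κ : ℝ} (hκ : 0 ≤ κ) {ζ : ℂ} (h : ζ ∈ coneLog κ) {r : ℝ} (hr : 0 ≤ r) :
    ζ - r ∈ coneLog κ := by
  simp only [coneLog, mem_ofPred_eq] at *
  have e : Complex.exp (ζ - r) = ((Real.exp (-r) : ℝ) : ℂ) * Complex.exp ζ := by
    rw [sub_eq_neg_add, Complex.exp_add]; push_cast; rfl
  have h1 : Real.exp (-r) ≤ 1 := Real.exp_le_one_iff.2 (by linarith)
  have h2 := Real.exp_pos (-r)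
  rw [e, Complex.im_ofReal_mul, Complex.re_ofReal_mul, abs_mul, abs_of_pos h2]
  nlinarith [mul_le_mul_of_nonneg_left h h2.le]

theorem exists_mem_coneLog_of_re_le {κ : ℝ} (hκ : 0 < κ) :
    ∃ R : ℝ, 0 ≤ R ∧ ∀ ζ : ℂ, ζ.re ≤ -R → ζ ∈ coneLog κ := by
  have hk : 0 < κ / (1 + κ) := by positivity
  refine ⟨|Real.log (κ / (1 + κ))|, abs_nonneg _, fun ζ hζ => ?_⟩
  have h1 : ‖Complex.exp ζ‖ ≤ κ / (1 + κ) := by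
    rw [Complex.norm_exp, ← Real.exp_log hk]
    exact Real.exp_le_exp.2 (hζ.trans (neg_abs_le _))
  have h2 := (Complex.abs_im_le_norm (Complex.exp ζ)).trans h1
  have h3 := (Complex.re_le_norm (Complex.exp ζ)).trans h1
  simp only [coneLog, mem_ofPred_eq]
  refine h2.trans ?_
  calc κ / (1 + κ) = κ * (1 - κ / (1 + κ)) := by field_simp; ring
    _ ≤ _ := by gcongr

theorem contractibleSpace_coneLog {κ : ℝ} (hκ : 0 < κ) : ContractibleSpace (coneLog κ) := by
  obtain ⟨R, hR, hR'⟩ := exists_mem_coneLog_of_re_le hκ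
  rw [contractible_iff_id_nullhomotopic]
  refine ⟨⟨(-R : ℂ), hR' _ (by simp)⟩, ?_⟩
  let f : C(coneLog κ, coneLog κ) := ⟨fun ζ => ⟨ζ - ((R + |(ζ : ℂ).re| : ℝ) : ℂ),
    sub_real_mem_coneLog hκ.le ζ.2 (by positivity)⟩, by
      refine Continuous.subtype_mk ?_ _
      have : Continuous fun ζ : coneLog κ => R + |(ζ : ℂ).re| := by fun_prop
      fun_prop⟩
  have h1 : (ContinuousMap.id (coneLog κ)).Homotopic f := ⟨{
    toFun := fun p => ⟨p.2 - (((p.1 : ℝ) * (R + |(p.2 : ℂ).re|) : ℝ) : ℂ),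
      sub_real_mem_coneLog hκ.le p.2.2 (mul_nonneg p.1.2.1 (by positivity))⟩
    continuous_toFun := by
      refine Continuous.subtype_mk ?_ _
      have : Continuous fun p : I × coneLog κ => (p.1 : ℝ) * (R + |(p.2 : ℂ).re|) := by fun_prop
      fun_prop
    map_zero_left := fun ζ => by simp
    map_one_left := fun ζ => by simp [f] }⟩
  refine h1.trans ⟨{
    toFun := fun p => ⟨(1 - ((p.1 : ℝ) : ℂ)) * (p.2 - ((R + |(p.2 : ℂ).re| : ℝ) : ℂ)) +
        ((p.1 : ℝ) : ℂ) * (-R), hR' _ ?_⟩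
    continuous_toFun := ?_
    map_zero_left := fun ζ => by simp [f]
    map_one_left := fun ζ => by simp }⟩
  · have e : (1 - ((p.1 : ℝ) : ℂ)) * (p.2 - ((R + |(p.2 : ℂ).re| : ℝ) : ℂ)) +
        ((p.1 : ℝ) : ℂ) * (-R) = ((1 - (p.1 : ℝ) : ℝ) : ℂ) *
            (p.2 - ((R + |(p.2 : ℂ).re| : ℝ) : ℂ)) +
        (((p.1 : ℝ) * (-R) : ℝ) : ℂ) := by push_cast; ring
    rw [e, Complex.add_re, Complex.re_ofReal_mul, Complex.ofReal_re, Complex.sub_re,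
      Complex.ofReal_re]
    have h2 := le_abs_self (p.2 : ℂ).re
    have h3 : 0 ≤ 1 - (p.1 : ℝ) := sub_nonneg.2 p.1.2.2
    nlinarith [mul_nonneg h3 (sub_nonneg.2 h2)]
  · refine Continuous.subtype_mk ?_ _
    have : Continuous fun p : I × coneLog κ => R + |(p.2 : ℂ).re| := by fun_prop
    fun_prop

/-- `V` avoids the origin, and the cone of slope `κ` around each of its points contains no other
point of `V`. -/
structure ConeSeparated (V : Set ℂ) (κ : ℝ) : Prop where
  zero_notMem : (0 : ℂ) ∉ V
  pos : 0 < κ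
  eq_of_mem : ∀ v ∈ V, ∀ v' ∈ V, v' ∈ rayCone κ v → v' = v

namespace ConeSeparated

variable {V : Set ℂ} {κ : ℝ} (hV : ConeSeparated V κ)
include hV

theorem ne_zero {v : ℂ} (hv : v ∈ V) : v ≠ 0 := fun h => hV.zero_notMem (h ▸ hv)

theorem sub_exp_notMem {v : ℂ} (hv : v ∈ V) {ζ : ℂ} (hζ : ζ ∈ coneLog κ) :
    v - v * Complex.exp ζ ∉ V := fun h => by
  have := hV.eq_of_mem v hv _ h ((mem_coneLog_iff (hV.ne_zero hv)).1 hζ)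
  rw [sub_eq_self] at this
  exact mul_ne_zero (hV.ne_zero hv) (Complex.exp_ne_zero ζ) this

/-- The punctured cone at `v` in logarithmic coordinates. -/
noncomputable def logChart {v : ℂ} (hv : v ∈ V) : C(coneLog κ, {z : ℂ // z ∉ V}) :=
  ⟨fun ζ => ⟨v - v * Complex.exp ζ, hV.sub_exp_notMem hv ζ.2⟩, by fun_prop⟩

/-- The base point `0`. -/
def base : {z : ℂ // z ∉ V} := ⟨0, hV.zero_notMem⟩

@[simp]
theorem coe_base : (hV.base : ℂ) = 0 := rfl

theorem homotopic_of_log {v : ℂ} (hv : v ∈ V) {p q : Path hV.base hV.base} {w : ℂ}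
    (ζ ξ : Path (0 : ℂ) w) (hζ : ∀ t, ζ t ∈ coneLog κ) (hξ : ∀ t, ξ t ∈ coneLog κ)
    (hp : ∀ t, (p t : ℂ) = v - v * Complex.exp (ζ t))
    (hq : ∀ t, (q t : ℂ) = v - v * Complex.exp (ξ t)) : p.Homotopic q := by
  have := contractibleSpace_coneLog hV.pos
  have hw : w ∈ coneLog κ := by simpa using hζ 1
  let Z : Path (⟨0, zero_mem_coneLog κ⟩ : coneLog κ) ⟨w, hw⟩ :=
    ⟨⟨fun t => ⟨ζ t, hζ t⟩, by fun_prop⟩, by simp, by simp⟩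
  let Ξ : Path (⟨0, zero_mem_coneLog κ⟩ : coneLog κ) ⟨w, hw⟩ :=
    ⟨⟨fun t => ⟨ξ t, hξ t⟩, by fun_prop⟩, by simp, by simp⟩
  obtain ⟨F⟩ := SimplyConnectedSpace.paths_homotopic Z Ξ
  refine .of_family (fun s t => hV.logChart hv (F (s, t)))
    ((hV.logChart hv).continuous.comp F.continuous) ?_ ?_ ?_ ?_
  · intro t
    rw [F.apply_zero]
    exact Subtype.ext (hp t).symm
  · intro t
    rw [F.apply_one]
    exact Subtype.ext (hq t).symm
  · intro s
    rw [F.source]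
    exact Subtype.ext (by simp [logChart, base])
  · intro s
    rw [F.target]
    exact Subtype.ext (by simpa [logChart] using (hp 1).symm)

/-- `g` is represented by a loop around `v` inside the cone at `v` with winding number `n`. -/
def Winds (v : ℂ) (g : FundamentalGroup {z : ℂ // z ∉ V} hV.base) (n : ℤ) : Prop :=
  ∃ (p : Path hV.base hV.base) (ζ : Path (0 : ℂ) (n * (2 * Real.pi * Complex.I))),
    loopClass p = g ∧ (∀ t, ζ t ∈ coneLog κ) ∧ ∀ t, (p t : ℂ) = v - v * Complex.exp (ζ t)

variable {hV}

theorem Winds.unique {v : ℂ} (hv : v ∈ V) {g h : FundamentalGroup {z : ℂ // z ∉ V} hV.base} {n : ℤ}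
    (H₁ : hV.Winds v g n) (H₂ : hV.Winds v h n) : g = h := by
  obtain ⟨p, ζ, rfl, h1, h2⟩ := H₁
  obtain ⟨q, ξ, rfl, h3, h4⟩ := H₂
  exact loopClass_eq_iff.2 (hV.homotopic_of_log hv ζ ξ h1 h3 h2 h4)

theorem Winds.mul {v : ℂ} {g h : FundamentalGroup {z : ℂ // z ∉ V} hV.base} {n m : ℤ}
    (H₁ : hV.Winds v g n) (H₂ : hV.Winds v h m) : hV.Winds v (h * g) (n + m) := by
  obtain ⟨p, ζ, rfl, h1, h2⟩ := H₁
  obtain ⟨q, ξ, rfl, h3, h4⟩ := H₂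
  refine ⟨p.trans q, (ζ.trans ((ξ.map (f := fun z => z + n * (2 * Real.pi * Complex.I))
    (by fun_prop)).cast (by simp) rfl)).cast rfl (by push_cast; ring), (loopClass_mul _ _).symm,
    fun t => ?_, fun t => ?_⟩
  · rw [Path.cast_coe, Path.trans_apply]
    split_ifs
    · exact h1 _
    · exact (add_int_mem_coneLog_iff n).2 (h3 _)
  · rw [Path.cast_coe, Path.trans_apply, Path.trans_apply]
    split_ifs
    · exact h2 _
    · simp [h4, Complex.exp_add, Complex.exp_int_mul_two_pi_mul_I]

theorem Winds.inv {v : ℂ} {g : FundamentalGroup {z : ℂ // z ∉ V} hV.base} {n : ℤ}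
    (H : hV.Winds v g n) : hV.Winds v g⁻¹ (-n) := by
  obtain ⟨p, ζ, rfl, h1, h2⟩ := H
  refine ⟨p.symm, (ζ.symm.map (f := fun z => z + (-n : ℤ) * (2 * Real.pi * Complex.I))
    (by fun_prop)).cast (by simp) (by simp), (loopClass_inv _).symm, fun t => ?_, fun t => ?_⟩
  · exact (add_int_mem_coneLog_iff (-n)).2 (h1 _)
  · rw [Path.cast_coe, Path.map_coe, Function.comp_apply, Complex.exp_add,
      Complex.exp_int_mul_two_pi_mul_I, mul_one]
    exact h2 _

variable (hV)

theorem exists_winds {v : ℂ} (hv : v ∈ V) :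
    ∃ g : FundamentalGroup {z : ℂ // z ∉ V} hV.base, hV.Winds v g 1 := by
  have := contractibleSpace_coneLog hV.pos
  let Z := PathConnectedSpace.somePath (⟨0, zero_mem_coneLog κ⟩ : coneLog κ)
    ⟨((1:ℤ):ℂ) * (2 * Real.pi * Complex.I), int_mem_coneLog κ 1⟩
  refine ⟨_, (Z.map (hV.logChart hv).continuous).cast ?_ ?_, Z.map (f := Subtype.val)
    continuous_subtype_val, rfl, fun t => (Z t).2, fun t => rfl⟩
  · exact Subtype.ext (by simp [logChart, base])
  · refine Subtype.ext ?_
    simp [logChart, base]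

open Classical in
/-- The class of a simple loop around `v` inside the cone at `v`. -/
noncomputable def gen (v : ℂ) : FundamentalGroup {z : ℂ // z ∉ V} hV.base :=
  if hv : v ∈ V then (hV.exists_winds hv).choose else 1

theorem winds_gen {v : ℂ} (hv : v ∈ V) : hV.Winds v (hV.gen v) 1 := by
  rw [gen, dif_pos hv]
  exact (hV.exists_winds hv).choose_spec

theorem winds_gen_zpow {v : ℂ} (hv : v ∈ V) (n : ℤ) : hV.Winds v (hV.gen v ^ n) n := by
  induction n with
  | zero =>
    refine ⟨.refl _, (Path.refl 0).cast rfl (by simp), loopClass_refl,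
      fun t => by simp [zero_mem_coneLog], fun t => by simp⟩
  | succ n ih => rw [add_comm, zpow_one_add, add_comm]; exact ih.mul (hV.winds_gen hv)
  | pred n ih =>
    rw [sub_eq_neg_add, zpow_add, zpow_neg_one, neg_add_eq_sub]
    exact ih.mul (hV.winds_gen hv).inv

/-- A loop inside a punctured cone is homotopic to a power of the generator. -/
theorem exists_loopClass_eq_zpow {v : ℂ} (hv : v ∈ V) (p : Path hV.base hV.base)
    (hp : ∀ t, (p t : ℂ) ∈ rayCone κ v) : ∃ n : ℤ, loopClass p = hV.gen v ^ n := by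
  have hv0 := hV.ne_zero hv
  have hne : ∀ t, (p t : ℂ) ≠ v := fun t h => (p t).2 (h ▸ hv)
  have m0 : (0:ℝ) ∈ Icc (0:ℝ) 1 := left_mem_Icc.2 zero_le_one
  obtain ⟨L, hL, h1, h2⟩ := exists_continuousOn_log ((convex_Icc (0:ℝ) 1).starConvex m0) m0
    (h := fun t => (v - p.extend t) / v) (by fun_prop)
    (fun t _ => div_ne_zero (sub_ne_zero.2 (hne _).symm) hv0) (w := 0) (by simp [hv0])
  have h3 : ∀ t : I, (p t : ℂ) = v - v * Complex.exp (L t) := fun t => by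
    rw [h1 t t.2]
    rw [p.extend_apply t.2]
    field_simp
    ring
  have h4 : Complex.exp (L 1) = 1 := by
    rw [h1 1 (right_mem_Icc.2 zero_le_one)]
    simp [hv0]
  obtain ⟨n, hn⟩ := Complex.exp_eq_one_iff.1 h4
  refine ⟨n, Winds.unique hv (n := n) ⟨p, ⟨⟨fun t => L t, ?_⟩, by simpa using h2,
      by simpa using hn⟩,
    rfl, fun t => ?_, h3⟩ (hV.winds_gen_zpow hv n)⟩
  · exact hL.comp_continuous (by fun_prop) fun t => t.2
  · rw [mem_coneLog_iff hv0]
    have := hp t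
    rwa [h3 t] at this

end ConeSeparated

theorem LogCover.exists_sub_eq_mul {V : Set ℂ} {π : ℂ → ℂ} (hπ : LogCover V π) {K : Set ℂ} {v : ℂ}
    (hv : v ∈ K) {f : ℂ → ℂ} (hf : ContinuousOn f K) (hfπ : ∀ k ∈ K, π (f k) = k) :
    ∃ M : ℂ → ℂ, ContinuousOn M K ∧ (∀ k ∈ K, M k ≠ 0) ∧
      ∀ k ∈ K, f k - f v = (k - v) * M k := by
  induction hπ generalizing f with
  | id =>
    refine ⟨fun _ => 1, continuousOn_const, fun _ _ => one_ne_zero, fun k hk => ?_⟩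
    have h1 : f k = k := hfπ k hk
    have h2 : f v = v := hfπ v hv
    rw [h1, h2, mul_one]
  | @unwrap π s hπ hs ih =>
    obtain ⟨M, hM, hM0, hM1⟩ := ih (f := fun k => s + Complex.exp (f k)) (by fun_prop) hfπ
    have hE : Continuous (dslope Complex.exp 0) := by
      rw [← continuousOn_univ, continuousOn_dslope Filter.univ_mem]
      exact ⟨Complex.continuous_exp.continuousOn, Complex.differentiableAt_exp⟩
    have hE1 : ∀ d, Complex.exp d - 1 = d * dslope Complex.exp 0 d := fun d => by
      have := sub_smul_dslope Complex.exp 0 d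
      simpa using this.symm
    have hk1 : ∀ k ∈ K, Complex.exp (f v) * (Complex.exp (f k - f v) - 1) = (k - v) * M k := by
      intro k hk
      rw [← hM1 k hk, mul_sub, ← Complex.exp_add]
      ring_nf
    have hE0 : ∀ k ∈ K, dslope Complex.exp 0 (f k - f v) ≠ 0 := by
      intro k hk h
      have h2 := hk1 k hk
      rw [hE1, h, mul_zero, mul_zero] at h2
      have h3 : k = v := by
        rcases mul_eq_zero.1 h2.symm with h | h
        · exact sub_eq_zero.1 h
        · exact absurd h (hM0 k hk)
      subst h3
      simp at h
    refine ⟨fun k => M k / (Complex.exp (f v) * dslope Complex.exp 0 (f k - f v)), ?_, ?_, ?_⟩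
    · refine hM.div (continuousOn_const.mul (hE.comp_continuousOn
        (hf.sub continuousOn_const))) fun k hk => ?_
      exact mul_ne_zero (Complex.exp_ne_zero _) (hE0 k hk)
    · exact fun k hk => div_ne_zero (hM0 k hk) (mul_ne_zero (Complex.exp_ne_zero _) (hE0 k hk))
    · intro k hk
      have := hk1 k hk
      rw [hE1] at this
      have h1 := hE0 k hk
      have h2 := Complex.exp_ne_zero (f v)
      field_simp
      linear_combination this

/-- The cone at `v` lifts along `π` to a set containing `y` above `0` and `s` above `v`. -/
def ConeLift (κ : ℝ) (π : ℂ → ℂ) (v y s : ℂ) : Prop :=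
  ∃ f : ℂ → ℂ, ContinuousOn f (rayCone κ v) ∧ (∀ k ∈ rayCone κ v, π (f k) = k) ∧
    f 0 = y ∧ f v = s

theorem ConeLift.id (κ : ℝ) (v : ℂ) : ConeLift κ (fun z => z) v 0 v :=
  ⟨fun z => z, continuousOn_id, fun _ _ => rfl, rfl, rfl⟩

theorem ConeLift.apply_source {κ : ℝ} {π : ℂ → ℂ} {v y s : ℂ} (h : ConeLift κ π v y s) :
    π y = 0 := by
  obtain ⟨f, h1, h2, rfl, rfl⟩ := h
  exact h2 0 (zero_mem_rayCone κ v)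

theorem ConeLift.add_period {κ : ℝ} {π : ℂ → ℂ} {t v y s : ℂ}
    (h : ConeLift κ (fun z => π (t + Complex.exp z)) v y s) (n : ℤ) :
    ConeLift κ (fun z => π (t + Complex.exp z)) v (y + n * (2 * Real.pi * Complex.I))
      (s + n * (2 * Real.pi * Complex.I)) := by
  obtain ⟨f, h1, h2, rfl, rfl⟩ := h
  refine ⟨fun k => f k + n * (2 * Real.pi * Complex.I), by fun_prop, fun k hk => ?_, rfl, rfl⟩
  simp only [Complex.exp_add, Complex.exp_int_mul_two_pi_mul_I, mul_one]
  exact h2 k hk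

namespace ConeSeparated

variable {V : Set ℂ} {κ : ℝ} (hV : ConeSeparated V κ) {π : ℂ → ℂ} {v y s t ξ : ℂ}
include hV

theorem coneLift_apply (h : ConeLift κ π v y s) (hv : v ∈ V) : π s = v := by
  obtain ⟨f, h1, h2, rfl, rfl⟩ := h
  exact h2 v (self_mem_rayCone hV.pos.le (hV.ne_zero hv))

theorem coneLift_unwrap (h : ConeLift κ π v y s) (hv : v ∈ V) (hts : t ≠ s) (ht : π t ∈ V)
    (hξ : t + Complex.exp ξ = y) :
    ∃ s', t + Complex.exp s' = s ∧ ConeLift κ (fun z => π (t + Complex.exp z)) v ξ s' := by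
  obtain ⟨f, h1, h2, rfl, rfl⟩ := h
  have h0 := zero_mem_rayCone κ v
  obtain ⟨L, h3, h4, h5⟩ := exists_continuousOn_log ((convex_rayCone κ v).starConvex h0) h0
    (h := fun k => f k - t) (by fun_prop) (fun k hk h => by
      rw [sub_eq_zero] at h
      rw [← h, h2 k hk] at ht
      have := hV.eq_of_mem v hv k ht hk
      rw [this] at h
      exact hts h.symm) (w := ξ) (by rw [← hξ]; ring)
  refine ⟨L v, ?_, L, h3, fun k hk => ?_, h5, rfl⟩
  · rw [h4 v (self_mem_rayCone hV.pos.le (hV.ne_zero hv))]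
    ring
  · simp only [h4 k hk, add_sub_cancel, h2 k hk]

theorem liftEnds_gen_of_coneLift (h : ConeLift κ π v y s) (hv : v ∈ V) :
    LiftEnds hV.base π y (hV.gen v) y := by
  obtain ⟨f, h1, h2, rfl, rfl⟩ := h
  obtain ⟨p, ζ, h3, h4, h5⟩ := hV.winds_gen hv
  have h6 : ∀ t, (p t : ℂ) ∈ rayCone κ v := fun t => by
    rw [h5]; exact (mem_coneLog_iff (hV.ne_zero hv)).1 (h4 t)
  exact ⟨p, ⟨⟨fun t => f (p t), h1.comp_continuous (by fun_prop) h6⟩, by simp, by simp⟩, h3,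
    fun t => h2 _ (h6 t)⟩

theorem liftEnds_gen_unwrap (hπ : LogCover V π) (h : ConeLift κ π v y s) (hv : v ∈ V)
    (hξ : s + Complex.exp ξ = y) :
    LiftEnds hV.base (fun z => π (s + Complex.exp z)) ξ (hV.gen v)
      (ξ + 2 * Real.pi * Complex.I) := by
  obtain ⟨f, h1, h2, rfl, rfl⟩ := h
  have hv0 := hV.ne_zero hv
  obtain ⟨M, hM, hM0, hM1⟩ := hπ.exists_sub_eq_mul (self_mem_rayCone hV.pos.le hv0) h1 h2
  obtain ⟨p, ζ, h3, h4, h5⟩ := hV.winds_gen hv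
  have h6 : ∀ t, (p t : ℂ) ∈ rayCone κ v := fun t => by
    rw [h5]; exact (mem_coneLog_iff (hV.ne_zero hv)).1 (h4 t)
  have h0 := zero_mem_rayCone κ v
  have h7 := hM1 0 h0
  have hlog := Complex.exp_log (neg_ne_zero.2 hv0)
  obtain ⟨m, h8, h9, h10⟩ := exists_continuousOn_log ((convex_rayCone κ v).starConvex h0) h0
    hM hM0 (w := ξ - Complex.log (-v)) (by
      rw [Complex.exp_sub, hlog, div_eq_iff (neg_ne_zero.2 hv0)]
      linear_combination h7 + hξ)
  refine ⟨p, ⟨⟨fun t => ζ t + m (p t) + Complex.log (-v), ?_⟩, ?_, ?_⟩, h3, fun t => ?_⟩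
  · have := h8.comp_continuous (f := fun t => (p t : ℂ)) (by fun_prop) h6
    exact (ζ.continuous.add this).add continuous_const
  · simp [h10]
  · simp [h10]; ring
  · show π (f v + Complex.exp (ζ t + m (p t) + Complex.log (-v))) = p t
    rw [Complex.exp_add, Complex.exp_add, hlog, h9 _ (h6 t), ← h2 _ (h6 t)]
    congr 1
    have := hM1 _ (h6 t)
    rw [h2 _ (h6 t)]
    rw [h5 t] at this ⊢
    linear_combination -this

end ConeSeparated

theorem loopClass_mem_of_eventually {X : Type*} [TopologicalSpace X] {x : X}
    (H : Subgroup (FundamentalGroup X x)) (α : ∀ z, Path x z) (hα : loopClass (α x) ∈ H)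
    (p : Path x x)
    (hp : ∀ t₀ : I, ∀ᶠ t in 𝓝 t₀,
      loopClass (((α (p t₀)).trans (p.subpath t₀ t)).trans (α (p t)).symm) ∈ H) :
    loopClass p ∈ H := by
  have : PreconnectedSpace I := inferInstance
  let Q : I → I → Prop := fun s t =>
    loopClass (((α (p s)).trans (p.subpath s t)).trans (α (p t)).symm) ∈ H
  have hsymm : ∀ s t, Q s t → Q t s := by
    intro s t h
    have := H.inv_mem h
    rw [loopClass_inv] at this
    simp only [Q]
    convert this using 1
    rw [loopClass_eq_iff, ← Path.Homotopic.Quotient.eq]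
    simp [Path.symm_subpath, Path.Homotopic.Quotient.trans_assoc]
  have htrans : ∀ r s t, Q r s → Q s t → Q r t := by
    intro r s t h1 h2
    have := H.mul_mem h2 h1
    rw [loopClass_mul] at this
    simp only [Q]
    convert this using 1
    have e : Path.Homotopic.Quotient.mk (p.subpath r t) =
        (Path.Homotopic.Quotient.mk (p.subpath r s)).trans (.mk (p.subpath s t)) := by
      rw [← Path.Homotopic.Quotient.mk_trans, Path.Homotopic.Quotient.eq]
      exact ⟨(Path.Homotopy.subpathTransSubpath p r s t).symm⟩
    rw [loopClass_eq_iff, ← Path.Homotopic.Quotient.eq]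
    simp only [Path.Homotopic.Quotient.mk_trans, Path.Homotopic.Quotient.mk_symm, e,
      Path.Homotopic.Quotient.trans_assoc]
    congr 2
    rw [← Path.Homotopic.Quotient.trans_assoc (Path.Homotopic.Quotient.mk (α (p s))).symm,
      Path.Homotopic.Quotient.symm_trans, Path.Homotopic.Quotient.refl_trans]
  have key : Q 0 1 := PreconnectedSpace.induction₂' Q
    (fun s => (hp s).mono fun t h => ⟨h, hsymm _ _ h⟩) ⟨htrans⟩ 0 1
  have hcast : ∀ (a b : X) (ha : a = x) (hb : b = x) (q : Path a b),
      loopClass (((α a).trans q).trans (α b).symm) =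
        (loopClass (α x))⁻¹ * loopClass (q.cast ha.symm hb.symm) * loopClass (α x) := by
    rintro a b rfl rfl q
    rw [loopClass_inv, loopClass_mul, loopClass_mul, Path.cast_rfl_rfl, loopClass_eq_iff,
      ← Path.Homotopic.Quotient.eq]
    simp [Path.Homotopic.Quotient.trans_assoc]
  have h3 : (p.subpath 0 1).cast p.source.symm p.target.symm = p := by
    rw [Path.subpath_zero_one]; ext; simp
  simp only [Q, hcast _ _ p.source p.target, h3] at key
  rwa [H.mul_mem_cancel_right hα, H.mul_mem_cancel_left (H.inv_mem hα)] at key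

/-- The complement of the rays issued from the points of `V` and pointing away from `0`. -/
def starDomain (V : Set ℂ) : Set ℂ := {z | ∀ v ∈ V, ¬((z / v).im = 0 ∧ 1 ≤ (z / v).re)}

theorem isOpen_starDomain {V : Set ℂ} (hV : V.Finite) : IsOpen (starDomain V) := by
  have : starDomain V = ⋂ v ∈ V, {z : ℂ | (z / v).im = 0 ∧ 1 ≤ (z / v).re}ᶜ := by
    ext; simp [starDomain]
  rw [this]
  refine hV.isOpen_biInter fun v _ => ?_
  rw [isOpen_compl_iff]
  have hc : Continuous fun z : ℂ => z / v := by fun_prop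
  exact (isClosed_eq (Complex.continuous_im.comp hc) continuous_const).inter
    (isClosed_le continuous_const (Complex.continuous_re.comp hc))

theorem smul_mem_starDomain {V : Set ℂ} {z : ℂ} (hz : z ∈ starDomain V) {s : ℝ} (h0 : 0 ≤ s)
    (h1 : s ≤ 1) : (s : ℂ) * z ∈ starDomain V := by
  rintro v hv ⟨h2, h3⟩
  rw [mul_div_assoc] at h2 h3
  rw [Complex.im_ofReal_mul, mul_eq_zero] at h2
  rw [Complex.re_ofReal_mul] at h3
  rcases h2 with rfl | h2
  · norm_num at h3
  · refine hz v hv ⟨h2, ?_⟩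
    rcases h0.eq_or_lt with rfl | h0
    · norm_num at h3
    · nlinarith

namespace ConeSeparated

variable {V : Set ℂ} {κ : ℝ} (hV : ConeSeparated V κ)
include hV

theorem notMem_of_mem_starDomain {z : ℂ} (hz : z ∈ starDomain V) : z ∉ V := fun h =>
  hz z h (by simp [div_self (hV.ne_zero h)])

theorem loopClass_eq_one_of_mem_starDomain (p : Path hV.base hV.base)
    (hp : ∀ t, (p t : ℂ) ∈ starDomain V) : loopClass p = 1 := by
  rw [← loopClass_refl, loopClass_eq_iff]
  refine .of_family (fun s t => ⟨((1 - (s : ℝ) : ℝ) : ℂ) * p t, hV.notMem_of_mem_starDomain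
    (smul_mem_starDomain (hp t) (by linarith [s.2.2]) (by linarith [s.2.1]))⟩) (by fun_prop)
    ?_ ?_ ?_ ?_ <;> intro t <;> refine Subtype.ext ?_ <;> simp

theorem exists_adapted_path (z : {z : ℂ // z ∉ V}) : ∃ α : Path hV.base z,
    ((z : ℂ) ∈ starDomain V → ∀ t, (α t : ℂ) ∈ starDomain V) ∧
      ∀ v ∈ V, (z : ℂ) ∈ rayCone κ v → ∀ t, (α t : ℂ) ∈ rayCone κ v := by
  by_cases hz : (z : ℂ) ∈ starDomain V
  · refine ⟨⟨⟨fun t => ⟨((t : ℝ) : ℂ) * z, hV.notMem_of_mem_starDomain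
      (smul_mem_starDomain hz t.2.1 t.2.2)⟩, by fun_prop⟩, ?_, ?_⟩, fun _ t => ?_,
          fun v hv h t => ?_⟩
    · exact Subtype.ext (by simp)
    · exact Subtype.ext (by simp)
    · exact smul_mem_starDomain hz t.2.1 t.2.2
    · have := (convex_rayCone κ v).starConvex (zero_mem_rayCone κ v) h
        (sub_nonneg.2 t.2.2) t.2.1 (by ring)
      simpa using this
  · obtain ⟨v, hv, h1, h2⟩ : ∃ v ∈ V, ((z : ℂ) / v).im = 0 ∧ 1 ≤ ((z : ℂ) / v).re := by
      simpa [starDomain] using hz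
    have hv0 := hV.ne_zero hv
    have hzv : (z : ℂ) = (((z : ℂ) / v).re : ℂ) * v := by
      have : (z : ℂ) / v = (((z : ℂ) / v).re : ℂ) := Complex.ext (by simp) (by simp [h1])
      rw [← this]; field_simp
    set τ : ℝ := ((z : ℂ) / v).re with hτ
    have hτ1 : τ ≠ 1 := fun h => z.2 (by rw [hzv, h]; simpa using hv)
    have hne : (1 - (τ : ℂ)) ≠ 0 := by
      rw [sub_ne_zero]; exact_mod_cast hτ1.symm
    have hlog : v - v * Complex.exp (Complex.log (1 - τ)) = z := by
      rw [Complex.exp_log hne, hzv]; ring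
    have hmem : (z : ℂ) ∈ rayCone κ v := by
      rw [hzv, real_mul_mem_rayCone_iff (by linarith)]
      exact self_mem_rayCone hV.pos.le hv0
    have := contractibleSpace_coneLog hV.pos
    let Z := PathConnectedSpace.somePath (⟨0, zero_mem_coneLog κ⟩ : coneLog κ)
      ⟨Complex.log (1 - τ), by rwa [mem_coneLog_iff hv0, hlog]⟩
    refine ⟨(Z.map (hV.logChart hv).continuous).cast ?_ ?_, fun h => absurd h hz,
      fun v' hv' h t => ?_⟩
    · exact Subtype.ext (by simp [logChart])
    · exact Subtype.ext hlog.symm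
    · obtain rfl : v = v' := hV.eq_of_mem v' hv' v hv (by
        rwa [hzv, real_mul_mem_rayCone_iff (by linarith)] at h)
      exact (mem_coneLog_iff hv0).1 (Z t).2

theorem closure_gen (hfin : V.Finite) : Subgroup.closure (hV.gen '' V) = ⊤ := by
  choose α hα1 hα2 using hV.exists_adapted_path
  rw [eq_top_iff]
  rintro g -
  obtain ⟨p, rfl⟩ := loopClass_surjective g
  have h0 : (0 : ℂ) ∈ starDomain V := fun v _ => by simp
  refine loopClass_mem_of_eventually _ α ?_ p fun t₀ => ?_
  · rw [hV.loopClass_eq_one_of_mem_starDomain _ (hα1 _ (by simpa using h0))]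
    exact Subgroup.one_mem _
  have hsub : ∀ U : Set ℂ, IsOpen U → (p t₀ : ℂ) ∈ U →
      ∀ᶠ t in 𝓝 t₀, ∀ s, ((p.subpath t₀ t) s : ℂ) ∈ U := by
    intro U hU h
    have hc : Continuous fun t => (p t : ℂ) := by fun_prop
    obtain ⟨ε, hε, h1⟩ := Metric.isOpen_iff.1 (hU.preimage hc) t₀ h
    filter_upwards [Metric.ball_mem_nhds t₀ hε] with t ht s
    have : p.subpath t₀ t s ∈ range (p.subpath t₀ t) := mem_range_self s
    rw [Path.range_subpath] at this
    obtain ⟨r, hr, hr'⟩ := this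
    rw [← hr']
    refine h1 ?_
    rw [Metric.mem_ball, Subtype.dist_eq, Real.dist_eq] at ht ⊢
    refine (abs_sub_left_of_mem_uIcc (b := (t : ℝ)) ?_).trans_lt ht
    rcases mem_uIcc.1 hr with h | h
    · exact mem_uIcc.2 (.inl ⟨h.1, h.2⟩)
    · exact mem_uIcc.2 (.inr ⟨h.1, h.2⟩)
  have htri : ∀ (U : Set ℂ) (t : I), (∀ s, (α (p t₀) s : ℂ) ∈ U) →
      (∀ s, (p.subpath t₀ t s : ℂ) ∈ U) → (∀ s, (α (p t) s : ℂ) ∈ U) →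
      ∀ s, ((((α (p t₀)).trans (p.subpath t₀ t)).trans (α (p t)).symm) s : ℂ) ∈ U := by
    intro U t h1 h2 h3 s
    rw [Path.trans_apply]
    split_ifs
    · rw [Path.trans_apply]
      split_ifs
      · exact h1 _
      · exact h2 _
    · exact h3 _
  have hends : ∀ t, p.subpath t₀ t 1 = p t := fun t => by simp
  by_cases hz : (p t₀ : ℂ) ∈ starDomain V
  · filter_upwards [hsub _ (isOpen_starDomain hfin) hz] with t ht
    rw [hV.loopClass_eq_one_of_mem_starDomain]
    · exact Subgroup.one_mem _
    · intro s
      exact htri _ _ (hα1 _ hz) ht (hα1 _ (hends t ▸ ht 1)) s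
  · obtain ⟨v, hv, h1, h2⟩ : ∃ v ∈ V, ((p t₀ : ℂ) / v).im = 0 ∧ 1 ≤ ((p t₀ : ℂ) / v).re := by
      simpa [starDomain] using hz
    have hU : IsOpen {z : ℂ | |(z / v).im| < κ * (z / v).re} :=
      isOpen_lt (by fun_prop) (by fun_prop)
    have hmem : (p t₀ : ℂ) ∈ {z : ℂ | |(z / v).im| < κ * (z / v).re} := by
      have := hV.pos
      simp only [mem_ofPred_eq, h1, abs_zero]
      positivity
    filter_upwards [hsub _ hU hmem] with t ht
    obtain ⟨n, hn⟩ := hV.exists_loopClass_eq_zpow hv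
      (((α (p t₀)).trans (p.subpath t₀ t)).trans (α (p t)).symm) (fun s => by
        have hcone : ∀ z ∈ {z : ℂ | |(z / v).im| < κ * (z / v).re}, z ∈ rayCone κ v :=
          fun z hz => le_of_lt (by simpa using hz)
        exact htri _ _ (hα2 _ v hv (hcone _ hmem)) (fun r => hcone _ (ht r))
          (hα2 _ v hv (hcone _ (hends t ▸ ht 1))) s)
    rw [hn]
    exact Subgroup.zpow_mem _ (Subgroup.subset_closure (mem_image_of_mem _ hv)) n

end ConeSeparated

theorem LiftEnds.wrap {V : Set ℂ} {x₀ : {z : ℂ // z ∉ V}} {π : ℂ → ℂ} {t ξ ξ' : ℂ}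
    {g : FundamentalGroup {z : ℂ // z ∉ V} x₀}
    (H : LiftEnds x₀ (fun z => π (t + Complex.exp z)) ξ g ξ') :
    LiftEnds x₀ π (t + Complex.exp ξ) g (t + Complex.exp ξ') := by
  obtain ⟨p, L, h1, h2⟩ := H
  exact ⟨p, L.map (f := fun z => t + Complex.exp z) (by fun_prop), h1, h2⟩

theorem LiftEnds.exists_unwrap {V : Set ℂ} {x₀ : {z : ℂ // z ∉ V}} {π : ℂ → ℂ} {t ξ y y' : ℂ}
    {g : FundamentalGroup {z : ℂ // z ∉ V} x₀} (hπ : LogCover V π) (ht : π t ∈ V)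
    (hξ : t + Complex.exp ξ = y) (H : LiftEnds x₀ π y g y') :
    ∃ ξ', t + Complex.exp ξ' = y' ∧ LiftEnds x₀ (fun z => π (t + Complex.exp z)) ξ g ξ' := by
  subst hξ
  obtain ⟨ξ', h⟩ := LiftEnds.exists_target (hπ.unwrap ht) (y := ξ) H.source_eq g
  exact ⟨ξ', LiftEnds.unique hπ h.wrap H, h⟩

namespace ConeSeparated

variable {V : Set ℂ} {κ : ℝ} (hV : ConeSeparated V κ) {π : ℂ → ℂ} {y₀ s t ξ : ℂ}
  {g γ : FundamentalGroup {z : ℂ // z ∉ V} hV.base}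

/-- `g` is conjugate to the generator at some `v ∈ V`, and lifts to a loop around `s`. -/
def Meridian (π : ℂ → ℂ) (y₀ : ℂ) (g : FundamentalGroup {z : ℂ // z ∉ V} hV.base) (s : ℂ) : Prop :=
  ∃ (h : FundamentalGroup {z : ℂ // z ∉ V} hV.base) (v y : ℂ), v ∈ V ∧ g = h⁻¹ * hV.gen v * h ∧
    LiftEnds hV.base π y₀ h y ∧ ConeLift κ π v y s

variable {hV}

namespace Meridian

theorem of_coneLift {v : ℂ} (hv : v ∈ V) (h : ConeLift κ π v y₀ s) :
    hV.Meridian π y₀ (hV.gen v) s :=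
  ⟨1, v, y₀, hv, by rw [inv_one, one_mul, mul_one], .one (by simpa using h.apply_source), h⟩

theorem apply_mem (H : hV.Meridian π y₀ g s) : π s ∈ V := by
  obtain ⟨h, v, y, hv, -, -, H⟩ := H
  rwa [hV.coneLift_apply H hv]

theorem liftEnds_self (H : hV.Meridian π y₀ g s) : LiftEnds hV.base π y₀ g y₀ := by
  obtain ⟨h, v, y, hv, rfl, h1, h2⟩ := H
  rw [mul_assoc]
  exact (h1.mul (hV.liftEnds_gen_of_coneLift h2 hv)).mul h1.inv

theorem liftEnds_unwrap (hπ : LogCover V π) (H : hV.Meridian π y₀ g s)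
    (hξ : s + Complex.exp ξ = y₀) : LiftEnds hV.base (fun z => π (s + Complex.exp z)) ξ g
      (ξ + 2 * Real.pi * Complex.I) := by
  have hs := H.apply_mem
  obtain ⟨h, v, y, hv, rfl, h1, h2⟩ := H
  obtain ⟨ξ', h3, h4⟩ := h1.exists_unwrap hπ hs hξ
  rw [mul_assoc]
  have := h4.inv.add_period 1
  rw [Int.cast_one, one_mul] at this
  exact (h4.mul (hV.liftEnds_gen_unwrap hπ h2 hv h3)).mul this

theorem exists_unwrap (hπ : LogCover V π) (H : hV.Meridian π y₀ g s) (ht : π t ∈ V) (hts : t ≠ s)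
    (hξ : t + Complex.exp ξ = y₀) :
    ∃ s', t + Complex.exp s' = s ∧ hV.Meridian (fun z => π (t + Complex.exp z)) ξ g s' := by
  obtain ⟨h, v, y, hv, rfl, h1, h2⟩ := H
  obtain ⟨ξ', h3, h4⟩ := h1.exists_unwrap hπ ht hξ
  obtain ⟨s', h5, h6⟩ := hV.coneLift_unwrap h2 hv hts ht h3
  exact ⟨s', h5, h, v, ξ', hv, rfl, h4, h6⟩

theorem conj (H : hV.Meridian (fun z => π (t + Complex.exp z)) ξ g s)
    (hγ : LiftEnds hV.base (fun z => π (t + Complex.exp z)) ξ γ (ξ + 2 * Real.pi * Complex.I))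
    (n : ℤ) : hV.Meridian (fun z => π (t + Complex.exp z)) ξ (γ ^ n * g * γ ^ (-n))
      (s - n * (2 * Real.pi * Complex.I)) := by
  obtain ⟨h, v, y, hv, rfl, h1, h2⟩ := H
  refine ⟨h * γ ^ (-n), v, y + (-n : ℤ) * (2 * Real.pi * Complex.I), hv, ?_,
    (hγ.zpow_of_period (-n)).mul (h1.add_period (-n)), ?_⟩
  · group
  · convert h2.add_period (-n) using 1
    push_cast; ring

end Meridian

/-- The product of a word whose letters are indexed by complex numbers. -/
def wordProd {G : Type*} [Group G] (m : ℂ → G) (l : List (ℂ × ℤ)) : G :=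
  (l.map fun x => m x.1 ^ x.2).prod

open Classical in
/-- The exponent sum of the letter `t` in a word. -/
noncomputable def expSum (t : ℂ) (l : List (ℂ × ℤ)) : ℤ :=
  (l.map fun x => if x.1 = t then x.2 else 0).sum

theorem liftEnds_wordProd {m : ℂ → FundamentalGroup {z : ℂ // z ∉ V} hV.base} (hπ : LogCover V π)
    (hξ : t + Complex.exp ξ = y₀) (ht : hV.Meridian π y₀ (m t) t) (l : List (ℂ × ℤ))
    (hl : ∀ x ∈ l, hV.Meridian π y₀ (m x.1) x.1) :
    LiftEnds hV.base (fun z => π (t + Complex.exp z)) ξ (wordProd m l)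
      (ξ + expSum t l * (2 * Real.pi * Complex.I)) := by
  induction l with
  | nil =>
    subst hξ
    simp only [wordProd, expSum, List.map_nil, List.prod_nil, List.sum_nil, Int.cast_zero, zero_mul,
      add_zero]
    exact .one ht.liftEnds_self.source_eq
  | cons x l ih =>
    have ih := ih fun x hx => hl x (List.mem_cons_of_mem _ hx)
    simp only [wordProd, expSum, List.map_cons, List.prod_cons, List.sum_cons] at ih ⊢
    refine ih.mul ?_
    split_ifs with h
    · subst h
      convert ((ht.liftEnds_unwrap hπ hξ).zpow_of_period x.2).add_period _ using 1
      push_cast; ring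
    · obtain ⟨s', -, h⟩ := (hl x List.mem_cons_self).exists_unwrap hπ ht.apply_mem (Ne.symm h) hξ
      rw [zero_add]
      exact (h.liftEnds_self.zpow_of_fixed _).add_period _

theorem exists_rewrite {m : ℂ → FundamentalGroup {z : ℂ // z ∉ V} hV.base} (hπ : LogCover V π)
    (hξ : t + Complex.exp ξ = y₀) (ht : hV.Meridian π y₀ (m t) t) {a : ℂ → ℂ}
    (ha : ∀ s, s ≠ t → hV.Meridian π y₀ (m s) s → t + Complex.exp (a s) = s ∧
      hV.Meridian (fun z => π (t + Complex.exp z)) ξ (m s) (a s))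
    {m' : ℂ → FundamentalGroup {z : ℂ // z ∉ V} hV.base}
    (hm' : ∀ s, s ≠ t → hV.Meridian π y₀ (m s) s → ∀ n : ℤ,
      m' (a s - n * (2 * Real.pi * Complex.I)) = m t ^ n * m s * m t ^ (-n))
    (l : List (ℂ × ℤ)) (hl : ∀ x ∈ l, hV.Meridian π y₀ (m x.1) x.1) (n : ℤ) :
    ∃ l', wordProd m' l' * m t ^ (n + expSum t l) = m t ^ n * wordProd m l ∧
      l'.length ≤ l.length ∧ ((∃ x ∈ l, x.1 = t) → l'.length < l.length) ∧
      ∀ x ∈ l', hV.Meridian (fun z => π (t + Complex.exp z)) ξ (m' x.1) x.1 := by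
  induction l generalizing n with
  | nil => exact ⟨[], by simp [wordProd, expSum], le_rfl, by simp, by simp⟩
  | cons x l ih =>
    have ih := ih fun x hx => hl x (List.mem_cons_of_mem _ hx)
    by_cases h : x.1 = t
    · obtain ⟨l', h1, h2, -, h4⟩ := ih (n + x.2)
      refine ⟨l', ?_, by simp; omega, fun _ => by simp; omega, h4⟩
      simp only [wordProd, expSum, List.map_cons, List.prod_cons, List.sum_cons, h, if_true]
        at h1 ⊢
      rw [← add_assoc, h1, zpow_add, mul_assoc]
    · obtain ⟨l', h1, h2, h3, h4⟩ := ih n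
      obtain ⟨h5, h6⟩ := ha x.1 h (hl x List.mem_cons_self)
      have h7 := hm' x.1 h (hl x List.mem_cons_self) n
      refine ⟨(a x.1 - n * (2 * Real.pi * Complex.I), x.2) :: l', ?_, by simpa using h2, ?_, ?_⟩
      · simp only [wordProd, expSum, List.map_cons, List.prod_cons, List.sum_cons, h, if_false]
          at h1 ⊢
        rw [h7, zero_add, mul_assoc, h1, zpow_neg, conj_zpow]
        group
      · rintro ⟨z, hz, rfl⟩
        rcases List.mem_cons.1 hz with rfl | hz
        · exact absurd rfl h
        · simpa using h3 ⟨z, hz, rfl⟩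
      · intro z hz
        rcases List.mem_cons.1 hz with rfl | hz
        · simp only [h7]
          exact h6.conj (ht.liftEnds_unwrap hπ hξ) n
        · exact h4 z hz

/-- Some logarithmic covering tells the class `g` apart from the powers of the generator at `1`. -/
def Separates (hV : ConeSeparated V κ) (g : FundamentalGroup {z : ℂ // z ∉ V} hV.base) : Prop :=
  ∃ (π : ℂ → ℂ) (y₀ w₀ y₁ w₁ : ℂ), LogCover V π ∧ ConeLift κ π 1 y₀ w₀ ∧ ConeLift κ π 1 y₁ w₁ ∧
    w₁ ≠ w₀ ∧ LiftEnds hV.base π y₀ g y₁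

theorem wordProd_eq_zpow_or_separates (h1 : (1 : ℂ) ∈ V)
    (m : ℂ → FundamentalGroup {z : ℂ // z ∉ V} hV.base) {w₀ : ℂ} (hπ : LogCover V π)
    (hw : ConeLift κ π 1 y₀ w₀) (hm : m w₀ = hV.gen 1) (l : List (ℂ × ℤ))
    (hl : ∀ x ∈ l, hV.Meridian π y₀ (m x.1) x.1) :
    (∃ n : ℤ, wordProd m l = hV.gen 1 ^ n) ∨ hV.Separates (wordProd m l) := by
  induction hN : l.length using Nat.strong_induction_on generalizing π y₀ w₀ m l with
  | _ N IH =>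
  by_cases hall : ∀ x ∈ l, x.1 = w₀
  · left
    clear IH hN hl
    induction l with
    | nil => exact ⟨0, by simp [wordProd]⟩
    | cons x l ih =>
      obtain ⟨n, hn⟩ := ih fun x hx => hall x (List.mem_cons_of_mem _ hx)
      refine ⟨x.2 + n, ?_⟩
      simp only [wordProd, List.map_cons, List.prod_cons] at hn ⊢
      rw [hn, hall x List.mem_cons_self, hm, zpow_add]
  push Not at hall
  obtain ⟨⟨t, e₀⟩, htl, htw : t ≠ w₀⟩ := hall
  have ht : hV.Meridian π y₀ (m t) t := hl _ htl
  have hyt : y₀ - t ≠ 0 := fun h => by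
    have := ht.apply_mem
    rw [← sub_eq_zero.1 h, hw.apply_source] at this
    exact hV.zero_notMem this
  obtain ⟨ξ, hξ⟩ : ∃ ξ, t + Complex.exp ξ = y₀ := ⟨Complex.log (y₀ - t), by
    rw [Complex.exp_log hyt]; ring⟩
  obtain ⟨w', hw', hw''⟩ := hV.coneLift_unwrap hw h1 htw ht.apply_mem hξ
  have hends := liftEnds_wordProd hπ hξ ht l hl
  by_cases he : expSum t l = 0
  · have ha : ∀ s, ∃ s', s ≠ t → hV.Meridian π y₀ (m s) s → (t + Complex.exp s' = s ∧
        hV.Meridian (fun z => π (t + Complex.exp z)) ξ (m s) s') ∧ (s = w₀ → s' = w') := by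
      intro s
      by_cases h : s = w₀
      · refine ⟨w', fun _ _ => ⟨⟨h ▸ hw', ?_⟩, fun _ => rfl⟩⟩
        rw [h, hm]
        exact .of_coneLift h1 hw''
      · by_cases h' : s ≠ t ∧ hV.Meridian π y₀ (m s) s
        · obtain ⟨s', h3⟩ := h'.2.exists_unwrap hπ ht.apply_mem h'.1.symm hξ
          exact ⟨s', fun _ _ => ⟨h3, fun h'' => absurd h'' h⟩⟩
        · exact ⟨0, fun h3 h4 => absurd ⟨h3, h4⟩ h'⟩
    choose a ha using ha
    let ν : ℂ → ℤ := fun z =>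
      round ((a (t + Complex.exp z) - z) / (2 * Real.pi * Complex.I)).re
    let m' : ℂ → FundamentalGroup {z : ℂ // z ∉ V} hV.base := fun z =>
      m t ^ ν z * m (t + Complex.exp z) * m t ^ (-ν z)
    have hm' : ∀ s, s ≠ t → hV.Meridian π y₀ (m s) s → ∀ n : ℤ,
        m' (a s - n * (2 * Real.pi * Complex.I)) = m t ^ n * m s * m t ^ (-n) := by
      intro s hs hs' n
      have h3 : t + Complex.exp (a s - n * (2 * Real.pi * Complex.I)) = s := by
        rw [Complex.exp_sub, Complex.exp_int_mul_two_pi_mul_I, div_one]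
        exact (ha s hs hs').1.1
      have h4 : ν (a s - n * (2 * Real.pi * Complex.I)) = n := by
        simp only [ν, h3, sub_sub_cancel]
        rw [mul_div_cancel_right₀ _ Complex.two_pi_I_ne_zero, Complex.intCast_re, round_intCast]
      simp only [m', h3, h4]
    obtain ⟨l', h3, -, h4, h5⟩ := exists_rewrite hπ hξ ht (fun s hs hs' => (ha s hs hs').1) hm' l
      hl 0
    rw [he, add_zero, zpow_zero, mul_one, one_mul] at h3
    have hw0 : hV.Meridian π y₀ (m w₀) w₀ := hm ▸ .of_coneLift h1 hw
    have hmw : m' w' = hV.gen 1 := by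
      have := hm' w₀ htw.symm hw0 0
      rwa [(ha w₀ htw.symm hw0).2 rfl, Int.cast_zero, zero_mul, sub_zero, neg_zero, zpow_zero,
        one_mul, mul_one, hm] at this
    rw [← h3]
    exact IH _ (hN ▸ h4 ⟨_, htl, rfl⟩) m' (hπ.unwrap ht.apply_mem) hw'' hmw l' h5 rfl
  · right
    refine ⟨_, ξ, w', _, _, hπ.unwrap ht.apply_mem, hw'', hw''.add_period (expSum t l), ?_, hends⟩
    simpa using he

theorem eq_zpow_or_separates (hfin : V.Finite) (h1 : (1 : ℂ) ∈ V)
    (g : FundamentalGroup {z : ℂ // z ∉ V} hV.base) :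
    (∃ n : ℤ, g = hV.gen 1 ^ n) ∨ hV.Separates g := by
  have hg : g ∈ Subgroup.closure (hV.gen '' V) := by
    rw [hV.closure_gen hfin]; trivial
  obtain ⟨l, hl, rfl⟩ : ∃ l : List (ℂ × ℤ), (∀ x ∈ l, x.1 ∈ V) ∧ wordProd hV.gen l = g := by
    induction hg using Subgroup.closure_induction with
    | mem x hx =>
      obtain ⟨v, hv, rfl⟩ := hx
      exact ⟨[(v, 1)], by simpa using hv, by simp [wordProd]⟩
    | one => exact ⟨[], by simp, by simp [wordProd]⟩
    | mul x y _ _ hx hy =>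
      obtain ⟨l, hl, rfl⟩ := hx
      obtain ⟨l', hl', rfl⟩ := hy
      refine ⟨l ++ l', fun x hx => ?_, by simp [wordProd]⟩
      rcases List.mem_append.1 hx with h | h
      exacts [hl x h, hl' x h]
    | inv x _ hx =>
      obtain ⟨l, hl, rfl⟩ := hx
      refine ⟨(l.map fun x => (x.1, -x.2)).reverse, fun x hx => ?_, ?_⟩
      · simp only [List.mem_reverse, List.mem_map] at hx
        obtain ⟨z, hz, rfl⟩ := hx
        exact hl z hz
      · simp [wordProd, List.prod_inv_reverse, Function.comp_def]
  exact wordProd_eq_zpow_or_separates h1 hV.gen .id (.id κ 1) rfl l fun x hx =>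
    .of_coneLift (hl x hx) (.id κ _)

end ConeSeparated

namespace ConeSeparated

variable {V : Set ℂ} {κ : ℝ} (hV : ConeSeparated V κ) {π : ℂ → ℂ} {y w ξ : ℂ}
include hV

theorem exists_log_lift_segment (hw : ConeLift κ π 1 y w)
    (hξ : w + Complex.exp ξ = y) :
    ∃ Φ : ℝ → ℂ, ContinuousOn Φ (Ico 0 1) ∧ (∀ s ∈ Ico (0:ℝ) 1, π (w + Complex.exp (Φ s)) = s) ∧
      Φ 0 = ξ ∧ ∀ B : ℝ, ∃ s ∈ Ico (0:ℝ) 1, (Φ s).re ≤ B := by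
  obtain ⟨f, hf, hfπ, rfl, rfl⟩ := hw
  have hmem : ∀ s : ℝ, 0 ≤ s → (s : ℂ) ∈ rayCone κ 1 := fun s hs => by
    simp [rayCone, mul_nonneg hV.pos.le hs]
  have hf' : ContinuousOn (fun s : ℝ => f s) (Icc 0 1) :=
    hf.comp Complex.continuous_ofReal.continuousOn fun s hs => hmem s hs.1
  have m0 : (0:ℝ) ∈ Ico (0:ℝ) 1 := by simp
  obtain ⟨Φ, hΦ, h2, h3⟩ := exists_continuousOn_log ((convex_Ico (0:ℝ) 1).starConvex m0) m0
    (h := fun s : ℝ => f s - f 1) ((hf'.mono Ico_subset_Icc_self).sub continuousOn_const)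
    (fun s hs h => by
      have := hfπ s (hmem s hs.1)
      rw [sub_eq_zero.1 h, hfπ 1 (by simpa using hmem 1 zero_le_one)] at this
      have : (1 : ℝ) = s := by exact_mod_cast this
      exact hs.2.ne this.symm) (w := ξ) (by simp [← hξ])
  refine ⟨Φ, hΦ, fun s hs => ?_, h3, fun B => ?_⟩
  · rw [h2 s hs, add_sub_cancel, hfπ _ (hmem s hs.1)]
  · have h4 : Filter.Tendsto (fun s : ℝ => ‖f s - f 1‖) (𝓝[Ico 0 1] 1) (𝓝 0) := by
      have := (hf' 1 (by simp)).mono (Ico_subset_Icc_self)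
      simpa using (this.tendsto.sub_const (f 1)).norm
    have h5 : (𝓝[Ico (0:ℝ) 1] 1).NeBot := by
      rw [nhdsWithin_Ico_eq_nhdsLT zero_lt_one]; infer_instance
    obtain ⟨s, h6, hs⟩ := ((h4.eventually_lt_const (Real.exp_pos B)).and self_mem_nhdsWithin).exists
    refine ⟨s, hs, ?_⟩
    rw [← h2 s hs, Complex.norm_exp] at h6
    exact (Real.exp_lt_exp.1 h6).le

/-- Loops whose lifts differ by a large multiple of the period have many crossings with each other
or with the segment `[0, 1)`, or many self-crossings. -/
theorem le_of_lift_shift (hw : ConeLift κ π 1 y w)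
    (hξ : w + Complex.exp ξ = y) {P Q P' Q' : ℝ → ℂ} (hP' : Continuous P') (hQ' : Continuous Q')
    (hP : ∀ t ∈ Icc (0:ℝ) 1, π (w + Complex.exp (P' t)) = P t)
    (hQ : ∀ t ∈ Icc (0:ℝ) 1, π (w + Complex.exp (Q' t)) = Q t) (hP0 : P' 0 = ξ) (hQ0 : Q' 0 = ξ)
    {A : ℕ} (hA : P' 1 = Q' 1 + A * (2 * Real.pi * Complex.I)) (hP1 : P 1 = 0) (hQ1 : Q 1 = 0)
    (HP HQ : Finset ℝ) (SP SQ J : Finset (ℝ × ℝ))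
    (hHP : ∀ t ∈ Ioc (0:ℝ) 1, ∀ s ∈ Ico (0:ℝ) 1, P t = s → t ∈ HP)
    (hHQ : ∀ t ∈ Ioc (0:ℝ) 1, ∀ s ∈ Ico (0:ℝ) 1, Q t = s → t ∈ HQ)
    (hSP : ∀ t ∈ Ioo (0:ℝ) 1, ∀ u ∈ Ioo (0:ℝ) 1, t < u → P t = P u → (t, u) ∈ SP)
    (hSQ : ∀ t ∈ Ioo (0:ℝ) 1, ∀ u ∈ Ioo (0:ℝ) 1, t < u → Q t = Q u → (t, u) ∈ SQ)
    (hJ : ∀ t ∈ Ioo (0:ℝ) 1, ∀ u ∈ Ioo (0:ℝ) 1, P t = Q u → (t, u) ∈ J) :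
    A ≤ 4 * HP.card + 4 * HQ.card + SP.card + SQ.card + J.card + 1 := by
  classical
  obtain ⟨Φ, hΦ, hΦπ, hΦ0, hΦB⟩ := hV.exists_log_lift_segment hw hξ
  have hb : ∀ F : ℝ → ℂ, Continuous F → ∃ B : ℝ, ∀ t ∈ Icc (0:ℝ) 1, B ≤ (F t).re := by
    intro F hF
    obtain ⟨t, -, ht⟩ := isCompact_Icc.exists_isMinOn (nonempty_Icc.2 (zero_le_one (α := ℝ)))
      (Complex.continuous_re.comp hF).continuousOn
    exact ⟨_, fun u hu => ht hu⟩
  obtain ⟨B₁, hB₁⟩ := hb P' hP'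
  obtain ⟨B₂, hB₂⟩ := hb Q' hQ'
  obtain ⟨S₁, hS₁, hS₁B⟩ := hΦB (min B₁ B₂)
  have hsub : Icc 0 S₁ ⊆ Ico (0:ℝ) 1 := fun s hs => ⟨hs.1, hs.2.trans_lt hS₁.2⟩
  obtain ⟨S, hS, hSmin⟩ := isCompact_Icc.exists_isMinOn (nonempty_Icc.2 hS₁.1)
    (Complex.continuous_re.comp_continuousOn (hΦ.mono hsub))
  have hS1 : S < 1 := hS.2.trans_lt hS₁.2
  have hsub' : Icc 0 S ⊆ Icc 0 S₁ := Icc_subset_Icc_right hS.2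
  have hSB : (Φ S).re ≤ min B₁ B₂ := (hSmin (right_mem_Icc.2 hS₁.1)).trans hS₁B
  let Ψ : ℝ → ℂ := IccExtend hS.1 ((Icc 0 S).domRestrict Φ)
  have hΨ : Continuous Ψ :=
    (continuousOn_iff_continuous_domRestrict.1 (hΦ.mono (hsub'.trans hsub))).Icc_extend'
  have hΨeq : ∀ s ∈ Icc 0 S, Ψ s = Φ s := fun s hs => by
    simp only [Ψ]; rw [IccExtend_of_mem _ _ hs]; rfl
  let ext : (ℝ → ℂ) → ℝ → ℂ := fun F t => if t ≤ 0 then Ψ (-t) else F t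
  have hext : ∀ F : ℝ → ℂ, Continuous F → F 0 = ξ → Continuous (ext F) := by
    intro F hF h0
    refine Continuous.if_le (by fun_prop) hF continuous_id continuous_const ?_
    rintro x rfl
    rw [neg_zero, h0, hΨeq 0 (left_mem_Icc.2 hS.1), hΦ0]
  have hneg : ∀ F t, t ∈ Icc (-S) 0 → ext F t = Φ (-t) := fun F t ht => by
    simp only [ext, if_pos ht.2]
    exact hΨeq _ ⟨by linarith [ht.2], by linarith [ht.1]⟩
  have hpos : ∀ F t, 0 < t → ext F t = F t := fun F t ht => by simp only [ext, if_neg ht.not_ge]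
  have hre : ∀ F : ℝ → ℂ, (∀ t ∈ Icc (0:ℝ) 1, min B₁ B₂ ≤ (F t).re) → ∀ t ∈ Icc (-S) 1,
      (Φ S).re ≤ (ext F t).re := by
    intro F hF t ht
    rcases le_or_gt t 0 with h | h
    · rw [hneg F t ⟨ht.1, h⟩]
      exact hSmin ⟨by linarith, (neg_le.1 ht.1).trans hS.2⟩
    · rw [hpos F t h]
      exact hSB.trans (hF t ⟨h.le, ht.2⟩)
  let D : ℂ → ℂ → ℝ := fun z w => ((z - w) / (2 * Real.pi * Complex.I)).re
  have hD : ∀ (z w : ℂ) (r : ℝ), z = w + r * (2 * Real.pi * Complex.I) → D z w = r := by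
    rintro z w r rfl
    simp only [D, add_sub_cancel_left, mul_div_cancel_right₀ _ Complex.two_pi_I_ne_zero,
      Complex.ofReal_re]
  have hper : ∀ (z w' : ℂ) (n : ℤ), z = w' + n * (2 * Real.pi * Complex.I) →
      π (w + Complex.exp z) = π (w + Complex.exp w') := by
    rintro z w' n rfl
    rw [Complex.exp_add, Complex.exp_int_mul_two_pi_mul_I, mul_one]
  let T : Finset ℝ :=
    HQ.image (fun u => |A - D (Φ (Q u).re) (Q' u)|) ∪
        HP.image (fun t => |A - D (P' t) (Φ (P t).re)|)
    ∪ J.image (fun x => |A - D (P' x.1) (Q' x.2)|) ∪ HQ.image (fun u => |A - D (P' 1) (Q' u)|)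
    ∪ HP.image (fun t => |A - D (P' t) (Q' 1)|)
    ∪ (HP.image (fun t => |D (P' t) (Φ (P t).re)|) ∪ HP.image (fun t => |D (P' t) (P' 1)|)
      ∪ SP.image (fun x => |D (P' x.1) (P' x.2)|))
    ∪ (HQ.image (fun t => |D (Q' t) (Φ (Q t).re)|) ∪ HQ.image (fun t => |D (Q' t) (Q' 1)|)
      ∪ SQ.image (fun x => |D (Q' x.1) (Q' x.2)|))
  have hTcard : T.card ≤ HQ.card + HP.card + J.card + HQ.card + HP.card
      + (HP.card + HP.card + SP.card) + (HQ.card + HQ.card + SQ.card) := by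
    have cu : ∀ (X Y : Finset ℝ) (a b : ℕ), X.card ≤ a → Y.card ≤ b → (X ∪ Y).card ≤ a + b :=
      fun X Y a b h h' => (Finset.card_union_le X Y).trans (add_le_add h h')
    repeat' first | exact Finset.card_image_le | refine cu _ _ _ _ ?_ ?_
  -- self-crossings of an extended lift
  have self : ∀ (F' F : ℝ → ℂ) (H : Finset ℝ) (SF : Finset (ℝ × ℝ)),
      (∀ t ∈ Icc (0:ℝ) 1, π (w + Complex.exp (F' t)) = F t) → F 1 = 0 →
      (∀ t ∈ Ioc (0:ℝ) 1, ∀ s ∈ Ico (0:ℝ) 1, F t = s → t ∈ H) →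
      (∀ t ∈ Ioo (0:ℝ) 1, ∀ u ∈ Ioo (0:ℝ) 1, t < u → F t = F u → (t, u) ∈ SF) →
      ∀ t ∈ Icc (-S) 1, ∀ u ∈ Icc (-S) 1, ∀ j : ℤ, j ≠ 0 → t < u →
        ext F' t = ext F' u + j * (2 * Real.pi * Complex.I) →
        |(j : ℝ)| ∈ H.image (fun t => |D (F' t) (Φ (F t).re)|) ∪
            H.image (fun t => |D (F' t) (F' 1)|)
          ∪ SF.image (fun x => |D (F' x.1) (F' x.2)|) := by
    intro F' F H SF hF hF1 hH hSF t ht u hu j hj htu he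
    have hπe := hper _ _ j he
    have he' : ext F' u = ext F' t + ((-j : ℤ) : ℝ) * (2 * Real.pi * Complex.I) := by
      rw [he]; push_cast; ring
    simp only [Finset.mem_union, Finset.mem_image]
    rcases le_or_gt u 0 with h | h
    · exfalso
      rw [hneg _ _ ⟨ht.1, htu.le.trans h⟩, hneg _ _ ⟨hu.1, h⟩, hΦπ, hΦπ] at hπe
      · have : -t = -u := by exact_mod_cast hπe
        linarith
      · exact ⟨by linarith, by linarith [hu.1]⟩
      · exact ⟨by linarith, by linarith [ht.1]⟩
    rcases le_or_gt t 0 with h' | h'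
    · rw [hneg _ _ ⟨ht.1, h'⟩, hpos _ _ h] at hπe he'
      rw [hF u ⟨h.le, hu.2⟩, hΦπ _ ⟨by linarith, by linarith [ht.1]⟩] at hπe
      refine .inl (.inl ⟨u, hH u ⟨h, hu.2⟩ (-t) ⟨by linarith, by linarith [ht.1]⟩ hπe.symm, ?_⟩)
      rw [← hπe, Complex.ofReal_re, hD _ _ _ he', Int.cast_neg, abs_neg]
    rw [hpos _ _ h', hpos _ _ h] at hπe he
    rw [hF u ⟨h.le, hu.2⟩, hF t ⟨h'.le, ht.2⟩] at hπe
    rcases hu.2.eq_or_lt with rfl | h1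
    · refine .inl (.inr ⟨t, hH t ⟨h', ht.2⟩ 0 (by simp) (by simp [hπe, hF1]), ?_⟩)
      rw [hD _ _ j (by rw [he]; simp)]
    · refine .inr ⟨(t, u), hSF t ⟨h', htu.trans h1⟩ u ⟨h, h1⟩ htu hπe, ?_⟩
      rw [hD _ _ j (by rw [he]; simp)]
  have self' : ∀ (F' F : ℝ → ℂ) (H : Finset ℝ) (SF : Finset (ℝ × ℝ)),
      (∀ t ∈ Icc (0:ℝ) 1, π (w + Complex.exp (F' t)) = F t) → F 1 = 0 →
      (∀ t ∈ Ioc (0:ℝ) 1, ∀ s ∈ Ico (0:ℝ) 1, F t = s → t ∈ H) →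
      (∀ t ∈ Ioo (0:ℝ) 1, ∀ u ∈ Ioo (0:ℝ) 1, t < u → F t = F u → (t, u) ∈ SF) →
      ∀ t ∈ Icc (-S) 1, ∀ u ∈ Icc (-S) 1, ∀ m : ℕ, 0 < m →
        ext F' t = ext F' u + m * (2 * Real.pi * Complex.I) →
        (m : ℝ) ∈ H.image (fun t => |D (F' t) (Φ (F t).re)|) ∪ H.image (fun t => |D (F' t) (F' 1)|)
          ∪ SF.image (fun x => |D (F' x.1) (F' x.2)|) := by
    intro F' F H SF hF hF1 hH hSF t ht u hu m hm he
    rcases lt_trichotomy t u with h | rfl | h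
    · simpa using self F' F H SF hF hF1 hH hSF t ht u hu m (by omega) h (by simpa using he)
    · simp [hm.ne'] at he
    · have := self F' F H SF hF hF1 hH hSF u hu t ht (-m) (by omega) h (by rw [he]; push_cast; ring)
      simpa using this
  have cross : ∀ t ∈ Icc (-S) 1, ∀ u ∈ Icc (-S) 1, ∀ j : ℤ, j ≠ 0 → j ≠ A →
      ext P' t = ext Q' u + j * (2 * Real.pi * Complex.I) → |(A : ℝ) - j| ∈ T := by
    intro t ht u hu j hj hjA he
    have hπe := hper _ _ j he
    have he' : ext P' t = ext Q' u + (j : ℝ) * (2 * Real.pi * Complex.I) := by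
      rw [he]; push_cast; ring
    simp only [T, Finset.mem_union]
    left; left
    simp only [Finset.mem_image]
    rcases le_or_gt u 0 with h | h <;> rcases le_or_gt t 0 with h' | h'
    · exfalso
      rw [hneg _ _ ⟨ht.1, h'⟩, hneg _ _ ⟨hu.1, h⟩] at hπe he'
      rw [hΦπ _ ⟨by linarith, by linarith [ht.1]⟩, hΦπ _ ⟨by linarith, by linarith [hu.1]⟩] at hπe
      have : -t = -u := by exact_mod_cast hπe
      rw [this] at he'
      simp [hj] at he'
    · rw [hpos _ _ h', hneg _ _ ⟨hu.1, h⟩] at hπe he'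
      rw [hP t ⟨h'.le, ht.2⟩, hΦπ _ ⟨by linarith, by linarith [hu.1]⟩] at hπe
      refine .inl (.inl (.inl (.inr ⟨t, hHP t ⟨h', ht.2⟩ (-u) ⟨by linarith, by linarith [hu.1]⟩ hπe,
        ?_⟩)))
      rw [hπe, Complex.ofReal_re, hD _ _ _ he']
    · rw [hpos _ _ h, hneg _ _ ⟨ht.1, h'⟩] at hπe he'
      rw [hQ u ⟨h.le, hu.2⟩, hΦπ _ ⟨by linarith, by linarith [ht.1]⟩] at hπe
      refine .inl (.inl (.inl (.inl ⟨u, hHQ u ⟨h, hu.2⟩ (-t) ⟨by linarith, by linarith [ht.1]⟩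
        hπe.symm, ?_⟩)))
      rw [← hπe, Complex.ofReal_re, hD _ _ _ he']
    · rw [hpos _ _ h', hpos _ _ h] at hπe he'
      rw [hP t ⟨h'.le, ht.2⟩, hQ u ⟨h.le, hu.2⟩] at hπe
      rcases hu.2.eq_or_lt with rfl | h1
      · refine .inr ⟨t, hHP t ⟨h', ht.2⟩ 0 (by simp) (by simp [hπe, hQ1]), ?_⟩
        rw [hD _ _ _ he']
      rcases ht.2.eq_or_lt with rfl | h2
      · refine .inl (.inr ⟨u, hHQ u ⟨h, hu.2⟩ 0 (by simp) (by simp [← hπe, hP1]), ?_⟩)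
        rw [hD _ _ _ he']
      · refine .inl (.inl (.inr ⟨(t, u), hJ t ⟨h', h2⟩ u ⟨h, h1⟩ hπe, ?_⟩))
        rw [hD _ _ _ he']
  have hsubset : ((Finset.Icc 1 (A - 1)).image fun m : ℕ => (m : ℝ)) ⊆ T := by
    intro r hr
    obtain ⟨m, hm, rfl⟩ := Finset.mem_image.1 hr
    rw [Finset.mem_Icc] at hm
    have hAm : m < A := by omega
    have e1 : ∀ F' : ℝ → ℂ, ext F' (-S) = Φ S := fun F' => by
      rw [hneg _ _ ⟨le_rfl, by linarith [hS.1]⟩, neg_neg]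
    obtain ⟨t, ht, u, hu, h | h | h | h⟩ := exists_crossing (a := -S) (b := 1)
      (f := ext P') (g := ext Q') (z := Φ S) (e := Q' 1) (A := A) (m := m) (by linarith [hS.1])
      (hext P' hP' hP0).continuousOn (hext Q' hQ' hQ0).continuousOn (e1 _) (e1 _)
      (by rw [hpos _ _ zero_lt_one]) (by rw [hpos _ _ zero_lt_one, hA]; simp)
      (hre P' fun t ht => (min_le_left _ _).trans (hB₁ t ht))
      (hre Q' fun t ht => (min_le_right _ _).trans (hB₂ t ht))
      (by exact_mod_cast hm.1) (by exact_mod_cast hAm)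
    · have := cross t ht u hu (A - m) (by omega) (by omega) (by rw [h]; push_cast; ring)
      simpa using this
    · have := cross t ht u hu (A + m) (by omega) (by omega) (by rw [h]; push_cast; ring)
      simpa using this
    · have := self' P' P HP SP hP hP1 hHP hSP t ht u hu m (by omega) (by rw [h]; simp)
      simp only [T]
      exact Finset.mem_union_left _ (Finset.mem_union_right _ this)
    · have := self' Q' Q HQ SQ hQ hQ1 hHQ hSQ t ht u hu m (by omega) (by rw [h]; simp)
      simp only [T]
      exact Finset.mem_union_right _ this
  have := Finset.card_le_card hsubset
  rw [Finset.card_image_of_injective _ Nat.cast_injective, Nat.card_Icc] at this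
  omega

end ConeSeparated

theorem LiftEnds.exists_path_lift {V : Set ℂ} {x₀ : {z : ℂ // z ∉ V}} {π : ℂ → ℂ} {y y' : ℂ}
    (hπ : LogCover V π) {p : Path x₀ x₀} (H : LiftEnds x₀ π y (loopClass p) y') :
    ∃ L : Path y y', ∀ t, π (L t) = p t := by
  obtain ⟨L, hL, h1, h2⟩ := hπ.exists_lift (E := ℝ) ((convex_Icc 0 1).starConvex
    (left_mem_Icc.2 zero_le_one)) (left_mem_Icc.2 zero_le_one) (h := fun t => p.extend t)
    (by fun_prop) (fun t _ => (p.extend t).2) (w := y) (by simp [H.source_eq])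
  have hLp : ∀ t : I, π (L t) = p t := fun t => by simpa using h1 t t.2
  let L' : Path y (L 1) := ⟨⟨fun t => L t, hL.comp_continuous (by fun_prop) fun t => t.2⟩,
    by simp [h2], by simp⟩
  have : L 1 = y' := LiftEnds.unique hπ ⟨p, L', rfl, hLp⟩ H
  exact ⟨L'.cast rfl this.symm, hLp⟩

namespace ConeSeparated

variable {V : Set ℂ} {κ : ℝ} (hV : ConeSeparated V κ) {π : ℂ → ℂ} {y w ξ : ℂ}
  {P Q : Path hV.base hV.base} {k : ℕ}

/-- The loop meets the segment `[0, 1)` fewer than `k` times. -/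
def FewHits (k : ℕ) (P : Path hV.base hV.base) : Prop :=
  ∃ H : Finset ℝ, H.card < k ∧ ∀ t ∈ Ioo (0:ℝ) 1, ∀ s ∈ Ico (0:ℝ) 1, (P.extend t : ℂ) = s → t ∈ H

/-- The loops have fewer than `k` intersections. -/
def FewCrossings (k : ℕ) (P Q : Path hV.base hV.base) : Prop :=
  ∃ J : Finset (ℝ × ℝ), J.card < k ∧
    ∀ t ∈ Ioo (0:ℝ) 1, ∀ u ∈ Ioo (0:ℝ) 1, P.extend t = Q.extend u → (t, u) ∈ J

/-- The loop has fewer than `k` self-intersections. -/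
def FewSelfCrossings (k : ℕ) (P : Path hV.base hV.base) : Prop :=
  ∃ J : Finset (ℝ × ℝ), J.card < k ∧
    ∀ t ∈ Ioo (0:ℝ) 1, ∀ u ∈ Ioo (0:ℝ) 1, t < u → P.extend t = P.extend u → (t, u) ∈ J

variable {hV}

theorem FewCrossings.swap (h : hV.FewCrossings k P Q) : hV.FewCrossings k Q P := by
  classical
  obtain ⟨J, h1, h2⟩ := h
  refine ⟨J.image Prod.swap, Finset.card_image_le.trans_lt h1, fun t ht u hu e => ?_⟩
  exact Finset.mem_image.2 ⟨(u, t), h2 u hu t ht e.symm, rfl⟩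

theorem FewCrossings.symm (h : hV.FewCrossings k P Q) : hV.FewCrossings k P.symm Q.symm := by
  classical
  obtain ⟨J, h1, h2⟩ := h
  refine ⟨J.image fun x => (1 - x.1, 1 - x.2), Finset.card_image_le.trans_lt h1,
    fun t ht u hu e => ?_⟩
  rw [Path.extend_symm_apply, Path.extend_symm_apply] at e
  exact Finset.mem_image.2 ⟨_, h2 (1 - t) ⟨by linarith [ht.2], by linarith [ht.1]⟩ (1 - u)
    ⟨by linarith [hu.2], by linarith [hu.1]⟩ e, by simp⟩

theorem FewSelfCrossings.symm (h : hV.FewSelfCrossings k P) : hV.FewSelfCrossings k P.symm := by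
  classical
  obtain ⟨J, h1, h2⟩ := h
  refine ⟨J.image fun x => (1 - x.2, 1 - x.1), Finset.card_image_le.trans_lt h1,
    fun t ht u hu htu e => ?_⟩
  rw [Path.extend_symm_apply, Path.extend_symm_apply] at e
  exact Finset.mem_image.2 ⟨_, h2 (1 - u) ⟨by linarith [hu.2], by linarith [hu.1]⟩ (1 - t)
    ⟨by linarith [ht.2], by linarith [ht.1]⟩ (by linarith) e.symm, by simp⟩

theorem FewHits.symm (h : hV.FewHits k P) : hV.FewHits k P.symm := by
  classical
  obtain ⟨H, h1, h2⟩ := h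
  refine ⟨H.image fun x => 1 - x, Finset.card_image_le.trans_lt h1, fun t ht s hs e => ?_⟩
  rw [Path.extend_symm_apply] at e
  exact Finset.mem_image.2 ⟨_, h2 (1 - t) ⟨by linarith [ht.2], by linarith [ht.1]⟩ s hs e, by simp⟩

theorem le_of_liftEnds (hπ : LogCover V π) (h1 : (1 : ℂ) ∈ V) (hw : ConeLift κ π 1 y w)
    (hξ : w + Complex.exp ξ = y) (hHP : hV.FewHits k P) (hHQ : hV.FewHits k Q)
    (hSP : hV.FewSelfCrossings k P) (hSQ : hV.FewSelfCrossings k Q) (hJ : hV.FewCrossings k P Q)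
    {ξP ξQ : ℂ} (hP : LiftEnds hV.base (fun z => π (w + Complex.exp z)) ξ (loopClass P) ξP)
    (hQ : LiftEnds hV.base (fun z => π (w + Complex.exp z)) ξ (loopClass Q) ξQ)
    {A : ℕ} (hA : ξP = ξQ + A * (2 * Real.pi * Complex.I)) : A + 2 ≤ 11 * k := by
  classical
  have hπ' := hπ.unwrap (s := w) (by rw [hV.coneLift_apply hw h1]; exact h1)
  obtain ⟨L, hL⟩ := hP.exists_path_lift hπ'
  obtain ⟨L', hL'⟩ := hQ.exists_path_lift hπ'
  obtain ⟨H, hH, hH'⟩ := hHP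
  obtain ⟨K, hK, hK'⟩ := hHQ
  obtain ⟨S, hS, hS'⟩ := hSP
  obtain ⟨R, hR, hR'⟩ := hSQ
  obtain ⟨J, hJ, hJ'⟩ := hJ
  have ins : ∀ (H : Finset ℝ) (F : Path hV.base hV.base),
      (∀ t ∈ Ioo (0:ℝ) 1, ∀ s ∈ Ico (0:ℝ) 1, (F.extend t : ℂ) = s → t ∈ H) →
      ∀ t ∈ Ioc (0:ℝ) 1, ∀ s ∈ Ico (0:ℝ) 1, (F.extend t : ℂ) = s → t ∈ insert 1 H := by
    intro H F hH t ht s hs e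
    rcases ht.2.eq_or_lt with rfl | h
    · exact Finset.mem_insert_self _ _
    · exact Finset.mem_insert_of_mem (hH t ⟨ht.1, h⟩ s hs e)
  have := hV.le_of_lift_shift hw hξ (P := fun t => P.extend t) (Q := fun t => Q.extend t)
    L.continuous_extend L'.continuous_extend
    (fun t ht => by rw [Path.extend_apply _ ht, Path.extend_apply _ ht]; exact hL _)
    (fun t ht => by rw [Path.extend_apply _ ht, Path.extend_apply _ ht]; exact hL' _)
    (by simp) (by simp) (A := A) (by simpa using hA) (by simp) (by simp)
    (insert 1 H) (insert 1 K) S R J (ins H P hH') (ins K Q hK')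
    (fun t ht u hu htu e => hS' t ht u hu htu (Subtype.ext e))
    (fun t ht u hu htu e => hR' t ht u hu htu (Subtype.ext e))
    (fun t ht u hu e => hJ' t ht u hu (Subtype.ext e))
  have := Finset.card_insert_le 1 H
  have := Finset.card_insert_le 1 K
  omega

theorem abs_le_of_liftEnds (hπ : LogCover V π) (h1 : (1 : ℂ) ∈ V) (hw : ConeLift κ π 1 y w)
    (hξ : w + Complex.exp ξ = y) (hHP : hV.FewHits k P) (hHQ : hV.FewHits k Q)
    (hSP : hV.FewSelfCrossings k P) (hSQ : hV.FewSelfCrossings k Q) (hJ : hV.FewCrossings k P Q)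
    {ξP ξQ : ℂ} (hP : LiftEnds hV.base (fun z => π (w + Complex.exp z)) ξ (loopClass P) ξP)
    (hQ : LiftEnds hV.base (fun z => π (w + Complex.exp z)) ξ (loopClass Q) ξQ)
    {a : ℤ} (ha : ξP = ξQ + a * (2 * Real.pi * Complex.I)) : |a| < 11 * k := by
  rcases le_total 0 a with h | h
  · lift a to ℕ using h
    have := le_of_liftEnds hπ h1 hw hξ hHP hHQ hSP hSQ hJ hP hQ (A := a) (by simpa using ha)
    rw [Nat.abs_cast]; omega
  · obtain ⟨b, rfl⟩ := Int.exists_eq_neg_ofNat h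
    have := le_of_liftEnds hπ h1 hw hξ hHQ hHP hSQ hSP hJ.swap hQ hP (A := b) (by simp [ha])
    rw [abs_neg, Nat.abs_cast]; omega

/-- The exponents of loops running around a single puncture differ by a bounded amount. -/
theorem abs_sub_lt_of_zpow (h1 : (1 : ℂ) ∈ V) (hHP : hV.FewHits k P) (hHQ : hV.FewHits k Q)
    (hSP : hV.FewSelfCrossings k P) (hSQ : hV.FewSelfCrossings k Q) (hJ : hV.FewCrossings k P Q)
    {p q : ℤ} (hp : loopClass P = hV.gen 1 ^ p) (hq : loopClass Q = hV.gen 1 ^ q) :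
    |p - q| < 11 * k := by
  have hw := ConeLift.id κ 1
  have hξ : (1 : ℂ) + Complex.exp (Real.pi * Complex.I) = 0 := by simp [Complex.exp_pi_mul_I]
  have key := hV.liftEnds_gen_unwrap .id hw h1 hξ
  have kp := LiftEnds.zpow_of_period (π := fun z => z) key p
  have kq := LiftEnds.zpow_of_period (π := fun z => z) key q
  rw [← hp] at kp
  rw [← hq] at kq
  refine abs_le_of_liftEnds .id h1 hw hξ hHP hHQ hSP hSQ hJ kp kq ?_
  push_cast; ring

/-- In a fixed double coset, the exponent on the right varies by a bounded amount. -/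
theorem abs_lt_of_eq_zpow_mul (hfin : V.Finite) (h1 : (1 : ℂ) ∈ V) (hHP : hV.FewHits k P)
    (hHQ : hV.FewHits k Q) (hSP : hV.FewSelfCrossings k P) (hSQ : hV.FewSelfCrossings k Q)
    (hJ : hV.FewCrossings k P Q) (hn : ∀ n : ℤ, loopClass Q ≠ hV.gen 1 ^ n) {a b : ℤ}
    (h : loopClass P = hV.gen 1 ^ b * loopClass Q * hV.gen 1 ^ a) : |a| < 11 * k := by
  rcases hV.eq_zpow_or_separates hfin h1 (loopClass Q) with ⟨n, h'⟩ | ⟨π, y₀, w₀, y₁, w₁, hπ, hw₀,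
    hw₁, hne, hQ⟩
  · exact absurd h' (hn n)
  have hy : y₀ ≠ w₀ := fun e => by
    have e1 := hV.coneLift_apply hw₀ h1
    rw [← e, hw₀.apply_source] at e1
    exact zero_ne_one e1
  have hξ : w₀ + Complex.exp (Complex.log (y₀ - w₀)) = y₀ := by
    rw [Complex.exp_log (sub_ne_zero.2 hy), add_sub_cancel]
  have hw₀V : π w₀ ∈ V := by rw [hV.coneLift_apply hw₀ h1]; exact h1
  obtain ⟨ξ₁, hξ₁, hQ'⟩ := hQ.exists_unwrap hπ hw₀V hξ
  obtain ⟨s', -, hs'⟩ := hV.coneLift_unwrap hw₁ h1 hne.symm hw₀V hξ₁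
  have hb := ((hV.liftEnds_gen_of_coneLift hs' h1).zpow_of_fixed b).add_period a
  have ha := (hV.liftEnds_gen_unwrap hπ hw₀ h1 hξ).zpow_of_period a
  have hP := ha.mul ((hQ'.add_period a).mul hb)
  rw [← h] at hP
  exact abs_le_of_liftEnds hπ h1 hw₀ hξ hHP hHQ hSP hSQ hJ hP hQ' rfl

theorem abs_lt_of_eq_zpow_mul' (hfin : V.Finite) (h1 : (1 : ℂ) ∈ V) (hHP : hV.FewHits k P)
    (hHQ : hV.FewHits k Q) (hSP : hV.FewSelfCrossings k P) (hSQ : hV.FewSelfCrossings k Q)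
    (hJ : hV.FewCrossings k P Q) (hn : ∀ n : ℤ, loopClass Q ≠ hV.gen 1 ^ n) {a b : ℤ}
    (h : loopClass P = hV.gen 1 ^ b * loopClass Q * hV.gen 1 ^ a) : |b| < 11 * k := by
  rw [← abs_neg]
  refine abs_lt_of_eq_zpow_mul (P := P.symm) (Q := Q.symm) (a := -b) (b := -a) hfin h1 hHP.symm
    hHQ.symm hSP.symm hSQ.symm hJ.symm (fun n hn' => hn (-n) ?_) ?_
  · rw [zpow_neg, ← hn', loopClass_inv, Path.symm_symm]
  · rw [← loopClass_inv, ← loopClass_inv, h, mul_inv_rev, mul_inv_rev, ← mul_assoc, zpow_neg,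
      zpow_neg]

end ConeSeparated

theorem Finset.exists_Ico_of_abs_sub_lt {ι : Type*} (s : Finset ι) (f : ι → ℤ) {N : ℕ}
    (h : ∀ i ∈ s, ∀ j ∈ s, |f i - f j| < N) : ∃ m : ℤ, ∀ i ∈ s, f i ∈ Finset.Ico m (m + N) := by
  rcases s.eq_empty_or_nonempty with rfl | hs
  · exact ⟨0, by simp⟩
  obtain ⟨j, hj, hmin⟩ := s.exists_min_image f hs
  refine ⟨f j, fun i hi => Finset.mem_Ico.2 ⟨hmin i hi, ?_⟩⟩
  linarith [(abs_lt.1 (h i hi j hj)).2]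

namespace ConeSeparated

variable {V : Set ℂ} {κ : ℝ} {hV : ConeSeparated V κ} {ι : Type*} {P : ι → Path hV.base hV.base}
  {k : ℕ}

theorem card_le_of_zpow_mul (hfin : V.Finite) (h1 : (1 : ℂ) ∈ V) (hk : 1 ≤ k)
    (hH : ∀ i, hV.FewHits k (P i)) (hS : ∀ i, hV.FewSelfCrossings k (P i))
    (hJ : ∀ i j, i ≠ j → hV.FewCrossings k (P i) (P j))
    (hinj : ∀ i j, i ≠ j → loopClass (P i) ≠ loopClass (P j)) (s : Finset ι)
    {g : FundamentalGroup {z : ℂ // z ∉ V} hV.base} {a b : ι → ℤ}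
    (hs : ∀ i ∈ s, loopClass (P i) = hV.gen 1 ^ b i * g * hV.gen 1 ^ a i) :
    s.card ≤ 121 * k ^ 2 := by
  by_cases hg : ∃ n : ℤ, g = hV.gen 1 ^ n
  · obtain ⟨n, rfl⟩ := hg
    have hs' : ∀ i ∈ s, loopClass (P i) = hV.gen 1 ^ (b i + n + a i) := fun i hi => by
      rw [hs i hi, zpow_add, zpow_add]
    obtain ⟨m, hm⟩ := s.exists_Ico_of_abs_sub_lt (N := 11 * k) (fun i => b i + n + a i)
      fun i hi j hj => by
        rcases eq_or_ne i j with rfl | hij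
        · rw [sub_self, abs_zero]; exact_mod_cast (show 0 < 11 * k by omega)
        · exact_mod_cast abs_sub_lt_of_zpow h1 (hH i) (hH j) (hS i) (hS j) (hJ i j hij)
            (hs' i hi) (hs' j hj)
    have := Finset.card_le_card_of_injOn (fun i => b i + n + a i) hm fun i hi j hj e => by
      by_contra hij
      exact hinj i j hij (by rw [hs' i hi, hs' j hj]; exact congrArg _ e)
    rw [Int.card_Ico, add_sub_cancel_left, Int.toNat_natCast] at this
    nlinarith
  · push Not at hg
    have hn : ∀ i ∈ s, ∀ n : ℤ, loopClass (P i) ≠ hV.gen 1 ^ n := fun i hi n hn => by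
      refine hg (-(b i) + n - a i) ?_
      rw [zpow_sub, zpow_add, zpow_neg, ← hn, hs i hi]
      group
    have hij : ∀ i ∈ s, ∀ j ∈ s, loopClass (P i) =
        hV.gen 1 ^ (b i - b j) * loopClass (P j) * hV.gen 1 ^ (a i - a j) := fun i hi j hj => by
      rw [hs i hi, hs j hj]
      group
    obtain ⟨m, hm⟩ := s.exists_Ico_of_abs_sub_lt (N := 11 * k) a fun i hi j hj => by
      rcases eq_or_ne i j with rfl | hne
      · rw [sub_self, abs_zero]; exact_mod_cast (show 0 < 11 * k by omega)
      · exact_mod_cast abs_lt_of_eq_zpow_mul hfin h1 (hH i) (hH j) (hS i) (hS j) (hJ i j hne)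
          (hn j hj) (hij i hi j hj)
    obtain ⟨l, hl⟩ := s.exists_Ico_of_abs_sub_lt (N := 11 * k) b fun i hi j hj => by
      rcases eq_or_ne i j with rfl | hne
      · rw [sub_self, abs_zero]; exact_mod_cast (show 0 < 11 * k by omega)
      · exact_mod_cast abs_lt_of_eq_zpow_mul' hfin h1 (hH i) (hH j) (hS i) (hS j) (hJ i j hne)
          (hn j hj) (hij i hi j hj)
    have := Finset.card_le_card_of_injOn (s := s)
      (t := Finset.Ico m (m + (11 * k : ℕ)) ×ˢ Finset.Ico l (l + (11 * k : ℕ)))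
      (fun i => (a i, b i)) (fun i hi => Finset.mem_product.2 ⟨hm i hi, hl i hi⟩)
      fun i hi j hj e => by
        by_contra hij
        rw [Prod.mk.injEq] at e
        exact hinj i j hij (by rw [hs i hi, hs j hj, e.1, e.2])
    rw [Finset.card_product, Int.card_Ico, Int.card_Ico, add_sub_cancel_left, add_sub_cancel_left,
      Int.toNat_natCast] at this
    linarith [show 11 * k * (11 * k) = 121 * k ^ 2 by ring]

/-- If at most `M` of the loops lie in distinct double cosets of the subgroup generated by
`hV.gen 1`, then there are at most `121 * k ^ 2 * M` loops. -/
theorem card_le_of_doubleCoset [Fintype ι] (hfin : V.Finite) (h1 : (1 : ℂ) ∈ V) (hk : 1 ≤ k)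
    (hH : ∀ i, hV.FewHits k (P i)) (hS : ∀ i, hV.FewSelfCrossings k (P i))
    (hJ : ∀ i j, i ≠ j → hV.FewCrossings k (P i) (P j))
    (hinj : ∀ i j, i ≠ j → loopClass (P i) ≠ loopClass (P j)) {M : ℕ}
    (hM : ∀ s : Finset ι, (∀ i ∈ s, ∀ j ∈ s, i ≠ j → ∀ a b : ℤ,
      loopClass (P i) ≠ hV.gen 1 ^ b * loopClass (P j) * hV.gen 1 ^ a) → s.card ≤ M) :
    Fintype.card ι ≤ 121 * k ^ 2 * M := by
  classical
  let r : Setoid ι := ⟨fun i j => ∃ a b : ℤ,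
      loopClass (P i) = hV.gen 1 ^ b * loopClass (P j) * hV.gen 1 ^ a,
    fun i => ⟨0, 0, by rw [zpow_zero, one_mul, mul_one]⟩,
    fun {i j} ⟨a, b, h⟩ => ⟨-a, -b, by rw [h]; group⟩,
    fun {i j l} ⟨a, b, h⟩ ⟨a', b', h'⟩ => ⟨a' + a, b + b', by rw [h, h']; group⟩⟩
  let f : ι → ι := fun i => (Quotient.mk r i).out
  have hf : ∀ i, ∃ a b : ℤ,
      loopClass (P i) = hV.gen 1 ^ b * loopClass (P (f i)) * hV.gen 1 ^ a := fun i =>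
    r.symm (Quotient.mk_out (s := r) i)
  choose a b hab using hf
  refine (Finset.card_le_mul_card_image (f := f) Finset.univ (121 * k ^ 2) fun j _ => ?_).trans
    (Nat.mul_le_mul_left _ (hM _ ?_))
  · refine card_le_of_zpow_mul hfin h1 hk hH hS hJ hinj _ (g := loopClass (P j)) (a := a) (b := b)
      fun i hi => ?_
    rw [← (Finset.mem_filter.1 hi).2]
    exact hab i
  · intro i hi j hj hne a b h
    obtain ⟨i, -, rfl⟩ := Finset.mem_image.1 hi
    obtain ⟨j, -, rfl⟩ := Finset.mem_image.1 hj
    refine hne ?_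
    have : Quotient.mk r (f i) = Quotient.mk r (f j) := Quotient.sound ⟨a, b, h⟩
    simp only [f, Quotient.out_eq] at this
    simp only [f, this]

end ConeSeparated

theorem rayCone_one_mem_nhds {κ : ℝ} (hκ : 0 < κ) : rayCone κ 1 ∈ 𝓝 (1 : ℂ) := by
  have h1 : ContinuousAt (fun z : ℂ => |(z / 1).im|) 1 := by fun_prop
  have h2 : ContinuousAt (fun z : ℂ => κ * (z / 1).re) 1 := by fun_prop
  filter_upwards [h1.eventually_lt h2 (by simpa using hκ)] with z hz using hz.le

/-- The segment between two points of a convex set, as a path in that set. -/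
def Convex.segmentPath {E : Type*} [AddCommGroup E] [Module ℝ E] [TopologicalSpace E]
    [ContinuousAdd E] [ContinuousSMul ℝ E] {R : Set E} (hR : Convex ℝ R) (a b : R) : Path a b where
  toFun t := ⟨(1 - (t : ℝ)) • (a : E) + (t : ℝ) • (b : E),
    hR a.2 b.2 (by linarith [t.2.2]) t.2.1 (by ring)⟩
  continuous_toFun := by fun_prop
  source' := by simp
  target' := by simp

theorem loopClass_eq_mul_mul_of_square {X Y : Type*} [TopologicalSpace X] [TopologicalSpace Y]
    [SimplyConnectedSpace Y] {x : X} (K : C(Y, X)) {a b c d : Y} (ha : K a = x) (hb : K b = x)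
    (hc : K c = x) (hd : K d = x) (A : Path a b) (G : Path b c) (B : Path c d) (F : Path a d)
    {pF pG pA pB : Path x x} (hF : ∀ t, pF t = K (F t)) (hG : ∀ t, pG t = K (G t))
    (hA : ∀ t, pA t = K (A t)) (hB : ∀ t, pB t = K (B t)) :
    loopClass pF = loopClass pB * loopClass pG * loopClass pA := by
  subst ha
  have h : F.Homotopic (A.trans (G.trans B)) := SimplyConnectedSpace.paths_homotopic _ _
  have e1 : pF = (F.map K.continuous).cast rfl hd.symm := by ext t; simp [hF]
  have e2 : pA.trans (pG.trans pB) =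
      ((A.trans (G.trans B)).map K.continuous).cast rfl hd.symm := by
    ext t
    simp only [Path.trans_apply, Path.cast_coe, Path.map_coe, Function.comp_apply]
    split_ifs <;> simp only [hA, hB, hG]
  have e3 : loopClass pB * loopClass pG * loopClass pA = loopClass (pA.trans (pG.trans pB)) := rfl
  rw [e3, e1, e2, loopClass_eq_iff]
  exact h.map K

namespace ConeSeparated

variable {V : Set ℂ} {κ : ℝ} {hV : ConeSeparated V κ}

theorem exists_eq_zpow_mul_of_square (h1 : (1 : ℂ) ∈ V) {P Q : Path hV.base hV.base}
    (H : ℝ → ℝ → ℂ) (hH : ContinuousOn (fun z : ℝ × ℝ => H z.1 z.2) (Icc 0 1 ×ˢ Icc 0 1))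
    (hHV : ∀ s ∈ Icc (0:ℝ) 1, ∀ t ∈ Ioo (0:ℝ) 1, H s t ∉ V)
    (hH0 : ∀ s ∈ Icc (0:ℝ) 1, H s 0 = 1) (hH1 : ∀ s ∈ Icc (0:ℝ) 1, H s 1 = 1)
    (hcone : ∀ s, (s = 0 ∨ s = 1) → ∀ t ∈ Icc (0:ℝ) (1/3),
      H s t ∈ rayCone κ 1 ∧ H s (1 - t) ∈ rayCone κ 1)
    (hP : ∀ t : I, H 0 (1/3 + t/3) = P t) (hQ : ∀ t : I, H 1 (1/3 + t/3) = Q t) :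
    ∃ a b : ℤ, loopClass P = hV.gen 1 ^ b * loopClass Q * hV.gen 1 ^ a := by
  obtain ⟨ε, hε, hε3, hεH⟩ : ∃ ε : ℝ, 0 < ε ∧ ε < 1/3 ∧ ∀ s ∈ Icc (0:ℝ) 1,
      H s ε ∈ rayCone κ 1 ∧ H s (1 - ε) ∈ rayCone κ 1 := by
    have hu := (isCompact_Icc.prod isCompact_Icc).uniformContinuousOn_of_continuous hH
    obtain ⟨r, hr, hball⟩ := Metric.mem_nhds_iff.1 (rayCone_one_mem_nhds hV.pos)
    obtain ⟨δ, hδ, hu⟩ := Metric.uniformContinuousOn_iff.1 hu r hr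
    refine ⟨min (δ/2) (1/6), by positivity, (min_le_right _ _).trans_lt (by norm_num),
      fun s hs => ⟨hball ?_, hball ?_⟩⟩
    all_goals
      have e1 : min (δ/2) (1/6) ≤ δ/2 := min_le_left _ _
      have e2 : min (δ/2) (1/6) ≤ 1/6 := min_le_right _ _
      have e3 : 0 < min (δ/2) (1/6) := by positivity
      generalize min (δ/2) (1/6) = ε at *
    · have := hu (s, ε) ⟨hs, by linarith, by linarith⟩ (s, 0) ⟨hs, by simp⟩
        (by rw [Prod.dist_eq]; simp [abs_of_pos e3, hδ]; linarith)
      simpa [hH0 s hs] using this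
    · have := hu (s, 1 - ε) ⟨hs, by linarith, by linarith⟩ (s, 1) ⟨hs, by simp⟩
        (by rw [Prod.dist_eq]; simp [abs_of_pos e3, hδ]; linarith)
      simpa [hH1 s hs] using this
  let R : Set (ℝ × ℝ) := Icc 0 1 ×ˢ Ioo 0 1
  have hR : Convex ℝ R := (convex_Icc _ _).prod (convex_Ioo _ _)
  have m0 : (0:ℝ) ∈ Icc (0:ℝ) 1 := left_mem_Icc.2 zero_le_one
  have m1 : (1:ℝ) ∈ Icc (0:ℝ) 1 := right_mem_Icc.2 zero_le_one
  have mR : ∀ s ∈ Icc (0:ℝ) 1, ∀ t ∈ Icc ε (1 - ε), (s, t) ∈ R := fun s hs t ht =>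
    ⟨hs, by linarith [ht.1], by linarith [ht.2]⟩
  have : Nonempty R := ⟨⟨(0, ε), mR 0 m0 ε ⟨le_rfl, by linarith⟩⟩⟩
  have : ContractibleSpace R := hR.contractibleSpace (nonempty_coe_sort.1 this)
  let K : C(R, {z : ℂ // z ∉ V}) := ⟨fun z => ⟨H z.1.1 z.1.2, hHV _ z.2.1 _ z.2.2⟩, by
    refine Continuous.subtype_mk ?_ _
    exact hH.comp_continuous continuous_subtype_val fun z => ⟨z.2.1, Ioo_subset_Icc_self z.2.2⟩⟩
  let a₀ : R := ⟨(0, 1/3), mR 0 m0 _ ⟨by linarith, by linarith⟩⟩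
  let a₁ : R := ⟨(0, ε), mR 0 m0 _ ⟨by linarith, by linarith⟩⟩
  let a₂ : R := ⟨(1, ε), mR 1 m1 _ ⟨by linarith, by linarith⟩⟩
  let a₃ : R := ⟨(1, 1/3), mR 1 m1 _ ⟨by linarith, by linarith⟩⟩
  let b₀ : R := ⟨(0, 2/3), mR 0 m0 _ ⟨by linarith, by linarith⟩⟩
  let b₁ : R := ⟨(0, 1 - ε), mR 0 m0 _ ⟨by linarith, by linarith⟩⟩
  let b₂ : R := ⟨(1, 1 - ε), mR 1 m1 _ ⟨by linarith, by linarith⟩⟩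
  let b₃ : R := ⟨(1, 2/3), mR 1 m1 _ ⟨by linarith, by linarith⟩⟩
  have k1 : K a₀ = hV.base := Subtype.ext (by simpa [K, a₀] using hP 0)
  have k2 : K a₃ = hV.base := Subtype.ext (by simpa [K, a₃] using hQ 0)
  have k3 : K b₀ = hV.base := Subtype.ext (by
    have := hP 1
    norm_num at this
    simpa [K, b₀] using this)
  have k4 : K b₃ = hV.base := Subtype.ext (by
    have := hQ 1
    norm_num at this
    simpa [K, b₃] using this)
  let A : Path a₀ a₃ := ((hR.segmentPath a₀ a₁).trans (hR.segmentPath a₁ a₂)).trans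
    (hR.segmentPath a₂ a₃)
  let B : Path b₃ b₀ := ((hR.segmentPath b₃ b₂).trans (hR.segmentPath b₂ b₁)).trans
    (hR.segmentPath b₁ b₀)
  have trans_mem : ∀ {x y z : R} {p : Path x y} {q : Path y z},
      (∀ t, (K (p t) : ℂ) ∈ rayCone κ 1) → (∀ t, (K (q t) : ℂ) ∈ rayCone κ 1) →
      ∀ t, (K (p.trans q t) : ℂ) ∈ rayCone κ 1 := by
    intro x y z p q hp hq t
    rw [Path.trans_apply]
    split_ifs
    exacts [hp _, hq _]
  have low : ∀ s, (s = 0 ∨ s = 1) → ∀ t ∈ Icc (0:ℝ) (1/3), H s t ∈ rayCone κ 1 :=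
    fun s hs t ht => (hcone s hs t ht).1
  have high : ∀ s, (s = 0 ∨ s = 1) → ∀ t ∈ Icc (2/3:ℝ) 1, H s t ∈ rayCone κ 1 :=
    fun s hs t ht => by
      have := (hcone s hs (1 - t) ⟨by linarith [ht.2], by linarith [ht.1]⟩).2
      rwa [sub_sub_cancel] at this
  have conv : ∀ {c d x y : ℝ} (r : I), x ∈ Icc c d → y ∈ Icc c d →
      (1 - (r : ℝ)) * x + r * y ∈ Icc c d := fun r hx hy =>
    convex_Icc _ _ hx hy (by linarith [r.2.2]) r.2.1 (by ring)
  have hA : ∀ t, (K (A t) : ℂ) ∈ rayCone κ 1 := by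
    refine trans_mem (trans_mem (fun r => ?_) fun r => ?_) fun r => ?_
    · have := low 0 (.inl rfl) _ (conv r (x := 1/3) (y := ε) (by norm_num) ⟨hε.le, hε3.le⟩)
      simpa [K, Convex.segmentPath, a₀, a₁] using this
    · have := (hεH _ r.2).1
      simpa [K, Convex.segmentPath, a₁, a₂, ← add_mul] using this
    · have := low 1 (.inr rfl) _ (conv r (x := ε) (y := 1/3) ⟨hε.le, hε3.le⟩ (by norm_num))
      simpa [K, Convex.segmentPath, a₂, a₃] using this
  have hB : ∀ t, (K (B t) : ℂ) ∈ rayCone κ 1 := by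
    have hε' : 1 - ε ∈ Icc (2/3 : ℝ) 1 := ⟨by linarith, by linarith⟩
    refine trans_mem (trans_mem (fun r => ?_) fun r => ?_) fun r => ?_
    · have := high 1 (.inr rfl) _ (conv r (x := 2/3) (y := 1 - ε) (by norm_num) hε')
      simpa [K, Convex.segmentPath, b₃, b₂] using this
    · have := (hεH _ (σ r).2).2
      simpa [K, Convex.segmentPath, b₂, b₁, ← add_mul] using this
    · have := high 0 (.inl rfl) _ (conv r (x := 1 - ε) (y := 2/3) hε' (by norm_num))
      simpa [K, Convex.segmentPath, b₁, b₀] using this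
  let pA : Path hV.base hV.base := (A.map K.continuous).cast k1.symm k2.symm
  let pB : Path hV.base hV.base := (B.map K.continuous).cast k4.symm k3.symm
  obtain ⟨a, ha⟩ := hV.exists_loopClass_eq_zpow h1 pA hA
  obtain ⟨b, hb⟩ := hV.exists_loopClass_eq_zpow h1 pB hB
  refine ⟨a, b, ?_⟩
  rw [← ha, ← hb]
  refine loopClass_eq_mul_mul_of_square K k1 k2 k4 k3 A (hR.segmentPath a₃ b₃) B
    (hR.segmentPath a₀ b₀) ?_ ?_ (fun t => rfl) (fun t => rfl)
  · intro t
    refine Subtype.ext ?_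
    rw [← hP]
    simp only [K, Convex.segmentPath, a₀, b₀, Path.coe_mk_mk, ContinuousMap.coe_mk, Prod.smul_mk,
      Prod.mk_add_mk, smul_eq_mul]
    congr 1 <;> ring
  · intro t
    refine Subtype.ext ?_
    rw [← hQ]
    simp only [K, Convex.segmentPath, a₃, b₃, Path.coe_mk_mk, ContinuousMap.coe_mk, Prod.smul_mk,
      Prod.mk_add_mk, smul_eq_mul]
    congr 1 <;> ring

end ConeSeparated

end

section

open Set Topology Filter

theorem exists_last_exit {φ : ℝ → ℂ} (hφ : Continuous φ) {z : ℂ} (h0 : φ 0 = z) {r ω : ℝ}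
    (hr : 0 < r) (hω : 0 ≤ ω) (h : r < ‖φ ω - z‖) :
    ∃ b, 0 < b ∧ b < ω ∧ ‖φ b - z‖ = r ∧ ∀ s, b < s → s ≤ ω → r < ‖φ s - z‖ := by
  have hc : Continuous fun s => ‖φ s - z‖ := by fun_prop
  have hK : IsCompact (Icc 0 ω ∩ {s | ‖φ s - z‖ ≤ r}) :=
    isCompact_Icc.inter_right (isClosed_le hc continuous_const)
  obtain ⟨b, ⟨hb, hbr⟩, hmax⟩ := hK.exists_isMaxOn
    ⟨0, ⟨le_rfl, hω⟩, by simp [h0, hr.le]⟩ continuousOn_id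
  have hbω : b ≠ ω := by rintro rfl; exact hbr.not_gt h
  have hlast : ∀ s, b < s → s ≤ ω → r < ‖φ s - z‖ := fun s hs hsω => by
    by_contra! hle
    exact hs.not_ge (hmax ⟨⟨hb.1.trans hs.le, hsω⟩, hle⟩)
  have hbr' : ‖φ b - z‖ = r := by
    refine le_antisymm hbr
        (ge_of_tendsto (hc.tendsto b |>.mono_left (nhdsWithin_le_nhds (s := Ioi b)))
      ?_)
    filter_upwards [Ioc_mem_nhdsGT (lt_of_le_of_ne hb.2 hbω)] with s hs using (hlast s hs.1 hs.2).le
  refine ⟨b, lt_of_le_of_ne hb.1 ?_, lt_of_le_of_ne hb.2 hbω, hbr', hlast⟩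
  rintro rfl
  simp [h0] at hbr'
  exact hr.ne hbr'

/-- Coincidences of a family of curves parametrised by the unit interval. -/
def Coincidences {ι : Type*} (c : ι → ℝ → ℂ) : Set ((ι × ℝ) × ι × ℝ) :=
  {q | q.1.2 ∈ Icc (0:ℝ) 1 ∧ q.2.2 ∈ Icc (0:ℝ) 1 ∧ q.1 ≠ q.2 ∧ c q.1.1 q.1.2 = c q.2.1 q.2.2}

theorem Coincidences.finite_hits {ι : Type*} {c : ι → ℝ → ℂ} (hfin : (Coincidences c).Finite)
    {Z : Set ℂ} (hZ : Z.Finite) (i : ι) : {t ∈ Icc (0:ℝ) 1 | c i t ∈ Z}.Finite := by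
  have : {t ∈ Icc (0:ℝ) 1 | c i t ∈ Z} = ⋃ z ∈ Z, {t ∈ Icc (0:ℝ) 1 | c i t = z} := by
    ext t; simp
  rw [this]
  refine hZ.biUnion fun z _ => ?_
  by_cases h : ∃ u ∈ Icc (0:ℝ) 1, c i u = z
  · obtain ⟨u, hu, rfl⟩ := h
    refine ((hfin.image fun q => q.2.2).insert u).subset fun t ht => ?_
    rcases eq_or_ne t u with rfl | hne
    · exact mem_insert _ _
    · exact mem_insert_of_mem _ ⟨((i, u), i, t), ⟨hu, ht.1, by simp [hne.symm], ht.2.symm⟩, rfl⟩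
  · convert finite_empty
    ext t
    simp only [mem_ofPred_eq, mem_empty_iff_false, iff_false]
    exact fun ht => h ⟨t, ht⟩

/-- The curve is linear on each side of `t₀`, near `t₀`. -/
def LinearNear (c : ℝ → ℂ) (t₀ : ℝ) : Prop :=
  ∃ ε > 0, ∃ d : ℝ → ℂ, ∀ e, (e = 1 ∨ e = -1) → ∀ s ∈ Icc 0 ε, t₀ + e * s ∈ Icc (0:ℝ) 1 →
    c (t₀ + e * s) = c t₀ + s * d e

/-- The correction turning the part of `c` between `a` and `a + e * b` into a segment. -/
noncomputable def straighten (c : ℝ → ℂ) (a e b t : ℝ) : ℂ :=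
  c a + ((max 0 (min (e * (t - a)) b) / b : ℝ) : ℂ) * (c (a + e * b) - c a) -
    c (a + e * max 0 (min (e * (t - a)) b))

theorem continuous_straighten {c : ℝ → ℂ} (hc : Continuous c) (a e b : ℝ) :
    Continuous (straighten c a e b) := by
  unfold straighten
  fun_prop

theorem straighten_eq_zero {c : ℝ → ℂ} {a e b t : ℝ} (hb : 0 < b)
    (h : ¬ (0 < e * (t - a) ∧ e * (t - a) < b)) : straighten c a e b t = 0 := by
  unfold straighten
  rcases le_or_gt (e * (t - a)) 0 with h0 | h0
  · rw [max_eq_left ((min_le_left _ _).trans h0)]; simp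
  · rw [min_eq_right (not_lt.1 fun h1 => h ⟨h0, h1⟩), max_eq_right hb.le, div_self hb.ne']; simp

theorem straighten_of_mem {c : ℝ → ℂ} {a e b t : ℝ} (he : e = 1 ∨ e = -1)
    (h0 : 0 < e * (t - a)) (h1 : e * (t - a) < b) :
    c t + straighten c a e b t = c a + ((e * (t - a) / b : ℝ) : ℂ) * (c (a + e * b) - c a) := by
  unfold straighten
  rw [min_eq_left h1.le, max_eq_right h0.le]
  have : a + e * (e * (t - a)) = t := by rcases he with rfl | rfl <;> ring
  rw [this]; ring

theorem exists_radialization_point {ι : Type*} [Finite ι] {c : ι → ℝ → ℂ}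
    (hc : ∀ i, Continuous (c i)) (hfin : (Coincidences c).Finite) (z : ℂ) {η : ℝ} (hη : 0 < η) :
    ∃ c' : ι → ℝ → ℂ, (∀ i, Continuous (c' i)) ∧ Coincidences c' ⊆ Coincidences c ∧
      (∀ i, c' i 0 = c i 0 ∧ c' i 1 = c i 1) ∧
      (∀ i, ∀ t ∈ Icc (0:ℝ) 1, c' i t = z ↔ c i t = z) ∧
      (∀ i, ∀ t ∈ Icc (0:ℝ) 1, c i t = z → LinearNear (c' i) t) ∧
      (∀ i, ∀ t ∈ Icc (0:ℝ) 1, c' i t ≠ c i t → dist (c' i t) z < η ∧ dist (c i t) z < η) ∧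
      (∀ i, (∃ A B : ℂ, ∀ t ∈ Icc (0:ℝ) 1, c i t = A + t * B) →
        ∀ t ∈ Icc (0:ℝ) 1, c' i t = c i t) := by
  classical
  have hT := fun i => Coincidences.finite_hits hfin (finite_singleton z) i
  let T : ι → Finset ℝ := fun i => (hT i).toFinset
  have hTm : ∀ i t, t ∈ T i ↔ t ∈ Icc (0:ℝ) 1 ∧ c i t = z := fun i t => by simp [T]
  let F : Set ℝ := (⋃ i, (T i : Set ℝ)) ∪ {0, 1}
  have hF : F.Finite := (finite_iUnion fun i => (T i).finite_toSet).union (by simp)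
  have hTF : ∀ i t, t ∈ T i → t ∈ F := fun i t h => Or.inl (mem_iUnion.2 ⟨i, h⟩)
  obtain ⟨ω, hω0, hωsep, hωc⟩ : ∃ ω > 0, (∀ a ∈ F, ∀ b ∈ F, a ≠ b → 2 * ω < |a - b|) ∧
      ∀ i, ∀ a ∈ T i, ∀ t, |t - a| ≤ ω → dist (c i t) z < η := by
    have h1 : ∀ᶠ ω in 𝓝[>] (0:ℝ), ∀ a ∈ F, ∀ b ∈ F, a ≠ b → 2 * ω < |a - b| := by
      refine (hF.eventually_all).2 fun a _ => (hF.eventually_all).2 fun b _ => ?_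
      by_cases hab : a = b
      · simp [hab]
      · filter_upwards [Ioo_mem_nhdsGT (show 0 < |a - b| / 2 by
          have := abs_pos.2 (sub_ne_zero.2 hab); linarith)] with ω hω _
        linarith [hω.2]
    have h2 : ∀ᶠ ω in 𝓝[>] (0:ℝ), ∀ i, ∀ a ∈ T i, ∀ t, |t - a| ≤ ω → dist (c i t) z < η := by
      refine eventually_all.2 fun i => (T i).eventually_all.2 fun a ha => ?_
      obtain ⟨δ, hδ, h⟩ := Metric.continuous_iff.1 (hc i) a η hη
      filter_upwards [Ioo_mem_nhdsGT hδ] with ω hω t ht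
      have := h t (lt_of_le_of_lt ht hω.2)
      rwa [((hTm i a).1 ha).2] at this
    obtain ⟨ω, ⟨h1, h2⟩, h3⟩ := ((h1.and h2).and self_mem_nhdsWithin).exists
    exact ⟨ω, h3, h1, h2⟩
  have h0F : (0:ℝ) ∈ F := Or.inr (by simp)
  have h1F : (1:ℝ) ∈ F := Or.inr (by simp)
  let S : ι → Finset (ℝ × ℝ) := fun i =>
    ((T i) ×ˢ {1, -1}).filter fun p => p.1 + p.2 * ω ∈ Icc (0:ℝ) 1
  have hSm : ∀ i p, p ∈ S i ↔ (p.1 ∈ T i ∧ (p.2 = 1 ∨ p.2 = -1)) ∧ p.1 + p.2 * ω ∈ Icc (0:ℝ) 1 :=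
    fun i p => by simp [S]
  obtain ⟨r, hr0, hrη, hrS, hrq, hrK⟩ : ∃ r > 0, r < η ∧
      (∀ i, ∀ p ∈ S i, r < ‖c i (p.1 + p.2 * ω) - z‖) ∧
      (∀ q ∈ Coincidences c, ‖c q.1.1 q.1.2 - z‖ ≠ r) ∧
      ∀ i, ∀ t ∈ Icc (0:ℝ) 1, (∀ a ∈ T i, ω ≤ |t - a|) → r ≤ ‖c i t - z‖ := by
    have h1 : ∀ᶠ r in 𝓝[>] (0:ℝ), ∀ i, ∀ p ∈ S i, r < ‖c i (p.1 + p.2 * ω) - z‖ := by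
      refine eventually_all.2 fun i => (S i).eventually_all.2 fun p hp => ?_
      rw [hSm] at hp
      refine Eventually.filter_mono nhdsWithin_le_nhds (eventually_lt_nhds ?_)
      rw [norm_sub_pos_iff]
      intro h
      have hm : p.1 + p.2 * ω ∈ T i := (hTm _ _).2 ⟨hp.2, h⟩
      have := hωsep _ (hTF _ _ hm) _ (hTF _ _ hp.1.1) (by
        rcases hp.1.2 with h | h <;> rw [h] <;> intro h <;> linarith)
      rw [add_sub_cancel_left] at this
      rcases hp.1.2 with h | h <;> rw [h] at this <;> simp [abs_of_pos hω0] at this <;> linarith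
    have h2 : ∀ᶠ r in 𝓝[>] (0:ℝ), ∀ q ∈ Coincidences c, ‖c q.1.1 q.1.2 - z‖ ≠ r := by
      refine (hfin.eventually_all).2 fun q _ => ?_
      rcases (norm_nonneg (c q.1.1 q.1.2 - z)).eq_or_lt with h | h
      · filter_upwards [self_mem_nhdsWithin] with r hr
        rw [← h]; exact (ne_of_gt hr).symm
      · filter_upwards [Ioo_mem_nhdsGT h] with r hr using hr.2.ne'
    have h3 : ∀ᶠ r in 𝓝[>] (0:ℝ), ∀ i, ∀ t ∈ Icc (0:ℝ) 1, (∀ a ∈ T i, ω ≤ |t - a|) →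
        r ≤ ‖c i t - z‖ := by
      refine eventually_all.2 fun i => ?_
      have hK : IsCompact (Icc (0:ℝ) 1 ∩ {t | ∀ a ∈ T i, ω ≤ |t - a|}) := by
        refine isCompact_Icc.inter_right ?_
        simp only [Set.ofPred_forall]
        exact isClosed_biInter fun a _ => isClosed_le continuous_const (by fun_prop)
      rcases (Icc (0:ℝ) 1 ∩ {t | ∀ a ∈ T i, ω ≤ |t - a|}).eq_empty_or_nonempty with he | hne
      · exact Eventually.of_forall fun r t ht h => absurd
          (he ▸ (⟨ht, h⟩ : t ∈ Icc (0:ℝ) 1 ∩ {t | ∀ a ∈ T i, ω ≤ |t - a|})) (notMem_empty t)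
      · obtain ⟨t₀, ht₀, hmin⟩ := hK.exists_isMinOn hne
          (f := fun t => ‖c i t - z‖) (by have := hc i; fun_prop)
        have : 0 < ‖c i t₀ - z‖ := by
          rw [norm_sub_pos_iff]
          intro h
          have := ht₀.2 t₀ ((hTm _ _).2 ⟨ht₀.1, h⟩)
          simp at this; linarith
        filter_upwards [Ioo_mem_nhdsGT this] with r hr t ht h
        exact hr.2.le.trans (hmin ⟨ht, h⟩)
    obtain ⟨r, ⟨⟨⟨h1, h2⟩, h3⟩, h4⟩⟩ := (((h1.and h2).and h3).and (Ioo_mem_nhdsGT hη)).exists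
    exact ⟨r, h4.1, h4.2, h1, h2, h3⟩
  have hex : ∀ i, ∀ p ∈ S i, ∃ b, 0 < b ∧ b < ω ∧ ‖c i (p.1 + p.2 * b) - z‖ = r ∧
      ∀ s, b < s → s ≤ ω → r < ‖c i (p.1 + p.2 * s) - z‖ := fun i p hp =>
    exists_last_exit (φ := fun s => c i (p.1 + p.2 * s)) (by have := hc i; fun_prop)
      (by simpa using ((hTm i p.1).1 ((hSm i p).1 hp).1.1).2) hr0 hω0.le (hrS i p hp)
  choose! b hb0 hbω hbr hbl using hex
  -- the open strand
  let In : ι → ℝ → ℝ × ℝ → Prop := fun i t p => 0 < p.2 * (t - p.1) ∧ p.2 * (t - p.1) < b i p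
  have habs : ∀ {i p t}, p ∈ S i → In i t p → |t - p.1| < ω ∧ t ≠ p.1 := by
    intro i p t hp h
    have h3 := hbω i p hp
    refine ⟨?_, by rintro rfl; simp [In] at h⟩
    rcases ((hSm i p).1 hp).1.2 with he | he <;> simp only [In, he] at h <;>
      rw [abs_lt] <;> constructor <;> linarith [h.1, h.2]
  have huniq : ∀ {i p p' t}, p ∈ S i → p' ∈ S i → In i t p → In i t p' → p = p' := by
    intro i p p' t hp hp' h h'
    have e1 : p.1 = p'.1 := by
      by_contra hne
      have := hωsep _ (hTF i _ ((hSm i p).1 hp).1.1) _ (hTF i _ ((hSm i p').1 hp').1.1) hne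
      have h1 := abs_lt.1 (habs hp h).1
      have h2 := abs_lt.1 (habs hp' h').1
      have : |p.1 - p'.1| < 2 * ω := by rw [abs_lt]; constructor <;>
          linarith [h1.1, h1.2, h2.1, h2.2]
      linarith
    refine Prod.ext e1 ?_
    simp only [In] at h h'
    rw [← e1] at h'
    rcases ((hSm i p).1 hp).1.2 with he | he <;> rcases ((hSm i p').1 hp').1.2 with he' | he' <;>
      rw [he, he'] <;> rw [he] at h <;> rw [he'] at h' <;> exfalso <;> linarith [h.1, h'.1]
  let c' : ι → ℝ → ℂ := fun i t => c i t + ∑ p ∈ S i, straighten (c i) p.1 p.2 (b i p) t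
  have hA : ∀ {i p t}, p ∈ S i → In i t p → c' i t =
      z + ((p.2 * (t - p.1) / b i p : ℝ) : ℂ) * (c i (p.1 + p.2 * b i p) - z) := by
    intro i p t hp h
    have hz := ((hTm i p.1).1 ((hSm i p).1 hp).1.1).2
    simp only [c']
    rw [Finset.sum_eq_single_of_mem p hp fun p' hp' hne =>
      straighten_eq_zero (hb0 i p' hp') fun h' => hne (huniq hp' hp h' h),
      straighten_of_mem ((hSm i p).1 hp).1.2 h.1 h.2, hz]
  have hB : ∀ {i t}, (∀ p ∈ S i, ¬ In i t p) → c' i t = c i t := by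
    intro i t h
    simp only [c']
    rw [Finset.sum_eq_zero fun p hp => straighten_eq_zero (hb0 i p hp) (h p hp), add_zero]
  have hA' : ∀ {i p t}, p ∈ S i → In i t p → 0 < ‖c' i t - z‖ ∧ ‖c' i t - z‖ < r := by
    intro i p t hp h
    have h0 := hb0 i p hp
    rw [hA hp h, add_sub_cancel_left, norm_mul, hbr i p hp, Complex.norm_real, Real.norm_eq_abs,
      abs_of_pos (div_pos h.1 h0)]
    exact ⟨mul_pos (div_pos h.1 h0) hr0, mul_lt_of_lt_one_left hr0 ((div_lt_one h0).2 h.2)⟩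
  have hval : ∀ {i a e s}, a ∈ T i → (e = 1 ∨ e = -1) → 0 < s → a + e * s ∈ Icc (0:ℝ) 1 →
      (a, e) ∈ S i := by
    intro i a e s ha he hs hm
    refine (hSm _ _).2 ⟨⟨ha, he⟩, ?_⟩
    have haI := ((hTm i a).1 ha).1
    simp only
    rcases he with rfl | rfl
    · have hne : a ≠ 1 := by rintro rfl; linarith [hm.2]
      have := hωsep _ (hTF _ _ ha) _ h1F hne
      rw [abs_of_nonpos (by linarith [haI.2])] at this
      exact ⟨by linarith [haI.1], by linarith⟩
    · have hne : a ≠ 0 := by rintro rfl; linarith [hm.1]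
      have := hωsep _ (hTF _ _ ha) _ h0F hne
      rw [abs_of_nonneg (by linarith [haI.1])] at this
      exact ⟨by linarith, by linarith [haI.2]⟩
  have hB' : ∀ {i t}, t ∈ Icc (0:ℝ) 1 → (∀ p ∈ S i, ¬ In i t p) →
      c' i t = z ∨ r ≤ ‖c' i t - z‖ := by
    intro i t ht h
    rw [hB h]
    by_cases hfar : ∀ a ∈ T i, ω ≤ |t - a|
    · exact Or.inr (hrK i t ht hfar)
    push Not at hfar
    obtain ⟨a, ha, hta⟩ := hfar
    rcases eq_or_ne t a with rfl | hne
    · exact Or.inl ((hTm _ _).1 ha).2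
    obtain ⟨e, he, s, hs, rfl⟩ : ∃ e : ℝ, (e = 1 ∨ e = -1) ∧ ∃ s > 0, t = a + e * s := by
      rcases hne.lt_or_gt with h | h
      · exact ⟨-1, Or.inr rfl, a - t, sub_pos.2 h, by ring⟩
      · exact ⟨1, Or.inl rfl, t - a, sub_pos.2 h, by ring⟩
    have hp := hval ha he hs ht
    have hes : e * (a + e * s - a) = s := by rcases he with rfl | rfl <;> ring
    have hsω : s < ω := by
      rw [add_sub_cancel_left, abs_mul, abs_of_pos hs] at hta
      rcases he with rfl | rfl <;> simpa using hta
    have hbs : b i (a, e) ≤ s := not_lt.1 fun h' => h _ hp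
        ⟨by simpa only [hes], by simpa only [hes]⟩
    rcases hbs.eq_or_lt with h' | h'
    · exact Or.inr (by rw [← h']; exact (hbr i _ hp).ge)
    · exact Or.inr (hbl i _ hp s h' hsω.le).le
  have hmemIcc : ∀ {i p s}, p ∈ S i → 0 ≤ s → s ≤ ω → p.1 + p.2 * s ∈ Icc (0:ℝ) 1 := by
    intro i p s hp hs hsω
    obtain ⟨⟨h1, h2⟩, h3⟩ := (hSm i p).1 hp
    have h1 := ((hTm _ _).1 h1).1
    rcases h2 with h2 | h2 <;> rw [h2] at h3 ⊢ <;> constructor <;>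
      linarith [h1.1, h1.2, h3.1, h3.2]
  have hTB : ∀ {i a}, a ∈ F → ∀ p ∈ S i, ¬ In i a p := by
    intro i a ha p hp h
    have := hωsep a ha p.1 (hTF _ _ ((hSm i p).1 hp).1.1) (habs hp h).2
    linarith [(habs hp h).1]
  refine ⟨c', fun i => (hc i).add (continuous_finsetSum _ fun p _ =>
    continuous_straighten (hc i) _ _ _), ?_, fun i => ⟨hB (hTB h0F), hB (hTB h1F)⟩, ?_, ?_, ?_, ?_⟩
  · rintro ⟨⟨i, t⟩, j, u⟩ ⟨ht, hu, hne, heq⟩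
    simp only at ht hu hne heq
    refine ⟨ht, hu, hne, ?_⟩
    by_cases h1 : ∃ p ∈ S i, In i t p <;> by_cases h2 : ∃ p ∈ S j, In j u p
    · exfalso
      obtain ⟨p, hp, h1⟩ := h1
      obtain ⟨p', hp', h2⟩ := h2
      have hn : p.2 * (t - p.1) / b i p = p'.2 * (u - p'.1) / b j p' := by
        have := congrArg (fun x => ‖x - z‖) heq
        simp only [hA hp h1, hA hp' h2, add_sub_cancel_left, norm_mul, hbr i p hp, hbr j p' hp',
          Complex.norm_real, Real.norm_eq_abs, abs_of_pos (div_pos h1.1 (hb0 i p hp)),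
          abs_of_pos (div_pos h2.1 (hb0 j p' hp'))] at this
        exact mul_right_cancel₀ hr0.ne' this
      have he : c i (p.1 + p.2 * b i p) = c j (p'.1 + p'.2 * b j p') := by
        rw [hA hp h1, hA hp' h2, hn] at heq
        have h0 : ((p'.2 * (u - p'.1) / b j p' : ℝ) : ℂ) ≠ 0 :=
          Complex.ofReal_ne_zero.2 (div_pos h2.1 (hb0 j p' hp')).ne'
        simpa using mul_left_cancel₀ h0 (add_left_cancel heq)
      by_cases hq : (i, p.1 + p.2 * b i p) = (j, p'.1 + p'.2 * b j p')
      · obtain ⟨rfl, hq⟩ := Prod.mk.inj hq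
        have hp1 := ((hSm i p).1 hp).1.2
        have hp1' := ((hSm i p').1 hp').1.2
        have b1 := hb0 i p hp
        have b2 := hb0 i p' hp'
        have b3 := hbω i p hp
        have b4 := hbω i p' hp'
        have e1 : p.1 = p'.1 := by
          by_contra hne
          have := hωsep _ (hTF i _ ((hSm i p).1 hp).1.1) _ (hTF i _ ((hSm i p').1 hp').1.1) hne
          have h3 : |p.1 - p'.1| < 2 * ω := by
            rw [abs_lt]
            rcases hp1 with h | h <;> rcases hp1' with h' | h' <;> rw [h, h'] at hq <;>
              constructor <;> linarith
          linarith
        have e2 : p.2 = p'.2 := by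
          rw [e1] at hq
          rcases hp1 with h | h <;> rcases hp1' with h' | h' <;> rw [h, h'] at hq <;>
            rw [h, h'] <;> linarith
        obtain rfl : p = p' := Prod.ext e1 e2
        rw [div_left_inj' b1.ne'] at hn
        apply hne
        rcases hp1 with h | h <;> rw [h] at hn <;> simp only [Prod.mk.injEq, true_and] <;> linarith
      · exact hrq ((i, p.1 + p.2 * b i p), j, p'.1 + p'.2 * b j p')
          ⟨hmemIcc hp (hb0 i p hp).le (hbω i p hp).le,
            hmemIcc hp' (hb0 j p' hp').le (hbω j p' hp').le, hq, he⟩ (hbr i p hp)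
    · exfalso
      obtain ⟨p, hp, h1⟩ := h1
      push Not at h2
      have h3 := hA' hp h1
      rcases hB' hu h2 with h | h <;> rw [← heq] at h
      · simp [h] at h3
      · linarith [h3.2]
    · exfalso
      obtain ⟨p, hp, h2⟩ := h2
      push Not at h1
      have h3 := hA' hp h2
      rcases hB' ht h1 with h | h <;> rw [heq] at h
      · simp [h] at h3
      · linarith [h3.2]
    · push Not at h1 h2
      rwa [hB h1, hB h2] at heq
  · intro i t ht
    constructor
    · intro h
      by_cases h1 : ∃ p ∈ S i, In i t p
      · obtain ⟨p, hp, h1⟩ := h1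
        have := hA' hp h1
        simp [h] at this
      · push Not at h1
        rwa [hB h1] at h
    · intro h
      rwa [hB (hTB (hTF i t ((hTm _ _).2 ⟨ht, h⟩)))]
  · intro i t ht h
    have htT := (hTm i t).2 ⟨ht, h⟩
    have key : ∀ e : ℝ, (e = 1 ∨ e = -1) → ∃ ε > 0, ∃ d : ℂ, ∀ s ∈ Icc 0 ε,
        t + e * s ∈ Icc (0:ℝ) 1 → c' i (t + e * s) = c' i t + s * d := by
      intro e he
      by_cases hp : (t, e) ∈ S i
      · have h0 := hb0 i _ hp
        refine ⟨b i (t, e) / 2, half_pos h0, (c i (t + e * b i (t, e)) - z) / b i (t, e),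
          fun s hs _ => ?_⟩
        rcases hs.1.eq_or_lt with rfl | hs0
        · simp
        have hes : e * (t + e * s - t) = s := by rcases he with rfl | rfl <;> ring
        rw [hA hp ⟨by simpa only [hes], by simp only [hes]; linarith [hs.2]⟩,
            hB (hTB (hTF i t htT)),
          h]
        simp only [hes]
        push_cast
        ring
      · refine ⟨1, one_pos, 0, fun s hs hm => ?_⟩
        rcases hs.1.eq_or_lt with rfl | hs0
        · simp
        · exact absurd (hval htT he hs0 hm) hp
    choose! ε hε d hd using key
    refine ⟨min (ε 1) (ε (-1)), lt_min (hε 1 (Or.inl rfl)) (hε _ (Or.inr rfl)), d,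
      fun e he s hs hm => hd e he s ⟨hs.1, hs.2.trans ?_⟩ hm⟩
    rcases he with rfl | rfl
    exacts [min_le_left _ _, min_le_right _ _]
  · intro i t ht h
    by_cases h1 : ∃ p ∈ S i, In i t p
    · obtain ⟨p, hp, h1⟩ := h1
      rw [dist_eq_norm]
      exact ⟨(hA' hp h1).2.trans hrη, hωc i p.1 ((hSm i p).1 hp).1.1 t (habs hp h1).1.le⟩
    · push Not at h1
      exact absurd (hB h1) h
  · rintro i ⟨A, B, hAB⟩ t ht
    by_cases h1 : ∃ p ∈ S i, In i t p
    · obtain ⟨p, hp, h1⟩ := h1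
      have hz := ((hTm i p.1).1 ((hSm i p).1 hp).1.1)
      have hb := hb0 i p hp
      rw [hA hp h1, hAB _ (hmemIcc hp hb.le (hbω i p hp).le), hAB t ht, ← hz.2, hAB _ hz.1]
      have h4 : (p.2 : ℂ) * p.2 = 1 := by
        rcases ((hSm i p).1 hp).1.2 with h | h <;> rw [h] <;> simp
      have hbc : (b i p : ℂ) ≠ 0 := Complex.ofReal_ne_zero.2 hb.ne'
      push_cast
      field_simp
      linear_combination (B * (t - p.1) * b i p) * h4
    · push Not at h1
      exact hB h1

theorem LinearNear.congr {c c' : ℝ → ℂ} {t₀ : ℝ} (h : LinearNear c t₀) (hm : t₀ ∈ Icc (0:ℝ) 1)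
    (he : ∀ᶠ t in 𝓝 t₀, t ∈ Icc (0:ℝ) 1 → c' t = c t) : LinearNear c' t₀ := by
  obtain ⟨ε, hε, d, hd⟩ := h
  obtain ⟨δ, hδ, hδ'⟩ := Metric.eventually_nhds_iff.1 he
  refine ⟨min ε (δ / 2), lt_min hε (half_pos hδ), d, fun e h1 s hs hsm => ?_⟩
  rw [hδ' (by simpa using hδ) hm, hδ' ?_ hsm, hd e h1 s ⟨hs.1, hs.2.trans (min_le_left _ _)⟩ hsm]
  have h3 : |e| = 1 := by rcases h1 with rfl | rfl <;> simp
  rw [Real.dist_eq, add_sub_cancel_left, abs_mul, h3, one_mul, abs_of_nonneg hs.1]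
  linarith [hs.2, min_le_right ε (δ / 2)]

/-- Finitely many points of the plane can be made to be met by a family of curves
only in pairs of straight segments, without creating new coincidences. -/
theorem exists_radialization {ι : Type*} [Finite ι] {c : ι → ℝ → ℂ}
    (hc : ∀ i, Continuous (c i)) (hfin : (Coincidences c).Finite) {Z : Set ℂ} (hZ : Z.Finite)
    {η : ℝ} (hη : 0 < η) :
    ∃ c' : ι → ℝ → ℂ, (∀ i, Continuous (c' i)) ∧ Coincidences c' ⊆ Coincidences c ∧
      (∀ i, c' i 0 = c i 0 ∧ c' i 1 = c i 1) ∧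
      (∀ i, ∀ t ∈ Icc (0:ℝ) 1, ∀ z ∈ Z, c' i t = z ↔ c i t = z) ∧
      (∀ i, ∀ t ∈ Icc (0:ℝ) 1, c i t ∈ Z → LinearNear (c' i) t) ∧
      (∀ i, ∀ t ∈ Icc (0:ℝ) 1, c' i t ≠ c i t →
        ∃ z ∈ Z, dist (c' i t) z < η ∧ dist (c i t) z < η) ∧
      (∀ i, (∃ A B : ℂ, ∀ t ∈ Icc (0:ℝ) 1, c i t = A + t * B) →
        ∀ t ∈ Icc (0:ℝ) 1, c' i t = c i t) := by
  induction Z, hZ using Set.Finite.induction_on generalizing η with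
  | empty => exact ⟨c, hc, subset_rfl, by simp, by simp, by simp, by simp, by simp⟩
  | @insert z Z hzZ hZ ih =>
    obtain ⟨δ, hδ, hδη, hδZ⟩ : ∃ δ > 0, δ ≤ η ∧ ∀ z' ∈ Z, 2 * δ ≤ dist z z' := by
      have h1 : ∀ᶠ δ in 𝓝[>] (0:ℝ), ∀ z' ∈ Z, 2 * δ ≤ dist z z' := by
        refine hZ.eventually_all.2 fun z' hz' => ?_
        have : 0 < dist z z' := dist_pos.2 (by rintro rfl; exact hzZ hz')
        filter_upwards [Ioo_mem_nhdsGT (half_pos this)] with δ hδ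
        linarith [hδ.2]
      obtain ⟨δ, h1, h2⟩ := (h1.and (Ioo_mem_nhdsGT hη)).exists
      exact ⟨δ, h2.1, h2.2.le, h1⟩
    obtain ⟨c₁, hc₁, hs₁, he₁, hh₁, hl₁, hd₁, ha₁⟩ := ih hδ
    obtain ⟨c₂, hc₂, hs₂, he₂, hh₂, hl₂, hd₂, ha₂⟩ :=
      exists_radialization_point hc₁ (hfin.subset hs₁) z hδ
    have hz₁ : ∀ i, ∀ t ∈ Icc (0:ℝ) 1, c₁ i t = z ↔ c i t = z := by
      intro i t ht
      by_cases h : c₁ i t = c i t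
      · rw [h]
      obtain ⟨z', hz', h1, h2⟩ := hd₁ i t ht h
      have := hδZ z' hz'
      constructor <;> intro h <;> exfalso
      · rw [h] at h1; linarith
      · rw [h] at h2; linarith
    have hZ₂ : ∀ i, ∀ t ∈ Icc (0:ℝ) 1, ∀ z' ∈ Z, c₂ i t = z' ↔ c₁ i t = z' := by
      intro i t ht z' hz'
      by_cases h : c₂ i t = c₁ i t
      · rw [h]
      obtain ⟨h1, h2⟩ := hd₂ i t ht h
      have := hδZ z' hz'
      rw [dist_comm] at this
      constructor <;> intro h <;> exfalso
      · rw [h] at h1; linarith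
      · rw [h] at h2; linarith
    refine ⟨c₂, hc₂, hs₂.trans hs₁, fun i => ⟨(he₂ i).1.trans (he₁ i).1, (he₂ i).2.trans (he₁ i).2⟩,
      ?_, ?_, ?_, ?_⟩
    · rintro i t ht z' (rfl | hz')
      · rw [hh₂ i t ht, hz₁ i t ht]
      · rw [hZ₂ i t ht z' hz', hh₁ i t ht z' hz']
    · rintro i t ht (h | h)
      · exact hl₂ i t ht ((hz₁ i t ht).2 h)
      · refine (hl₁ i t ht h).congr ht ?_
        have h1 : c₁ i t = c i t := (hh₁ i t ht _ h).2 rfl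
        have h2 : 0 < dist (c₁ i t) z := by
          rw [h1, dist_comm]; linarith [hδZ _ h]
        have h3 : ∀ᶠ s in 𝓝 t, δ < dist (c₁ i s) z := by
          refine ((hc₁ i).dist continuous_const).continuousAt.eventually_mem (Ioi_mem_nhds ?_)
          rw [h1, dist_comm]; linarith [hδZ _ h]
        filter_upwards [h3] with s hs hsm
        by_contra hne
        linarith [(hd₂ i s hsm hne).2]
    · intro i t ht hne
      by_cases h : c₂ i t = c₁ i t
      · rw [h] at hne ⊢
        obtain ⟨z', hz', h1, h2⟩ := hd₁ i t ht hne
        exact ⟨z', mem_insert_of_mem _ hz', h1.trans_le hδη, h2.trans_le hδη⟩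
      · obtain ⟨h1, h2⟩ := hd₂ i t ht h
        refine ⟨z, mem_insert _ _, h1.trans_le hδη, ?_⟩
        by_cases h' : c₁ i t = c i t
        · rw [← h']; exact h2.trans_le hδη
        · obtain ⟨z', hz', h3, h4⟩ := hd₁ i t ht h'
          have := hδZ z' hz'
          have := dist_triangle_left z z' (c₁ i t)
          linarith
    · rintro i ⟨A, B, hAB⟩ t ht
      have h1 : ∀ t ∈ Icc (0:ℝ) 1, c₁ i t = c i t := ha₁ i ⟨A, B, hAB⟩
      rw [ha₂ i ⟨A, B, fun t ht => (h1 t ht).trans (hAB t ht)⟩ t ht, h1 t ht]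

/-- The set has fewer than `k` elements. -/
def FewerThan {α : Type*} (k : ℕ) (S : Set α) : Prop :=
  ∃ J : Finset α, J.card < k ∧ S ⊆ J

/-- The graph of a tent of height proportional to `δ` over `[0, 1]`. -/
def tent (δ a : ℝ) : ℂ := ⟨a, δ * min a (1 - a)⟩

@[simp] theorem tent_zero (δ : ℝ) : tent δ 0 = 0 := by
  apply Complex.ext <;> simp [tent]

@[simp] theorem tent_one (δ : ℝ) : tent δ 1 = 1 := by
  apply Complex.ext <;> simp [tent]

theorem continuous_tent (δ : ℝ) : Continuous (tent δ) := by
  have : tent δ = fun a : ℝ => (a : ℂ) + ((δ * min a (1 - a) : ℝ) : ℂ) * Complex.I := by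
    ext a; apply Complex.ext <;> simp [tent]
  rw [this]
  fun_prop

theorem tent_injective {δ δ' a a' : ℝ} (ha : a ∈ Ioo (0:ℝ) 1) (h : tent δ a = tent δ' a') :
    a = a' ∧ δ = δ' := by
  have h1 : a = a' := congrArg Complex.re h
  subst h1
  exact ⟨rfl, mul_right_cancel₀ (lt_min ha.1 (sub_pos.2 ha.2)).ne' (congrArg Complex.im h)⟩

theorem abs_min_sub_min_le (a b : ℝ) : |min a (1 - a) - min b (1 - b)| ≤ |a - b| := by
  have := abs_min_sub_min_le_max a (1 - a) b (1 - b)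
  refine this.trans (max_le le_rfl ?_)
  rw [sub_sub_sub_cancel_left, abs_sub_comm]

/-- A strand crosses a pair of opposite thin tents at most once. -/
theorem strand_tent_unique {δ a₀ s s' a a' e e' : ℝ} {d : ℂ} (hδ : 0 < δ)
    (hd : d.im ≠ 0 → δ * |d.re| < |d.im|) (ha : a ∈ Ioo (0:ℝ) 1)
    (he : e = 1 ∨ e = -1) (he' : e' = 1 ∨ e' = -1) (hs : 0 < s) (hs' : 0 ≤ s')
    (ha' : a' ∈ Ico (0:ℝ) 1) (h : (a₀ : ℂ) + s * d = tent (e * δ) a)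
    (h' : (a₀ : ℂ) + s' * d = tent (e' * δ) a') : s = s' := by
  have r1 := congrArg Complex.re h
  have r2 := congrArg Complex.im h
  have r3 := congrArg Complex.re h'
  have r4 := congrArg Complex.im h'
  simp [tent] at r1 r2 r3 r4
  have t1 : 0 < min a (1 - a) := lt_min ha.1 (sub_pos.2 ha.2)
  have t2 : 0 ≤ min a' (1 - a') := le_min ha'.1 (sub_nonneg.2 ha'.2.le)
  have q1 : s * |d.im| = δ * min a (1 - a) := by
    rw [← abs_of_pos hs, ← abs_mul, r2, mul_assoc, abs_mul, abs_of_pos (mul_pos hδ t1)]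
    rcases he with rfl | rfl <;> simp
  have q2 : s' * |d.im| = δ * min a' (1 - a') := by
    rw [← abs_of_nonneg hs', ← abs_mul, r4, mul_assoc, abs_mul,
      abs_of_nonneg (mul_nonneg hδ.le t2)]
    rcases he' with rfl | rfl <;> simp
  have hd0 : d.im ≠ 0 := by
    intro h0
    rw [h0, abs_zero, mul_zero] at q1
    exact (mul_pos hδ t1).ne q1
  have hL := abs_min_sub_min_le a a'
  have e1 : a - a' = (s - s') * d.re := by linear_combination r3 - r1
  rw [e1, abs_mul] at hL
  have e2 : |s - s'| * |d.im| = δ * |min a (1 - a) - min a' (1 - a')| := by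
    have h3 : (s - s') * |d.im| = δ * (min a (1 - a) - min a' (1 - a')) := by
      linear_combination q1 - q2
    have h4 := congrArg abs h3
    rwa [abs_mul, abs_abs, abs_mul, abs_of_pos hδ] at h4
  by_contra hne
  have h3 : 0 < |s - s'| := abs_pos.2 (sub_ne_zero.2 hne)
  have := mul_lt_mul_of_pos_left (hd hd0) h3
  have := mul_le_mul_of_nonneg_left hL hδ.le
  nlinarith

/-- The arms of the modified loops: the upper tent traversed backwards on `[0, 1/3]`,
the lower tent on `[2/3, 1]`. -/
noncomputable def arm (δ u : ℝ) : ℂ :=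
  if u ≤ 1 / 2 then tent δ (1 - 3 * u) else tent (-δ) (3 * u - 2)

/-- A loop with two arms attached. -/
noncomputable def armLoop (δ : ℝ) (f : ℝ → ℂ) (t : ℝ) : ℂ :=
  if t ≤ 1 / 3 then tent δ (1 - 3 * t) else
    if t ≤ 2 / 3 then f (3 * t - 1) else tent (-δ) (3 * t - 2)

theorem arm_eq {δ u : ℝ} (hu : u ∈ Ioo (0:ℝ) 1) (hu' : u ∉ Ioo (1 / 3 : ℝ) (2 / 3)) :
    ∃ e : ℝ, (e = 1 ∨ e = -1) ∧ ∃ a ∈ Ico (0:ℝ) 1, arm δ u = tent (e * δ) a ∧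
      u = 1 / 2 - e * (1 / 6 + a / 3) := by
  rw [mem_Ioo, not_and_or, not_lt, not_lt] at hu'
  unfold arm
  rcases hu' with h | h
  · refine ⟨1, Or.inl rfl, 1 - 3 * u, ⟨by linarith, by linarith [hu.1]⟩, ?_, by ring⟩
    rw [if_pos (by linarith), one_mul]
  · refine ⟨-1, Or.inr rfl, 3 * u - 2, ⟨by linarith, by linarith [hu.2]⟩, ?_, by ring⟩
    rw [if_neg (by linarith), neg_one_mul]

theorem exists_arm_cover {f : ℝ → ℂ} (hf : Continuous f) (hf1 : ∀ t ∈ Icc (0:ℝ) 1, f t ≠ 1)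
    (h0 : f 0 = 0) (h1 : f 1 = 0) {H : Finset ℝ}
    (hH : ∀ t ∈ Ioo (0:ℝ) 1, ∀ s ∈ Ico (0:ℝ) 1, f t = s → t ∈ H)
    (hlin : ∀ t ∈ Icc (0:ℝ) 1, ∀ s ∈ Ico (0:ℝ) 1, f t = s → LinearNear f t) :
    ∃ δ₀ > 0, ∀ δ ∈ Ioo 0 δ₀, ∃ A : Finset (ℝ × ℝ), A.card ≤ 2 * H.card ∧
      ∀ t ∈ Ioo (0:ℝ) 1, ∀ u ∈ Ioo (0:ℝ) 1, u ∉ Ioo (1 / 3 : ℝ) (2 / 3) → f t = arm δ u →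
        (t, u) ∈ A := by
  classical
  let T : Finset ℝ := (insert 0 (insert 1 H)).filter
    fun t => t ∈ Icc (0:ℝ) 1 ∧ ∃ s ∈ Ico (0:ℝ) 1, f t = s
  have hT : ∀ t, t ∈ T ↔ t ∈ Icc (0:ℝ) 1 ∧ ∃ s ∈ Ico (0:ℝ) 1, f t = s := by
    intro t
    simp only [T, Finset.mem_filter, Finset.mem_insert, and_iff_right_iff_imp]
    rintro ⟨ht, s, hs, h⟩
    rcases ht.1.eq_or_lt with rfl | ht0
    · simp
    rcases ht.2.eq_or_lt with rfl | ht1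
    · simp
    exact Or.inr (Or.inr (hH t ⟨ht0, ht1⟩ s hs h))
  have hlin' : ∀ t ∈ T, LinearNear f t := fun t ht => by
    obtain ⟨h, s, hs, h'⟩ := (hT t).1 ht
    exact hlin t h s hs h'
  choose! ε hε d hd using hlin'
  obtain ⟨δ₁, hδ₁, hK⟩ : ∃ δ₁ > 0, ∀ t ∈ Icc (0:ℝ) 1, (∀ a ∈ T, ε a ≤ |t - a|) →
      ∀ a ∈ Icc (0:ℝ) 1, δ₁ ≤ ‖f t - a‖ := by
    have hKc : IsCompact ((Icc (0:ℝ) 1 ∩ {t | ∀ a ∈ T, ε a ≤ |t - a|}) ×ˢ Icc (0:ℝ) 1) := by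
      refine (isCompact_Icc.inter_right ?_).prod isCompact_Icc
      simp only [Set.ofPred_forall]
      exact isClosed_biInter fun a _ => isClosed_le continuous_const (by fun_prop)
    rcases ((Icc (0:ℝ) 1 ∩ {t | ∀ a ∈ T, ε a ≤ |t - a|}) ×ˢ Icc (0:ℝ) 1).eq_empty_or_nonempty
      with he | hne
    · exact ⟨1, one_pos, fun t ht h a ha =>
        (eq_empty_iff_forall_notMem.1 he (t, a) ⟨⟨ht, h⟩, ha⟩).elim⟩
    · obtain ⟨⟨t, a⟩, ⟨⟨ht, hta⟩, ha⟩, hmin⟩ := hKc.exists_isMinOn hne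
        (f := fun q => ‖f q.1 - q.2‖) (by fun_prop)
      refine ⟨‖f t - a‖, ?_, fun t' ht' h a' ha' =>
        hmin (show (t', a') ∈ _ from ⟨⟨ht', h⟩, ha'⟩)⟩
      rw [gt_iff_lt, norm_sub_pos_iff]
      intro h
      rcases ha.2.eq_or_lt with h' | h'
      · exact hf1 t ht (by simpa [show a = 1 from h'] using h)
      · have := hta t ((hT t).2 ⟨ht, a, ⟨ha.1, h'⟩, h⟩)
        rw [sub_self, abs_zero] at this
        exact this.not_gt (hε t ((hT t).2 ⟨ht, a, ⟨ha.1, h'⟩, h⟩))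
  have hev : ∀ᶠ δ in 𝓝[>] (0:ℝ), ∀ t ∈ T, ∀ e ∈ ({1, -1} : Finset ℝ), (d t e).im ≠ 0 →
      δ * |(d t e).re| < |(d t e).im| := by
    refine T.eventually_all.2 fun t _ => Finset.eventually_all _ |>.2 fun e _ => ?_
    by_cases hd0 : (d t e).im = 0
    · simp [hd0]
    have hc : ContinuousAt (fun δ : ℝ => δ * |(d t e).re|) 0 := by fun_prop
    have := hc.eventually_lt (continuousAt_const (y := |(d t e).im|)) (by simpa using hd0)
    filter_upwards [this.filter_mono nhdsWithin_le_nhds] with δ h _ using h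
  obtain ⟨δ₂, hδ₂, hsub⟩ := mem_nhdsGT_iff_exists_Ioo_subset.1 hev
  refine ⟨min δ₁ δ₂, lt_min hδ₁ hδ₂, fun δ hδ => ?_⟩
  have hδ0 := hδ.1
  have hdd : ∀ t ∈ T, ∀ e, (e = 1 ∨ e = -1) → (d t e).im ≠ 0 →
      δ * |(d t e).re| < |(d t e).im| := fun t ht e he =>
    hsub ⟨hδ.1, hδ.2.trans_le (min_le_right _ _)⟩ t ht e (by simpa using he)
  have hnz : ∀ {t₀ e s e' a}, t₀ ∈ T → (e = 1 ∨ e = -1) → s ∈ Ioc 0 (ε t₀) →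
      t₀ + e * s ∈ Icc (0:ℝ) 1 → (e' = 1 ∨ e' = -1) → a ∈ Ioo (0:ℝ) 1 →
      f (t₀ + e * s) = tent (e' * δ) a → f t₀ ≠ 0 := by
    intro t₀ e s e' a ht₀ he hs hm he' ha h hz
    rw [hd t₀ ht₀ e he s ⟨hs.1.le, hs.2⟩ hm, hz] at h
    exact hs.1.ne' (strand_tent_unique (a₀ := 0) hδ0 (hdd t₀ ht₀ e he) ha he' (Or.inl rfl) hs.1
      le_rfl (a' := 0) ⟨le_rfl, one_pos⟩ (by simpa using h) (by simp))
  let X : ℝ × ℝ → Set (ℝ × ℝ) := fun p => {q |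
      (q.1 = p.1 ∧ q.2 = 1 / 2 - p.2 * (1 / 6) ∧ f p.1 = 0) ∨
    (f p.1 ≠ 0 ∧ p.1 ∈ T ∧ ∃ s ∈ Ioc 0 (ε p.1), q.1 = p.1 + p.2 * s ∧ q.1 ∈ Icc (0:ℝ) 1 ∧
      ∃ e, (e = 1 ∨ e = -1) ∧ ∃ a ∈ Ioo (0:ℝ) 1, f q.1 = tent (e * δ) a ∧
        q.2 = 1 / 2 - e * (1 / 6 + a / 3))}
  have hX : ∀ p ∈ H ×ˢ ({1, -1} : Finset ℝ), ∃ q, X p ⊆ {q} := by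
    rintro ⟨t₀, e⟩ hp
    have he : e = 1 ∨ e = -1 := by simpa using (Finset.mem_product.1 hp).2
    refine ⟨if h : (X (t₀, e)).Nonempty then h.some else 0, ?_⟩
    suffices h : (X (t₀, e)).Subsingleton by
      intro q hq
      have hne : (X (t₀, e)).Nonempty := ⟨q, hq⟩
      rw [dif_pos hne]
      exact h hq hne.some_mem
    rintro ⟨t, u⟩ (h | ⟨hz, hT0, s, hs, rfl, hm, e1, he1, a, ha, h, rfl⟩) ⟨t', u'⟩
      (h' | ⟨hz', -, s', hs', rfl, hm', e2, he2, a', ha', h', rfl⟩)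
    · exact Prod.ext (h.1.trans h'.1.symm) (h.2.1.trans h'.2.1.symm)
    · exact absurd h.2.2 hz'
    · exact absurd h'.2.2 hz
    · simp only at h h' hm hm' hs hs' hT0
      obtain ⟨a₀, ha₀⟩ : ∃ a₀ : ℝ, f t₀ = a₀ := by
        obtain ⟨-, s, -, h⟩ := (hT t₀).1 hT0
        exact ⟨s, h⟩
      have g := h
      have g' := h'
      rw [hd t₀ hT0 e he s ⟨hs.1.le, hs.2⟩ hm, ha₀] at g
      rw [hd t₀ hT0 e he s' ⟨hs'.1.le, hs'.2⟩ hm', ha₀] at g'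
      have hss := strand_tent_unique hδ0 (hdd t₀ hT0 e he) ha he1 he2 hs.1 hs'.1.le
        ⟨ha'.1.le, ha'.2⟩ g g'
      subst hss
      obtain ⟨rfl, h3⟩ := tent_injective ha (h.symm.trans h')
      rw [mul_right_cancel₀ hδ0.ne' h3]
  choose! φ hφ using hX
  refine ⟨(H ×ˢ {1, -1}).image φ, Finset.card_image_le.trans ?_, ?_⟩
  · rw [Finset.card_product, mul_comm]
    exact Nat.mul_le_mul_right _ Finset.card_le_two
  intro t ht u hu hu' h
  rw [Finset.mem_image]
  obtain ⟨e, he, a, ha, harm, hua⟩ := arm_eq (δ := δ) hu hu'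
  rw [harm] at h
  rcases ha.1.eq_or_lt with rfl | ha0
  · have htH : t ∈ H := hH t ht 0 ⟨le_rfl, one_pos⟩ (by simpa using h)
    have hp : (t, e) ∈ H ×ˢ ({1, -1} : Finset ℝ) := by simpa [htH] using he
    have hq : (t, u) ∈ X (t, e) := Or.inl ⟨rfl, by simpa using hua, by simpa using h⟩
    exact ⟨(t, e), hp, (hφ _ hp hq).symm⟩
  have hT1 : 0 < min a (1 - a) := lt_min ha0 (sub_pos.2 ha.2)
  have htT : t ∉ T := by
    intro h'
    obtain ⟨-, s, -, h'⟩ := (hT t).1 h'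
    have := congrArg Complex.im (h.symm.trans h')
    simp only [tent, Complex.ofReal_im] at this
    rcases he with rfl | rfl <;> simp [hδ0.ne', hT1.ne'] at this
  have hnear : ¬ ∀ a ∈ T, ε a ≤ |t - a| := by
    intro hfar
    have h2 := hK t ⟨ht.1.le, ht.2.le⟩ hfar a ⟨ha.1, ha.2.le⟩
    have h3 : f t - a = ((e * δ * min a (1 - a) : ℝ) : ℂ) * Complex.I := by
      rw [h]; apply Complex.ext <;> simp [tent]
    have h4 : |e| = 1 := by rcases he with rfl | rfl <;> simp
    rw [h3, norm_mul, Complex.norm_I, mul_one, Complex.norm_real, Real.norm_eq_abs,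
        abs_mul, abs_mul,
      h4, one_mul, abs_of_pos hδ0, abs_of_pos hT1] at h2
    have h5 : min a (1 - a) ≤ 1 := (min_le_left _ _).trans ha.2.le
    have := mul_le_of_le_one_right hδ0.le h5
    linarith [hδ.2, min_le_left δ₁ δ₂]
  push Not at hnear
  obtain ⟨t₀, ht₀, htt⟩ := hnear
  obtain ⟨e', he', s, hs, rfl⟩ : ∃ e : ℝ, (e = 1 ∨ e = -1) ∧ ∃ s > 0, t = t₀ + e * s := by
    rcases (show t ≠ t₀ by rintro rfl; exact htT ht₀).lt_or_gt with h | h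
    · exact ⟨-1, Or.inr rfl, t₀ - t, sub_pos.2 h, by ring⟩
    · exact ⟨1, Or.inl rfl, t - t₀, sub_pos.2 h, by ring⟩
  have hsε : s ∈ Ioc 0 (ε t₀) := by
    rw [add_sub_cancel_left, abs_mul, abs_of_pos hs] at htt
    refine ⟨hs, ?_⟩
    rcases he' with rfl | rfl <;> simpa using htt.le
  have hm : t₀ + e' * s ∈ Icc (0:ℝ) 1 := ⟨ht.1.le, ht.2.le⟩
  have hz := hnz ht₀ he' hsε hm he ⟨ha0, ha.2⟩ h
  have htH : t₀ ∈ H := by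
    have h2 := Finset.mem_insert.1 (Finset.mem_filter.1 ht₀).1
    rcases h2 with rfl | h2
    · exact absurd h0 hz
    rcases Finset.mem_insert.1 h2 with rfl | h2
    · exact absurd h1 hz
    · exact h2
  have hp : (t₀, e') ∈ H ×ˢ ({1, -1} : Finset ℝ) := by simpa [htH] using he'
  have hq : (t₀ + e' * s, u) ∈ X (t₀, e') :=
    Or.inr ⟨hz, ht₀, s, hsε, rfl, hm, e, he, a, ⟨ha0, ha.2⟩, h, hua⟩
  exact ⟨(t₀, e'), hp, (hφ _ hp hq).symm⟩

end

section

open Set Topology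

/-- A continuous loop at `x` whose interior avoids `V`. -/
structure IsLoopAt (V : Set ℂ) (x : ℂ) (f : ℝ → ℂ) : Prop where
  continuous : Continuous f
  source : f 0 = x
  target : f 1 = x
  notMem : ∀ t ∈ Ioo (0:ℝ) 1, f t ∉ V

/-- The interior intersections of two curves. -/
def crossings (f g : ℝ → ℂ) : Set (ℝ × ℝ) :=
  {p | p.1 ∈ Ioo (0:ℝ) 1 ∧ p.2 ∈ Ioo (0:ℝ) 1 ∧ f p.1 = g p.2}

/-- The interior self-intersections of a curve. -/
def selfCrossings (f : ℝ → ℂ) : Set (ℝ × ℝ) :=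
  {p | p.1 ∈ Ioo (0:ℝ) 1 ∧ p.2 ∈ Ioo (0:ℝ) 1 ∧ p.1 < p.2 ∧ f p.1 = f p.2}

/-- Homotopy of curves relative to their endpoints, with interiors avoiding `V`. -/
def RelHomotopic (V : Set ℂ) (f g : ℝ → ℂ) : Prop :=
  ∃ H : ℝ → ℝ → ℂ, ContinuousOn (fun p : ℝ × ℝ => H p.1 p.2) (Icc 0 1 ×ˢ Icc 0 1) ∧
    (∀ t ∈ Icc (0:ℝ) 1, H 0 t = f t ∧ H 1 t = g t) ∧
    (∀ s ∈ Icc (0:ℝ) 1, H s 0 = f 0 ∧ H s 1 = f 1) ∧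
    ∀ s ∈ Icc (0:ℝ) 1, ∀ t ∈ Ioo (0:ℝ) 1, H s t ∉ V

/-- Families of pairwise non-homotopic loops at an obstacle, with fewer than `k` intersections,
have at most `M` members. -/
def LoopBound (n k M : ℕ) : Prop :=
  ∀ V : Set ℂ, V.ncard = n → ∀ v ∈ V, ∀ (m : ℕ) (L : Fin m → ℝ → ℂ),
    (∀ i, IsLoopAt V v (L i)) → (∀ i, FewerThan k (selfCrossings (L i))) →
    (∀ i j, i ≠ j → FewerThan k (crossings (L i) (L j))) →
    (∀ i j, i ≠ j → ¬ RelHomotopic V (L i) (L j)) → m ≤ M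

theorem LoopBound.card_le {n k M : ℕ} (hB : LoopBound n k M) {V : Set ℂ} (hV : V.ncard = n)
    {v : ℂ} (hv : v ∈ V) {ι : Type*} (s : Finset ι) {L : ι → ℝ → ℂ}
    (hL : ∀ i ∈ s, IsLoopAt V v (L i)) (hself : ∀ i ∈ s, FewerThan k (selfCrossings (L i)))
    (hcross : ∀ i ∈ s, ∀ j ∈ s, i ≠ j → FewerThan k (crossings (L i) (L j)))
    (hnh : ∀ i ∈ s, ∀ j ∈ s, i ≠ j → ¬ RelHomotopic V (L i) (L j)) : s.card ≤ M := by
  have hne : ∀ i j, i ≠ j → (s.equivFin.symm i : ι) ≠ s.equivFin.symm j := fun i j h h' =>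
    h (s.equivFin.symm.injective (Subtype.ext h'))
  exact hB V hV v hv s.card (fun i => L (s.equivFin.symm i))
    (fun i => hL _ (s.equivFin.symm i).2) (fun i => hself _ (s.equivFin.symm i).2)
    (fun i j h => hcross _ (s.equivFin.symm i).2 _ (s.equivFin.symm j).2 (hne i j h))
    (fun i j h => hnh _ (s.equivFin.symm i).2 _ (s.equivFin.symm j).2 (hne i j h))

theorem continuous_armLoop (δ : ℝ) {f : ℝ → ℂ} (hf : Continuous f) (h0 : f 0 = 0) (h1 : f 1 = 0) :
    Continuous (armLoop δ f) := by
  have := continuous_tent δ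
  have := continuous_tent (-δ)
  unfold armLoop
  refine Continuous.if_le (by fun_prop) ?_ continuous_id continuous_const ?_
  · refine Continuous.if_le (by fun_prop) (by fun_prop) continuous_id continuous_const ?_
    rintro t rfl
    norm_num [h1]
  · rintro t rfl
    norm_num [h0]

theorem armLoop_of_mem {δ t : ℝ} {f : ℝ → ℂ} (ht : t ∈ Ioo (1 / 3 : ℝ) (2 / 3)) :
    armLoop δ f t = f (3 * t - 1) := by
  rw [armLoop, if_neg (not_le.2 ht.1), if_pos ht.2.le]

theorem armLoop_of_notMem {δ t : ℝ} {f : ℝ → ℂ} (h1 : f 1 = 0)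
    (ht : t ∉ Ioo (1 / 3 : ℝ) (2 / 3)) : armLoop δ f t = arm δ t := by
  rw [mem_Ioo, not_and_or, not_lt, not_lt] at ht
  unfold armLoop arm
  rcases ht with h | h
  · rw [if_pos h, if_pos (by linarith)]
  · rw [if_neg (by linarith), if_neg (by linarith : ¬ t ≤ 1 / 2)]
    rcases h.eq_or_lt with rfl | h
    · norm_num [h1]
    · rw [if_neg (by linarith)]

theorem three_mul_sub_one_mem {t : ℝ} (ht : t ∈ Ioo (1 / 3 : ℝ) (2 / 3)) :
    3 * t - 1 ∈ Ioo (0:ℝ) 1 := ⟨by linarith [ht.1], by linarith [ht.2]⟩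

theorem fewerThan_crossings_armLoop {k : ℕ} {δ δ' : ℝ} {f g : ℝ → ℂ} (hδ : 0 < δ) (hδ' : 0 < δ')
    (hne : δ ≠ δ') (hf1 : f 1 = 0) (hg1 : g 1 = 0) (hfg : FewerThan k (crossings f g))
    {A B : Finset (ℝ × ℝ)} (hA : A.card ≤ 2 * (k - 1)) (hB : B.card ≤ 2 * (k - 1))
    (hfA : ∀ t ∈ Ioo (0:ℝ) 1, ∀ u ∈ Ioo (0:ℝ) 1, u ∉ Ioo (1 / 3 : ℝ) (2 / 3) → f t = arm δ' u →
        (t, u) ∈ A)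
    (hgB : ∀ t ∈ Ioo (0:ℝ) 1, ∀ u ∈ Ioo (0:ℝ) 1, u ∉ Ioo (1 / 3 : ℝ) (2 / 3) → g t = arm δ u →
        (t, u) ∈ B) :
    FewerThan (5 * k) (crossings (armLoop δ f) (armLoop δ' g)) := by
  classical
  obtain ⟨J, hJ, hJ'⟩ := hfg
  refine ⟨J.image (fun p => ((p.1 + 1) / 3, (p.2 + 1) / 3)) ∪
      A.image (fun p => ((p.1 + 1) / 3, p.2))
    ∪ B.image (fun p => (p.2, (p.1 + 1) / 3)) ∪ ({1 / 3, 2 / 3} ×ˢ {1 / 3, 2 / 3}), ?_, ?_⟩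
  · refine (Finset.card_union_le _ _).trans_lt ?_
    have h1 := Finset.card_union_le (J.image (fun p => ((p.1 + 1) / 3, (p.2 + 1) / 3)) ∪
      A.image (fun p => ((p.1 + 1) / 3, p.2))) (B.image (fun p => (p.2, (p.1 + 1) / 3)))
    have h2 := Finset.card_union_le (J.image (fun p => ((p.1 + 1) / 3, (p.2 + 1) / 3)))
      (A.image (fun p => ((p.1 + 1) / 3, p.2)))
    have h3 : (J.image (fun p => ((p.1 + 1) / 3, (p.2 + 1) / 3))).card ≤ _ := Finset.card_image_le
    have h4 : (A.image (fun p => ((p.1 + 1) / 3, p.2))).card ≤ _ := Finset.card_image_le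
    have h5 : (B.image (fun p => (p.2, (p.1 + 1) / 3))).card ≤ _ := Finset.card_image_le
    have h6 : (({1 / 3, 2 / 3} : Finset ℝ) ×ˢ ({1 / 3, 2 / 3} : Finset ℝ)).card ≤ 2 * 2 := by
      rw [Finset.card_product]
      exact Nat.mul_le_mul Finset.card_le_two Finset.card_le_two
    omega
  · rintro ⟨t, u⟩ ⟨ht, hu, h⟩
    simp only at ht hu h
    simp only [Finset.coe_union, mem_union, Finset.mem_coe, Finset.mem_image]
    by_cases htm : t ∈ Ioo (1 / 3 : ℝ) (2 / 3) <;> by_cases hum : u ∈ Ioo (1 / 3 : ℝ) (2 / 3)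
    · refine Or.inl (Or.inl (Or.inl ⟨(3 * t - 1, 3 * u - 1), hJ' ⟨three_mul_sub_one_mem htm,
        three_mul_sub_one_mem hum, ?_⟩, by ext <;> simp⟩))
      rwa [armLoop_of_mem htm, armLoop_of_mem hum] at h
    · refine Or.inl (Or.inl (Or.inr ⟨(3 * t - 1, u), hfA _ (three_mul_sub_one_mem htm) _ hu hum ?_,
        by ext <;> simp⟩))
      rwa [armLoop_of_mem htm, armLoop_of_notMem hg1 hum] at h
    · refine Or.inl (Or.inr ⟨(3 * u - 1, t), hgB _ (three_mul_sub_one_mem hum) _ ht htm ?_,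
        by ext <;> simp⟩)
      rw [armLoop_of_notMem hf1 htm, armLoop_of_mem hum] at h
      exact h.symm
    · right
      rw [armLoop_of_notMem hf1 htm, armLoop_of_notMem hg1 hum] at h
      obtain ⟨e, he, a, ha, h1, ht'⟩ := arm_eq (δ := δ) ht htm
      obtain ⟨e', he', a', ha', h1', hu'⟩ := arm_eq (δ := δ') hu hum
      rw [h1, h1'] at h
      rcases ha.1.eq_or_lt with rfl | ha0
      · have h0 : (0:ℝ) = a' := congrArg Complex.re h
        subst h0
        rw [ht', hu']
        rcases he with rfl | rfl <;> rcases he' with rfl | rfl <;> norm_num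
      · exfalso
        have h2 := (tent_injective ⟨ha0, ha.2⟩ h).2
        rcases he with rfl | rfl <;> rcases he' with rfl | rfl <;>
          exact hne (by linarith)

theorem fewerThan_selfCrossings_armLoop {k : ℕ} {δ : ℝ} {f : ℝ → ℂ} (hk : 1 ≤ k) (hδ : 0 < δ)
    (hf1 : f 1 = 0) (hf : FewerThan k (selfCrossings f)) {A : Finset (ℝ × ℝ)}
    (hA : A.card ≤ 2 * (k - 1))
    (hfA : ∀ t ∈ Ioo (0:ℝ) 1, ∀ u ∈ Ioo (0:ℝ) 1, u ∉ Ioo (1 / 3 : ℝ) (2 / 3) → f t = arm δ u →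
        (t, u) ∈ A) :
    FewerThan (5 * k) (selfCrossings (armLoop δ f)) := by
  classical
  obtain ⟨J, hJ, hJ'⟩ := hf
  let φ : ℝ × ℝ → ℝ × ℝ := fun p => (min ((p.1 + 1) / 3) p.2, max ((p.1 + 1) / 3) p.2)
  refine ⟨J.image (fun p => ((p.1 + 1) / 3, (p.2 + 1) / 3)) ∪ A.image φ ∪ {(1 / 3, 2 / 3)}, ?_, ?_⟩
  · refine (Finset.card_union_le _ _).trans_lt ?_
    have h2 := Finset.card_union_le (J.image (fun p => ((p.1 + 1) / 3, (p.2 + 1) / 3)))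
      (A.image φ)
    have h3 : (J.image (fun p => ((p.1 + 1) / 3, (p.2 + 1) / 3))).card ≤ _ := Finset.card_image_le
    have h4 : (A.image φ).card ≤ _ := Finset.card_image_le
    rw [Finset.card_singleton]
    omega
  · rintro ⟨t, u⟩ ⟨ht, hu, htu, h⟩
    simp only at ht hu h htu
    simp only [Finset.coe_union, mem_union, Finset.mem_coe, Finset.mem_image]
    by_cases htm : t ∈ Ioo (1 / 3 : ℝ) (2 / 3) <;> by_cases hum : u ∈ Ioo (1 / 3 : ℝ) (2 / 3)
    · refine Or.inl (Or.inl ⟨(3 * t - 1, 3 * u - 1), hJ' ⟨three_mul_sub_one_mem htm,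
        three_mul_sub_one_mem hum, by simp only; linarith, ?_⟩, by ext <;> simp⟩)
      rwa [armLoop_of_mem htm, armLoop_of_mem hum] at h
    · refine Or.inl (Or.inr ⟨(3 * t - 1, u), hfA _ (three_mul_sub_one_mem htm) _ hu hum ?_, ?_⟩)
      · rwa [armLoop_of_mem htm, armLoop_of_notMem hf1 hum] at h
      · simp [φ, htu.le]
    · refine Or.inl (Or.inr ⟨(3 * u - 1, t), hfA _ (three_mul_sub_one_mem hum) _ ht htm ?_, ?_⟩)
      · rw [armLoop_of_notMem hf1 htm, armLoop_of_mem hum] at h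
        exact h.symm
      · simp [φ, htu.le]
    · right
      rw [armLoop_of_notMem hf1 htm, armLoop_of_notMem hf1 hum] at h
      obtain ⟨e, he, a, ha, h1, ht'⟩ := arm_eq (δ := δ) ht htm
      obtain ⟨e', he', a', ha', h1', hu'⟩ := arm_eq (δ := δ) hu hum
      rw [h1, h1'] at h
      rcases ha.1.eq_or_lt with rfl | ha0
      · have h0 : (0:ℝ) = a' := congrArg Complex.re h
        subst h0
        rw [ht', hu'] at htu ⊢
        rcases he with rfl | rfl <;> rcases he' with rfl | rfl <;>
          first | (exfalso; linarith) | norm_num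
      · exfalso
        obtain ⟨rfl, h2⟩ := tent_injective ⟨ha0, ha.2⟩ h
        rw [mul_right_cancel₀ hδ.ne' h2] at ht'
        exact htu.ne (ht'.trans hu'.symm)

/-- A loop avoiding `V`, as a path in the complement. -/
def IsLoopAt.path {V : Set ℂ} {x : {z : ℂ // z ∉ V}} {f : ℝ → ℂ} (hf : IsLoopAt V x f) :
    Path x x where
  toFun t := ⟨f t, by
    rcases t.2.1.eq_or_lt with h | h
    · rw [← h, hf.source]; exact x.2
    rcases t.2.2.eq_or_lt with h' | h'
    · rw [h', hf.target]; exact x.2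
    exact hf.notMem t ⟨h, h'⟩⟩
  continuous_toFun := (hf.continuous.comp continuous_subtype_val).subtype_mk _
  source' := Subtype.ext hf.source
  target' := Subtype.ext hf.target

theorem IsLoopAt.coe_path {V : Set ℂ} {x : {z : ℂ // z ∉ V}} {f : ℝ → ℂ} (hf : IsLoopAt V x f)
    (t : unitInterval) : (hf.path t : ℂ) = f t := rfl

theorem IsLoopAt.extend_path {V : Set ℂ} {x : {z : ℂ // z ∉ V}} {f : ℝ → ℂ} (hf : IsLoopAt V x f)
    {t : ℝ} (ht : t ∈ Ioo (0:ℝ) 1) : (hf.path.extend t : ℂ) = f t := by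
  rw [Path.extend_apply _ ⟨ht.1.le, ht.2.le⟩, hf.coe_path]

theorem IsLoopAt.relHomotopic {V : Set ℂ} {x : {z : ℂ // z ∉ V}} {f g : ℝ → ℂ}
    (hf : IsLoopAt V x f) (hg : IsLoopAt V x g) (h : loopClass hf.path = loopClass hg.path) :
    RelHomotopic V f g := by
  obtain ⟨F⟩ := loopClass_eq_iff.1 h
  refine ⟨fun s t => F (projIcc 0 1 zero_le_one s, projIcc 0 1 zero_le_one t), ?_, ?_, ?_, ?_⟩
  · exact (continuous_subtype_val.comp (F.continuous.comp (by fun_prop))).continuousOn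
  · intro t ht
    simp [projIcc_left, projIcc_right, projIcc_of_mem _ ht, hf.coe_path, hg.coe_path]
  · intro s _
    simp [projIcc_left, projIcc_right, hf.source, hf.target]
  · exact fun s _ t _ => (F _).2

theorem ConeSeparated.arm_mem {V : Set ℂ} {κ : ℝ} (hV : ConeSeparated V κ) {δ a : ℝ} (hδ : |δ| ≤ κ)
    (ha : a ∈ Icc (0:ℝ) 1) : tent δ a ∈ rayCone κ 1 := by
  have h1 : 0 ≤ min a (1 - a) := le_min ha.1 (sub_nonneg.2 ha.2)
  simp only [rayCone, mem_ofPred_eq, div_one, tent, abs_mul, abs_of_nonneg h1]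
  exact mul_le_mul hδ (min_le_left _ _) h1 hV.pos.le

theorem ConeSeparated.isLoopAt_armLoop {V : Set ℂ} {κ : ℝ} (hV : ConeSeparated V κ)
    (h1 : (1 : ℂ) ∈ V) {δ : ℝ} (hδ : |δ| ≤ κ) {f : ℝ → ℂ} (hf : IsLoopAt V 0 f) :
    IsLoopAt V 1 (armLoop δ f) := by
  refine ⟨continuous_armLoop δ hf.continuous hf.source hf.target, by norm_num [armLoop],
    by norm_num [armLoop], fun t ht => ?_⟩
  by_cases htm : t ∈ Ioo (1 / 3 : ℝ) (2 / 3)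
  · rw [armLoop_of_mem htm]
    exact hf.notMem _ (three_mul_sub_one_mem htm)
  · rw [armLoop_of_notMem hf.target htm]
    obtain ⟨e, he, a, ha, h, -⟩ := arm_eq (δ := δ) ht htm
    rw [h]
    intro hm
    have h2 := hV.eq_of_mem 1 h1 _ hm (hV.arm_mem (by
      rcases he with rfl | rfl <;> simpa using hδ) ⟨ha.1, ha.2.le⟩)
    exact ha.2.ne (congrArg Complex.re h2)

theorem ConeSeparated.card_le_of_linearNear {n k M : ℕ} (hB : LoopBound n (5 * k) M) (hk : 1 ≤ k)
    {V : Set ℂ} (hVn : V.ncard = n) (hfin : V.Finite) {κ : ℝ} (hV : ConeSeparated V κ)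
    (h1 : (1 : ℂ) ∈ V) {ι : Type*} [Fintype ι] {f : ι → ℝ → ℂ} (hf : ∀ i, IsLoopAt V 0 (f i))
    (hself : ∀ i, FewerThan k (selfCrossings (f i)))
    (hcross : ∀ i j, i ≠ j → FewerThan k (crossings (f i) (f j)))
    (hhit : ∀ i, FewerThan k {t | t ∈ Ioo (0:ℝ) 1 ∧ ∃ s ∈ Ico (0:ℝ) 1, f i t = s})
    (hlin : ∀ i, ∀ t ∈ Icc (0:ℝ) 1, ∀ s ∈ Ico (0:ℝ) 1, f i t = s → LinearNear (f i) t)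
    (hnh : ∀ i j, i ≠ j → ¬ RelHomotopic V (f i) (f j)) :
    Fintype.card ι ≤ 121 * k ^ 2 * M := by
  classical
  have hnotMem : ∀ i, ∀ t ∈ Icc (0:ℝ) 1, f i t ∉ V := by
    intro i t ht
    rcases ht.1.eq_or_lt with rfl | h
    · rw [(hf i).source]; exact hV.zero_notMem
    rcases ht.2.eq_or_lt with rfl | h'
    · rw [(hf i).target]; exact hV.zero_notMem
    exact (hf i).notMem t ⟨h, h'⟩
  choose H hHk hH using hhit
  choose δ₀ hδ₀ A hA hA' using fun i => exists_arm_cover (hf i).continuous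
    (fun t ht h => hnotMem i t ht (h ▸ h1)) (hf i).source (hf i).target (H := H i)
    (fun t ht s hs h => hH i ⟨ht, s, hs, h⟩) (hlin i)
  obtain ⟨δ, hδ, hδinj⟩ : ∃ δ : ι → ℝ, (∀ i, 0 < δ i ∧ δ i ≤ κ ∧ ∀ j, δ i < δ₀ j) ∧
      Function.Injective δ := by
    obtain ⟨r, hr, hrκ, hrδ⟩ : ∃ r > 0, r ≤ κ ∧ ∀ j, r ≤ δ₀ j := by
      have h1 : ∀ᶠ r in 𝓝[>] (0:ℝ), ∀ j, r ≤ δ₀ j := Filter.eventually_all.2 fun j => by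
        filter_upwards [Ioo_mem_nhdsGT (hδ₀ j)] with r hr using hr.2.le
      obtain ⟨r, h1, h2⟩ := (h1.and (Ioo_mem_nhdsGT hV.pos)).exists
      exact ⟨r, h2.1, h2.2.le, h1⟩
    have hlt : ∀ i : ι, r / ((Fintype.equivFin ι i : ℕ) + 2 : ℝ) < r := fun i =>
      div_lt_self hr (by linarith [Nat.cast_nonneg (α := ℝ) (Fintype.equivFin ι i : ℕ)])
    refine ⟨fun i => r / ((Fintype.equivFin ι i : ℕ) + 2 : ℝ), fun i => ⟨by positivity,
      (hlt i).le.trans hrκ, fun j => (hlt i).trans_le (hrδ j)⟩, fun i j h => ?_⟩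
    have h2 := h
    simp only at h2
    rw [div_eq_div_iff (by positivity) (by positivity)] at h2
    have h3 := mul_left_cancel₀ hr.ne' h2
    simpa [Fin.val_inj, eq_comm] using h3
  have hκ : ∀ i, |δ i| ≤ κ := fun i => by rw [abs_of_pos (hδ i).1]; exact (hδ i).2.1
  have hf' : ∀ i, IsLoopAt V hV.base (f i) := hf
  refine card_le_of_doubleCoset (hV := hV) (P := fun i => (hf' i).path) hfin h1 hk ?_ ?_ ?_ ?_ ?_
  · exact fun i => ⟨H i, hHk i, fun t ht s hs h =>
      hH i ⟨ht, s, hs, by rwa [(hf' i).extend_path ht] at h⟩⟩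
  · intro i
    obtain ⟨J, hJ, hJ'⟩ := hself i
    refine ⟨J, hJ, fun t ht u hu htu h => hJ' ⟨ht, hu, htu, ?_⟩⟩
    have := congrArg Subtype.val h
    rwa [(hf' i).extend_path ht, (hf' i).extend_path hu] at this
  · intro i j hij
    obtain ⟨J, hJ, hJ'⟩ := hcross i j hij
    refine ⟨J, hJ, fun t ht u hu h => hJ' ⟨ht, hu, ?_⟩⟩
    have := congrArg Subtype.val h
    rwa [(hf' i).extend_path ht, (hf' j).extend_path hu] at this
  · exact fun i j hij h => hnh i j hij ((hf' i).relHomotopic (hf' j) h)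
  · intro s hs
    have hAk : ∀ i j, (A i (δ j) ⟨(hδ j).1, (hδ j).2.2 i⟩).card ≤ 2 * (k - 1) := fun i j =>
      (hA i (δ j) ⟨(hδ j).1, (hδ j).2.2 i⟩).trans (by have := hHk i; omega)
    refine hB.card_le hVn h1 s (L := fun i => armLoop (δ i) (f i))
      (fun i _ => hV.isLoopAt_armLoop h1 (hκ i) (hf i)) (fun i _ => ?_) (fun i _ j _ hij => ?_)
      (fun i hi j hj hij => ?_)
    · exact fewerThan_selfCrossings_armLoop hk (hδ i).1 (hf i).target (hself i) (hAk i i)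
        (hA' i _ _)
    · exact fewerThan_crossings_armLoop (hδ i).1 (hδ j).1 (fun h => hij (hδinj h)) (hf i).target
        (hf j).target (hcross i j hij) (hAk i j) (hAk j i) (hA' i _ _) (hA' j _ _)
    · rintro ⟨G, hG, hG01, hGs, hGV⟩
      have hLi : ∀ i, IsLoopAt V 1 (armLoop (δ i) (f i)) := fun i =>
        hV.isLoopAt_armLoop h1 (hκ i) (hf i)
      have hmid : ∀ i, ∀ t : unitInterval, armLoop (δ i) (f i) (1 / 3 + t / 3) = f i t := by
        intro i t
        rcases t.2.1.eq_or_lt with h | h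
        · rw [← h, (hf i).source]; norm_num [armLoop]
        · rw [armLoop, if_neg (by linarith), if_pos (by linarith [t.2.2])]
          congr 1; ring
      have hcone : ∀ i, ∀ t ∈ Icc (0:ℝ) (1 / 3), armLoop (δ i) (f i) t ∈ rayCone κ 1 ∧
          armLoop (δ i) (f i) (1 - t) ∈ rayCone κ 1 := by
        intro i t ht
        constructor
        · rw [armLoop, if_pos ht.2]
          exact hV.arm_mem (hκ i) ⟨by linarith [ht.2], by linarith [ht.1]⟩
        · have e : armLoop (δ i) (f i) (1 - t) = tent (-δ i) (3 * (1 - t) - 2) := by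
            rw [armLoop_of_notMem (hf i).target (fun h => by linarith [h.2, ht.2]), arm,
              if_neg (by linarith [ht.2])]
          rw [e]
          exact hV.arm_mem (by simpa using hκ i) ⟨by linarith [ht.2], by linarith [ht.1]⟩
      obtain ⟨a, b, h⟩ := exists_eq_zpow_mul_of_square (hV := hV) h1 (P := (hf' i).path)
        (Q := (hf' j).path) G hG hGV
        (fun s hs => (hGs s hs).1.trans (hLi i).source)
            (fun s hs => (hGs s hs).2.trans (hLi i).target)
        (by
          rintro s (rfl | rfl) t ht
          · have h1 := hG01 t ⟨ht.1, by linarith [ht.2]⟩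
            have h2 := hG01 (1 - t) ⟨by linarith [ht.2], by linarith [ht.1]⟩
            rw [h1.1, h2.1]; exact hcone i t ht
          · have h1 := hG01 t ⟨ht.1, by linarith [ht.2]⟩
            have h2 := hG01 (1 - t) ⟨by linarith [ht.2], by linarith [ht.1]⟩
            rw [h1.2, h2.2]; exact hcone j t ht)
        (fun t => by rw [(hG01 _ ⟨by linarith [t.2.1], by linarith [t.2.2]⟩).1, hmid]; rfl)
        (fun t => by rw [(hG01 _ ⟨by linarith [t.2.1], by linarith [t.2.2]⟩).2, hmid]; rfl)
      exact hs i hi j hj hij a b h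

theorem RelHomotopic.symm {V : Set ℂ} {f g : ℝ → ℂ} (h : RelHomotopic V f g) (h0 : f 0 = g 0)
    (h1 : f 1 = g 1) : RelHomotopic V g f := by
  obtain ⟨H, hH, hfg, hend, hV⟩ := h
  have hs : ∀ s ∈ Icc (0:ℝ) 1, 1 - s ∈ Icc (0:ℝ) 1 := fun s hs =>
    ⟨by linarith [hs.2], by linarith [hs.1]⟩
  refine ⟨fun s t => H (1 - s) t, ?_, fun t ht => ?_, fun s hs' => ?_, fun s hs' => hV _ (hs s hs')⟩
  · exact hH.comp (f := fun p : ℝ × ℝ => (1 - p.1, p.2)) (by fun_prop)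
      fun p hp => ⟨hs _ hp.1, hp.2⟩
  · simpa using (hfg t ht).symm
  · rw [← h0, ← h1]
    exact hend _ (hs s hs')

theorem RelHomotopic.trans {V : Set ℂ} {f g k : ℝ → ℂ} (h : RelHomotopic V f g)
    (h' : RelHomotopic V g k) : RelHomotopic V f k := by
  obtain ⟨H, hH, hfg, hend, hV⟩ := h
  obtain ⟨H', hH', hfg', hend', hV'⟩ := h'
  have h0 : g 0 = f 0 := by
    rw [← (hfg 0 (by simp)).2, (hend 1 (by simp)).1]
  have h1 : g 1 = f 1 := by
    rw [← (hfg 1 (by simp)).2, (hend 1 (by simp)).2]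
  have e1 : ∀ s : ℝ, s ∈ Icc (0:ℝ) 1 → s ≤ 1 / 2 → 2 * s ∈ Icc (0:ℝ) 1 := fun s h h' =>
    ⟨by linarith [h.1], by linarith⟩
  have e2 : ∀ s : ℝ, s ∈ Icc (0:ℝ) 1 → 1 / 2 ≤ s → 2 * s - 1 ∈ Icc (0:ℝ) 1 := fun s h h' =>
    ⟨by linarith, by linarith [h.2]⟩
  refine ⟨fun s t => if s ≤ 1 / 2 then H (2 * s) t else H' (2 * s - 1) t, ?_, fun t ht => ?_,
    fun s hs => ?_, fun s hs t ht => ?_⟩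
  · have hcl : closure {p : ℝ × ℝ | p.1 ≤ 1 / 2} ⊆ {p | p.1 ≤ 1 / 2} :=
      (isClosed_le continuous_fst continuous_const).closure_subset
    have hcl' : closure {p : ℝ × ℝ | ¬ p.1 ≤ 1 / 2} ⊆ {p | 1 / 2 ≤ p.1} :=
      closure_minimal (fun p hp => (not_le.1 hp).le) (isClosed_le continuous_const continuous_fst)
    refine ContinuousOn.if ?_ ?_ ?_
    · rintro ⟨s, t⟩ ⟨hp, hfr⟩
      have hs : s = 1 / 2 := frontier_le_subset_eq continuous_fst continuous_const hfr
      subst hs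
      norm_num
      rw [(hfg t hp.2).2, (hfg' t hp.2).1]
    · exact hH.comp (f := fun p : ℝ × ℝ => (2 * p.1, p.2)) (by fun_prop)
        fun p hp => ⟨e1 _ hp.1.1 (hcl hp.2), hp.1.2⟩
    · exact hH'.comp (f := fun p : ℝ × ℝ => (2 * p.1 - 1, p.2)) (by fun_prop)
        fun p hp => ⟨e2 _ hp.1.1 (hcl' hp.2), hp.1.2⟩
  · have := (hfg t ht).1
    have := (hfg' t ht).2
    norm_num
    tauto
  · by_cases h : s ≤ 1 / 2
    · simpa only [if_pos h] using hend _ (e1 s hs h)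
    · simpa only [if_neg h, h0, h1] using hend' _ (e2 s hs (not_le.1 h).le)
  · by_cases h : s ≤ 1 / 2
    · simpa only [if_pos h] using hV _ (e1 s hs h) t ht
    · simpa only [if_neg h] using hV' _ (e2 s hs (not_le.1 h).le) t ht

theorem RelHomotopic.comp {V : Set ℂ} {f g : ℝ → ℂ} (h : RelHomotopic V f g) {φ : ℂ → ℂ}
    (hφ : Continuous φ) {W : Set ℂ} (hW : φ ⁻¹' W ⊆ V) :
    RelHomotopic W (φ ∘ f) (φ ∘ g) := by
  obtain ⟨H, hH, hfg, hend, hV⟩ := h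
  exact ⟨fun s t => φ (H s t), hφ.comp_continuousOn hH,
    fun t ht => ⟨congrArg φ (hfg t ht).1, congrArg φ (hfg t ht).2⟩,
    fun s hs => ⟨congrArg φ (hend s hs).1, congrArg φ (hend s hs).2⟩,
    fun s hs t ht h => hV s hs t ht (hW h)⟩

theorem relHomotopic_comp_homeomorph_iff {V : Set ℂ} {f g : ℝ → ℂ} (h : ℂ ≃ₜ ℂ) :
    RelHomotopic (h '' V) (h ∘ f) (h ∘ g) ↔ RelHomotopic V f g := by
  refine ⟨fun H => ?_, fun H => H.comp h.continuous (by rw [h.injective.preimage_image])⟩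
  have := H.comp h.symm.continuous (W := V) (by rw [← h.image_eq_preimage_symm])
  simpa only [← Function.comp_assoc, h.symm_comp_self, Function.id_comp] using this

theorem relHomotopic_of_segment {V : Set ℂ} {f g : ℝ → ℂ} (hf : Continuous f) (hg : Continuous g)
    (h0 : g 0 = f 0) (h1 : g 1 = f 1)
    (hV : ∀ t ∈ Ioo (0:ℝ) 1, ∀ s ∈ Icc (0:ℝ) 1, f t + s * (g t - f t) ∉ V) :
    RelHomotopic V f g := by
  refine ⟨fun s t => f t + s * (g t - f t), by fun_prop, fun t _ => by simp, fun s _ => by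
    simp [h0, h1], fun s hs t ht => hV t ht s hs⟩

/-- A perturbation moving points only inside balls of radius `η`, where `η` is at most a third of
the distance to the obstacles, does not change the homotopy class. -/
theorem relHomotopic_of_close {V : Set ℂ} {f g : ℝ → ℂ} (hf : Continuous f) (hg : Continuous g)
    (h0 : g 0 = f 0) (h1 : g 1 = f 1) {η : ℝ}
    (hη : ∀ t ∈ Icc (0:ℝ) 1, ∀ v ∈ V, 2 * η < dist (f t) v) (hd : ∀ t ∈ Icc (0:ℝ) 1,
      dist (g t) (f t) ≤ 2 * η) : RelHomotopic V f g := by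
  refine relHomotopic_of_segment hf hg h0 h1 fun t ht s hs hm => ?_
  have ht' := Ioo_subset_Icc_self ht
  have h2 := hη t ht' _ hm
  have h3 := hd t ht'
  rw [dist_comm, Complex.dist_eq, add_sub_cancel_left, norm_mul, Complex.norm_real,
    Real.norm_of_nonneg hs.1] at h2
  rw [Complex.dist_eq] at h3
  nlinarith [norm_nonneg (g t - f t), hs.2]

theorem coincidences_finite {ι : Type*} [Finite ι] {c : ι → ℝ → ℂ}
    (h1 : ∀ i j, {p : ℝ × ℝ | p.1 ∈ Ioo (0:ℝ) 1 ∧ p.2 ∈ Ioo (0:ℝ) 1 ∧ (i, p.1) ≠ (j, p.2) ∧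
      c i p.1 = c j p.2}.Finite)
    (h2 : ∀ i j, {t | t ∈ Ioo (0:ℝ) 1 ∧ (c i t = c j 0 ∨ c i t = c j 1)}.Finite) :
    (Coincidences c).Finite := by
  let E : Set ℝ := {0, 1}
  have hE : E.Finite := by simp [E]
  have hI : ∀ t ∈ Icc (0:ℝ) 1, t ∈ Ioo (0:ℝ) 1 ∨ t ∈ E := by
    intro t ht
    rcases ht.1.eq_or_lt with rfl | h
    · right; simp [E]
    rcases ht.2.eq_or_lt with rfl | h'
    · right; simp [E]
    exact Or.inl ⟨h, h'⟩
  let T : ι → ι → Set (ℝ × ℝ) := fun i j =>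
    {p : ℝ × ℝ | p.1 ∈ Ioo (0:ℝ) 1 ∧ p.2 ∈ Ioo (0:ℝ) 1 ∧ (i, p.1) ≠ (j, p.2) ∧ c i p.1 = c j p.2}
    ∪ {t | t ∈ Ioo (0:ℝ) 1 ∧ (c i t = c j 0 ∨ c i t = c j 1)} ×ˢ E
    ∪ E ×ˢ {t | t ∈ Ioo (0:ℝ) 1 ∧ (c j t = c i 0 ∨ c j t = c i 1)} ∪ E ×ˢ E
  have hT : ∀ i j, (T i j).Finite := fun i j =>
    (((h1 i j).union ((h2 i j).prod hE)).union (hE.prod (h2 j i))).union (hE.prod hE)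
  refine (finite_iUnion fun i => finite_iUnion fun j =>
    (hT i j).image fun p => ((i, p.1), (j, p.2))).subset ?_
  rintro ⟨⟨i, t⟩, j, u⟩ ⟨ht, hu, hne, h⟩
  simp only [mem_iUnion]
  refine ⟨i, j, (t, u), ?_, rfl⟩
  simp only at ht hu h
  rcases hI t ht with ht' | ht' <;> rcases hI u hu with hu' | hu'
  · exact Or.inl (Or.inl (Or.inl ⟨ht', hu', hne, h⟩))
  · refine Or.inl (Or.inl (Or.inr ⟨⟨ht', ?_⟩, hu'⟩))
    rcases hu' with rfl | rfl <;> simp [h]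
  · refine Or.inl (Or.inr ⟨ht', ⟨hu', ?_⟩⟩)
    rcases ht' with rfl | rfl <;> simp [h]
  · exact Or.inr ⟨ht', hu'⟩

theorem FewerThan.finite {α : Type*} {k : ℕ} {S : Set α} (h : FewerThan k S) : S.Finite := by
  obtain ⟨J, -, hJ⟩ := h
  exact J.finite_toSet.subset hJ

theorem FewerThan.mono {α : Type*} {k : ℕ} {S T : Set α} (h : FewerThan k T) (hST : S ⊆ T) :
    FewerThan k S := by
  obtain ⟨J, hJ, hJ'⟩ := h
  exact ⟨J, hJ, hST.trans hJ'⟩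

theorem finite_interior_coincidences {ι : Type*} {c : ι → ℝ → ℂ}
    (hself : ∀ i, (selfCrossings (c i)).Finite)
    (hcross : ∀ i j, i ≠ j → (crossings (c i) (c j)).Finite) (i j : ι) :
    {p : ℝ × ℝ | p.1 ∈ Ioo (0:ℝ) 1 ∧ p.2 ∈ Ioo (0:ℝ) 1 ∧ (i, p.1) ≠ (j, p.2) ∧
      c i p.1 = c j p.2}.Finite := by
  by_cases hij : i = j
  · subst hij
    refine ((hself i).union ((hself i).image Prod.swap)).subset ?_
    rintro ⟨t, u⟩ ⟨ht, hu, hne, h⟩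
    have hne : t ≠ u := fun h => hne (by rw [h])
    rcases hne.lt_or_gt with h' | h'
    · exact Or.inl ⟨ht, hu, h', h⟩
    · exact Or.inr ⟨(u, t), ⟨hu, ht, h', h.symm⟩, rfl⟩
  · exact (hcross i j hij).subset fun p hp => ⟨hp.1, hp.2.1, hp.2.2.2⟩

theorem finite_fiber {f : ℝ → ℂ} (hself : (selfCrossings f).Finite) (z : ℂ) :
    {t | t ∈ Ioo (0:ℝ) 1 ∧ f t = z}.Finite := by
  by_contra hinf
  obtain ⟨t₀, ht₀⟩ := (show Set.Infinite _ from hinf).nonempty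
  refine hinf (((hself.image Prod.fst).union ((hself.image Prod.snd).insert t₀)).subset ?_)
  intro t ht
  rcases lt_trichotomy t t₀ with h | rfl | h
  · exact Or.inl ⟨(t, t₀), ⟨ht.1, ht₀.1, h, ht.2.trans ht₀.2.symm⟩, rfl⟩
  · exact Or.inr (Or.inl rfl)
  · exact Or.inr (Or.inr ⟨(t₀, t), ⟨ht₀.1, ht.1, h, ht₀.2.trans ht.2.symm⟩, rfl⟩)

theorem FewerThan.crossings_of_coincidences {ι : Type*} {c c' : ι → ℝ → ℂ} {k : ℕ}
    (h : Coincidences c' ⊆ Coincidences c) {i j : ι} (hij : i ≠ j)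
    (hk : FewerThan k (crossings (c i) (c j))) : FewerThan k (crossings (c' i) (c' j)) := by
  refine hk.mono ?_
  rintro ⟨t, u⟩ ⟨ht, hu, hE⟩
  exact ⟨ht, hu, (@h ((i, t), (j, u)) ⟨Ioo_subset_Icc_self ht, Ioo_subset_Icc_self hu,
    fun h => hij (congrArg Prod.fst h), hE⟩).2.2.2⟩

theorem FewerThan.selfCrossings_of_coincidences {ι : Type*} {c c' : ι → ℝ → ℂ} {k : ℕ}
    (h : Coincidences c' ⊆ Coincidences c) {i : ι}
    (hk : FewerThan k (selfCrossings (c i))) : FewerThan k (selfCrossings (c' i)) := by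
  refine hk.mono ?_
  rintro ⟨t, u⟩ ⟨ht, hu, hlt, hE⟩
  exact ⟨ht, hu, hlt, (@h ((i, t), (i, u)) ⟨Ioo_subset_Icc_self ht, Ioo_subset_Icc_self hu,
    fun h => hlt.ne (congrArg Prod.snd h), hE⟩).2.2.2⟩

theorem exists_coneSeparated {V : Set ℂ} (hfin : V.Finite) (h0 : (0 : ℂ) ∉ V)
    (hgen : ∀ v ∈ V, ∀ v' ∈ V, v' ≠ v → (v' / v).im ≠ 0) : ∃ κ, ConeSeparated V κ := by
  have h : ∀ᶠ κ in 𝓝[>] (0:ℝ), ∀ v ∈ V, ∀ v' ∈ V, v' ∈ rayCone κ v → v' = v := by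
    rw [hfin.eventually_all]
    intro v hv
    rw [hfin.eventually_all]
    intro v' hv'
    by_cases hne : v' = v
    · exact .of_forall fun _ _ => hne
    have hlim : Filter.Tendsto (fun κ : ℝ => κ * (v' / v).re) (𝓝[>] 0) (𝓝 (0 * (v' / v).re)) :=
      (Filter.tendsto_id.mono_left nhdsWithin_le_nhds).mul_const _
    rw [zero_mul] at hlim
    filter_upwards [hlim.eventually_lt_const (abs_pos.2 (hgen v hv v' hv' hne))] with κ hκ h
    exact absurd (show |(v' / v).im| ≤ κ * (v' / v).re from h) (not_le.2 hκ)
  obtain ⟨κ, h, hκ⟩ := (h.and self_mem_nhdsWithin).exists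
  exact ⟨κ, h0, hκ, h⟩

theorem exists_pos_forall_lt_dist {V : Set ℂ} (hfin : V.Finite) {K : Set ℂ} (hK : IsCompact K)
    (hd : Disjoint K V) : ∃ η > 0, ∀ z ∈ K, ∀ v ∈ V, 2 * η < dist z v := by
  obtain ⟨r, hr, h⟩ := Metric.exists_pos_forall_lt_edist hK hfin.isClosed hd
  refine ⟨r / 2, by positivity, fun z hz v hv => ?_⟩
  rw [mul_div_cancel₀ _ two_ne_zero]
  have := h z hz v hv
  rwa [edist_nndist, ENNReal.coe_lt_coe, ← NNReal.coe_lt_coe, coe_nndist] at this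

/-- Loops at `0` that meet the segment from `0` to the obstacle `1` fewer than `k` times. -/
theorem card_le_of_unitSegment {n k M : ℕ} (hB : LoopBound n (5 * k) M) (hk : 1 ≤ k)
    {V : Set ℂ} (hVn : V.ncard = n) (hfin : V.Finite) (h0 : (0 : ℂ) ∉ V)
    (hgen : ∀ v ∈ V, ∀ v' ∈ V, v' ≠ v → (v' / v).im ≠ 0)
    (h1 : (1 : ℂ) ∈ V) {ι : Type*} [Fintype ι] {f : ι → ℝ → ℂ} (hf : ∀ i, IsLoopAt V 0 (f i))
    (hself : ∀ i, FewerThan k (selfCrossings (f i)))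
    (hcross : ∀ i j, i ≠ j → FewerThan k (crossings (f i) (f j)))
    (hhit : ∀ i, FewerThan k {t | t ∈ Ioo (0:ℝ) 1 ∧ ∃ s ∈ Ico (0:ℝ) 1, f i t = s})
    (hnh : ∀ i j, i ≠ j → ¬ RelHomotopic V (f i) (f j)) :
    Fintype.card ι ≤ 121 * k ^ 2 * M := by
  obtain ⟨κ, hκ⟩ := exists_coneSeparated hfin h0 hgen
  have hnotMem : ∀ i, ∀ t ∈ Icc (0:ℝ) 1, f i t ∉ V := by
    intro i t ht
    rcases ht.1.eq_or_lt with rfl | h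
    · rwa [(hf i).source]
    rcases ht.2.eq_or_lt with rfl | h'
    · rwa [(hf i).target]
    exact (hf i).notMem t ⟨h, h'⟩
  obtain ⟨η, hη, hηV⟩ := exists_pos_forall_lt_dist hfin
    (isCompact_iUnion fun i => (isCompact_Icc (a := (0:ℝ)) (b := 1)).image (hf i).continuous)
    (by
      rw [disjoint_left]
      rintro z hz hzV
      obtain ⟨i, t, ht, rfl⟩ := mem_iUnion.1 hz
      exact hnotMem i t ht hzV)
  have hηV : ∀ i, ∀ t ∈ Icc (0:ℝ) 1, ∀ v ∈ V, 2 * η < dist (f i t) v := fun i t ht v hv =>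
    hηV _ (mem_iUnion.2 ⟨i, t, ht, rfl⟩) v hv
  let c : Option ι → ℝ → ℂ := fun o => o.elim (fun t => (t : ℂ)) f
  have hc : ∀ o, Continuous (c o) := by
    rintro (_ | i)
    · exact Complex.continuous_ofReal
    · exact (hf i).continuous
  have hc1 : (c none 1) = 1 := Complex.ofReal_one
  have hf1 : ∀ i, ∀ t ∈ Ioo (0:ℝ) 1, f i t ≠ 1 := fun i t ht h =>
    hnotMem i t (Ioo_subset_Icc_self ht) (h ▸ h1)
  have hhitc : ∀ i, {p : ℝ × ℝ | p.1 ∈ Ioo (0:ℝ) 1 ∧ p.2 ∈ Ioo (0:ℝ) 1 ∧ f i p.1 = p.2}.Finite := by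
    intro i
    refine ((hhit i).finite.image fun t => (t, (f i t).re)).subset ?_
    rintro ⟨t, u⟩ ⟨ht, hu, h⟩
    exact ⟨t, ⟨ht, u, ⟨hu.1.le, hu.2⟩, h⟩, by simp only at h; simp [h]⟩
  have hfinc : (Coincidences c).Finite := by
    refine coincidences_finite (finite_interior_coincidences ?_ ?_) ?_
    · rintro (_ | i)
      · refine finite_empty.subset ?_
        rintro ⟨t, u⟩ ⟨-, -, hlt, h⟩
        exact hlt.ne (Complex.ofReal_injective h)
      · exact (hself i).finite
    · rintro (_ | i) (_ | j) hij
      · exact absurd rfl hij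
      · refine ((hhitc j).image Prod.swap).subset ?_
        rintro ⟨t, u⟩ ⟨ht, hu, h⟩
        exact ⟨(u, t), ⟨hu, ht, h.symm⟩, rfl⟩
      · exact hhitc i
      · exact (hcross i j fun h => hij (congrArg some h)).finite
    · have he : ∀ j : Option ι, ∀ z, (z = c j 0 ∨ z = c j 1) → z = 0 ∨ z = 1 := by
        rintro (_ | j) z h
        · simpa [c] using h
        · left
          simpa [c, (hf j).source, (hf j).target] using h
      rintro (_ | i) j
      · refine finite_empty.subset ?_
        rintro t ⟨ht, h⟩
        rcases he j _ h with h | h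
        · exact ht.1.ne' (Complex.ofReal_eq_zero.1 h)
        · exact ht.2.ne (Complex.ofReal_eq_one.1 h)
      · refine (finite_fiber (hself i).finite 0).subset ?_
        rintro t ⟨ht, h⟩
        exact ⟨ht, (he j _ h).resolve_right (hf1 i t ht)⟩
  let Z : Set ℂ := insert 0 (⋃ i, f i '' {t | t ∈ Ioo (0:ℝ) 1 ∧ ∃ s ∈ Ico (0:ℝ) 1, f i t = s})
  have hZ : Z.Finite := (finite_iUnion fun i => (hhit i).finite.image _).insert _
  obtain ⟨c', hc', hsub, hend, hiff, hlin, hclose, haff⟩ := exists_radialization hc hfinc hZ hη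
  have hnone : ∀ t ∈ Icc (0:ℝ) 1, c' none t = t := haff none ⟨0, 1, fun t _ => by simp [c]⟩
  have hhom : ∀ i, RelHomotopic V (f i) (c' (some i)) := by
    intro i
    refine relHomotopic_of_close (hf i).continuous (hc' _) (hend (some i)).1 (hend (some i)).2
      (hηV i) fun t ht => ?_
    by_cases h : c' (some i) t = c (some i) t
    · rw [h]; simp only [c, Option.elim_some, dist_self]; positivity
    · obtain ⟨z, -, h1, h2⟩ := hclose (some i) t ht h
      have := dist_triangle_right (c' (some i) t) (c (some i) t) z
      exact this.trans (by linarith)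
  have hends : ∀ i, c' (some i) 0 = 0 ∧ c' (some i) 1 = 0 := fun i =>
    ⟨(hend (some i)).1.trans (hf i).source, (hend (some i)).2.trans (hf i).target⟩
  have hloop : ∀ i, IsLoopAt V 0 (c' (some i)) := by
    intro i
    obtain ⟨H, -, hH, -, hHV⟩ := hhom i
    refine ⟨hc' _, (hends i).1, (hends i).2, fun t ht => ?_⟩
    rw [← (hH t (Ioo_subset_Icc_self ht)).2]
    exact hHV 1 (by simp) t ht
  have hback : ∀ i, ∀ t ∈ Icc (0:ℝ) 1, ∀ s ∈ Ico (0:ℝ) 1, c' (some i) t = s → f i t = s := by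
    intro i t ht s hs h
    have hs' := Ico_subset_Icc_self hs
    have h2 := (@hsub ((some i, t), (none, s)) ⟨ht, hs', by simp, by
      simp only [hnone s hs', h]⟩).2.2.2
    exact h2
  refine hκ.card_le_of_linearNear hB hk hVn hfin h1 (f := fun i => c' (some i)) hloop
    (fun i => (hself i).selfCrossings_of_coincidences (i := some i) hsub)
    (fun i j hij => (hcross i j hij).crossings_of_coincidences (i := some i) (j := some j) hsub
      (by simpa using hij))
    (fun i => (hhit i).mono ?_) ?_ ?_
  · rintro t ⟨ht, s, hs, h⟩
    exact ⟨ht, s, hs, hback i t (Ioo_subset_Icc_self ht) s hs h⟩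
  · intro i t ht s hs h
    refine hlin (some i) t ht ?_
    have h2 := hback i t ht s hs h
    show f i t ∈ Z
    rcases ht.1.eq_or_lt with rfl | h0
    · rw [(hf i).source]; exact mem_insert _ _
    rcases ht.2.eq_or_lt with rfl | h1
    · rw [(hf i).target]; exact mem_insert _ _
    exact mem_insert_of_mem _ (mem_iUnion.2 ⟨i, t, ⟨⟨h0, h1⟩, s, hs, h2⟩, rfl⟩)
  · intro i j hij h
    refine hnh i j hij ((hhom i).trans (h.trans ((hhom j).symm ?_ ?_)))
    · rw [(hf j).source, (hends j).1]
    · rw [(hf j).target, (hends j).2]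

end

section

open Set Topology
open scoped NNReal

/-- A Lipschitz displacement field with constant less than one gives a homeomorphism. -/
theorem LipschitzWith.exists_homeomorph_add {g : ℂ → ℂ} {K : ℝ≥0} (hg : LipschitzWith K g)
    (hK : K < 1) : ∃ φ : ℂ ≃ₜ ℂ, ∀ y, φ y = y + g y := by
  have h : ApproximatesLinearOn (fun y => y + g y)
      ((ContinuousLinearEquiv.refl ℝ ℂ : ℂ ≃L[ℝ] ℂ) : ℂ →L[ℝ] ℂ) univ K := by
    intro x _ y _
    have := hg.dist_le_mul x y
    rw [Complex.dist_eq, Complex.dist_eq] at this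
    refine le_of_eq_of_le (congrArg _ ?_) this
    change x + g x - (y + g y) - (x - y) = _
    ring
  refine ⟨h.toHomeomorph _ (Or.inr ?_), fun y => rfl⟩
  have : ‖((ContinuousLinearEquiv.refl ℝ ℂ).symm : ℂ →L[ℝ] ℂ)‖₊ = 1 := by
    rw [ContinuousLinearEquiv.refl_symm]
    exact NNReal.eq ContinuousLinearMap.norm_id
  rwa [this, inv_one]

/-- A homeomorphism fixing `S` and moving the segment `[e, z]` to `[e, z']`. -/
def Pivots (S : Set ℂ) (e z z' : ℂ) : Prop :=
  ∃ φ : ℂ ≃ₜ ℂ, (∀ y ∈ S, φ y = y) ∧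
    ∀ t ∈ Icc (0:ℝ) 1, φ (e + t • (z - e)) = e + t • (z' - e)

theorem Pivots.symm {S : Set ℂ} {e z z' : ℂ} (h : Pivots S e z z') : Pivots S e z' z := by
  obtain ⟨φ, h1, h2⟩ := h
  exact ⟨φ.symm, fun y hy => φ.symm_apply_eq.2 (h1 y hy).symm,
    fun t ht => φ.symm_apply_eq.2 (h2 t ht).symm⟩

theorem Pivots.trans {S : Set ℂ} {e z z' z'' : ℂ} (h : Pivots S e z z') (h' : Pivots S e z' z'') :
    Pivots S e z z'' := by
  obtain ⟨φ, h1, h2⟩ := h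
  obtain ⟨ψ, h3, h4⟩ := h'
  exact ⟨φ.trans ψ, fun y hy => by simp [h1 y hy, h3 y hy],
    fun t ht => by rw [Homeomorph.trans_apply, h2 t ht, h4 t ht]⟩

theorem eventually_pivots {S : Set ℂ} {e z : ℂ} (hz : z ≠ e) {r : ℝ} (hr : 0 < r)
    (h : ∀ t ∈ Icc (0:ℝ) 1, ∀ y ∈ S, t * r ≤ ‖e + t • (z - e) - y‖) :
    ∀ᶠ z' in 𝓝 z, Pivots S e z z' := by
  classical
  have hze : 0 < ‖z - e‖ := norm_pos_iff.2 (sub_ne_zero.2 hz)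
  set f : ℂ → ℝ := fun y => if y ∈ S then 0 else ‖y - e‖ / ‖z - e‖ with hf
  set K : ℝ≥0 := ⟨max r⁻¹ ‖z - e‖⁻¹, le_max_of_le_left (by positivity)⟩ with hKdef
  have hKr : ∀ t d : ℝ, t * r ≤ d → 0 ≤ d → t ≤ K * d := fun t d h hd =>
    (le_div_iff₀ hr).2 h |>.trans (by
      rw [div_eq_mul_inv, mul_comm]
      exact mul_le_mul_of_nonneg_right (le_max_left _ _) hd)
  have hfS : ∀ y ∈ S, f y = 0 := fun y hy => if_pos hy
  have hft : ∀ t ∈ Icc (0:ℝ) 1, f (e + t • (z - e)) = t := by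
    intro t ht
    by_cases hS : e + t • (z - e) ∈ S
    · have := h t ht _ hS
      rw [sub_self, norm_zero] at this
      rw [hfS _ hS]
      nlinarith [ht.1]
    · rw [hf]
      simp only [if_neg hS, add_sub_cancel_left, norm_smul, Real.norm_of_nonneg ht.1]
      field_simp
  have hlip : LipschitzOnWith K f (S ∪ (fun t : ℝ => e + t • (z - e)) '' Icc 0 1) := by
    refine LipschitzOnWith.of_dist_le_mul ?_
    rintro _ (hx | ⟨t, ht, rfl⟩) _ (hy | ⟨u, hu, rfl⟩)
    · rw [hfS _ hx, hfS _ hy, dist_self]; positivity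
    · rw [hfS _ hx, hft u hu, dist_comm, Real.dist_eq, sub_zero, abs_of_nonneg hu.1, dist_comm,
        dist_eq_norm]
      exact hKr _ _ (h u hu _ hx) (norm_nonneg _)
    · rw [hfS _ hy, hft t ht, Real.dist_eq, sub_zero, abs_of_nonneg ht.1, dist_eq_norm]
      exact hKr _ _ (h t ht _ hy) (norm_nonneg _)
    · simp only
      rw [hft t ht, hft u hu, dist_add_left, dist_eq_norm (t • (z - e)), ← sub_smul, norm_smul,
        Real.dist_eq, Real.norm_eq_abs]
      have h1 : ‖z - e‖⁻¹ ≤ K := le_max_right _ _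
      have h2 : 1 ≤ (K:ℝ) * ‖z - e‖ := by
        rw [← inv_mul_cancel₀ hze.ne']
        exact mul_le_mul_of_nonneg_right h1 hze.le
      nlinarith [abs_nonneg (t - u)]
  obtain ⟨g, hg, hgf⟩ := hlip.extend_real
  have hlim : ∀ᶠ z' in 𝓝 z, K * ‖z' - z‖₊ < 1 := by
    have : Filter.Tendsto (fun z' => K * ‖z' - z‖₊) (𝓝 z) (𝓝 (K * ‖z - z‖₊)) :=
      (Continuous.tendsto (by fun_prop) z)
    exact this.eventually_lt_const (by simp)
  filter_upwards [hlim] with z' hz'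
  have hg' : LipschitzWith (K * ‖z' - z‖₊) fun y => g y • (z' - z) := by
    refine LipschitzWith.of_dist_le_mul fun x y => ?_
    rw [dist_eq_norm, ← sub_smul, norm_smul, NNReal.coe_mul, coe_nnnorm]
    have := hg.dist_le_mul x y
    rw [dist_eq_norm (g x)] at this
    rw [mul_right_comm]
    gcongr
  obtain ⟨φ, hφ⟩ := hg'.exists_homeomorph_add hz'
  refine ⟨φ, fun y hy => ?_, fun t ht => ?_⟩
  · rw [hφ, ← hgf (Or.inl hy), hfS y hy, zero_smul, add_zero]
  · rw [hφ, ← hgf (Or.inr ⟨t, ht, rfl⟩), hft t ht, add_assoc, ← smul_add]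
    congr 2
    ring

/-- Endpoints of segments from `e` that meet neither `S` nor the ray from `e` through `f`. -/
def slitRegion (S : Set ℂ) (e f : ℂ) : Set ℂ :=
  {z | (∀ s : ℝ, 0 ≤ s → z - e ≠ s • (f - e)) ∧ ∀ t ∈ Icc (0:ℝ) 1, e + t • (z - e) ∉ S}

theorem exists_bound_of_mem_slitRegion {S : Set ℂ} (hS : IsCompact S) {e f z : ℂ} (hfe : f ≠ e)
    (hz : z ∈ slitRegion S e f) :
    ∃ r > 0, ∀ t ∈ Icc (0:ℝ) 1, ∀ y ∈ S ∪ segment ℝ e f, t * r ≤ ‖e + t • (z - e) - y‖ := by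
  obtain ⟨r₁, hr₁, h1⟩ : ∃ r > 0, ∀ t ∈ Icc (0:ℝ) 1, ∀ y ∈ S, r ≤ ‖e + t • (z - e) - y‖ := by
    have hc : IsCompact ((fun t : ℝ => e + t • (z - e)) '' Icc 0 1) :=
      isCompact_Icc.image (by fun_prop)
    obtain ⟨r, hr, h⟩ := Metric.exists_pos_forall_lt_edist hc hS.isClosed (by
      rw [disjoint_left]
      rintro _ ⟨t, ht, rfl⟩ h
      exact hz.2 t ht h)
    refine ⟨r, hr, fun t ht y hy => ?_⟩
    have := h _ ⟨t, ht, rfl⟩ y hy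
    rw [edist_nndist, ENNReal.coe_lt_coe, ← NNReal.coe_lt_coe, coe_nndist, dist_eq_norm] at this
    exact this.le
  obtain ⟨r₂, hr₂, h2⟩ : ∃ r > 0, ∀ s : ℝ, 0 ≤ s → r ≤ ‖(z - e) - s • (f - e)‖ := by
    have hcl : IsClosed ((fun s : ℝ => s • (f - e)) '' Ici 0) :=
      (isClosedEmbedding_smul_left (sub_ne_zero.2 hfe)).isClosedMap _ isClosed_Ici
    have hnm : z - e ∉ (fun s : ℝ => s • (f - e)) '' Ici 0 := by
      rintro ⟨s, hs, h⟩
      exact hz.1 s hs h.symm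
    refine ⟨_, (hcl.notMem_iff_infDist_pos ⟨_, 0, self_mem_Ici, rfl⟩).1 hnm, fun s hs => ?_⟩
    rw [← dist_eq_norm]
    exact Metric.infDist_le_dist_of_mem ⟨s, hs, rfl⟩
  refine ⟨min r₁ r₂, lt_min hr₁ hr₂, ?_⟩
  rintro t ht y (hy | hy)
  · refine le_trans ?_ (h1 t ht y hy)
    nlinarith [min_le_left r₁ r₂, ht.1, ht.2]
  · rw [segment_eq_image'] at hy
    obtain ⟨s, hs, rfl⟩ := hy
    rcases ht.1.eq_or_lt with rfl | ht0
    · rw [zero_mul]; positivity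
    · have h3 := h2 (s / t) (div_nonneg hs.1 ht.1)
      have h4 : e + t • (z - e) - (e + s • (f - e)) = t • ((z - e) - (s / t) • (f - e)) := by
        rw [smul_sub t (z - e), smul_smul, mul_div_cancel₀ _ ht0.ne']
        ring
      rw [h4, norm_smul, Real.norm_of_nonneg ht.1]
      exact mul_le_mul_of_nonneg_left ((min_le_right _ _).trans h3) ht.1

theorem pivots_of_isPreconnected {S : Set ℂ} (hS : IsCompact S) {e f : ℂ} (hfe : f ≠ e) {T : Set ℂ}
    (hT : IsPreconnected T) (hTS : T ⊆ slitRegion S e f) {z z' : ℂ} (hz : z ∈ T) (hz' : z' ∈ T) :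
    Pivots (S ∪ segment ℝ e f) e z z' := by
  refine hT.induction₂ (Pivots (S ∪ segment ℝ e f) e) (fun x hx => ?_)
    (fun _ _ _ _ _ _ h h' => h.trans h') (fun _ _ _ _ h => h.symm) hz hz'
  obtain ⟨r, hr, h⟩ := exists_bound_of_mem_slitRegion hS hfe (hTS hx)
  refine (eventually_pivots ?_ hr h).filter_mono nhdsWithin_le_nhds
  rintro rfl
  exact (hTS hx).1 0 le_rfl (by simp)

/-- The last edge of an arc can be turned to point in the direction opposite to the previous
edge. -/
theorem exists_pivots_opposite {S : Set ℂ} (hS : IsCompact S) {d e f : ℂ} (hfe : f ≠ e)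
    (hd : d ∈ slitRegion S e f) :
    ∃ ε > 0, (∀ t ∈ Icc (0:ℝ) 1, e - (t * ε) • (f - e) ∉ S) ∧
      Pivots (S ∪ segment ℝ e f) e d (e - ε • (f - e)) := by
  have heS : e ∉ S := by simpa using hd.2 0 (by simp)
  obtain ⟨r, hr, hball⟩ := Metric.isOpen_iff.1 hS.isClosed.isOpen_compl e heS
  have hde : d - e ≠ 0 := by simpa using hd.1 0 le_rfl
  have hfe' : 0 < ‖f - e‖ := norm_pos_iff.2 (sub_ne_zero.2 hfe)
  have hde' : 0 < ‖d - e‖ := norm_pos_iff.2 hde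
  obtain ⟨ε, hε, hεr⟩ : ∃ ε > 0, ε * ‖f - e‖ < r :=
    ⟨r / (2 * ‖f - e‖), by positivity, by field_simp; linarith⟩
  obtain ⟨τ, hτ, hτr⟩ : ∃ τ > 0, τ * ‖d - e‖ < r :=
    ⟨r / (2 * ‖d - e‖), by positivity, by field_simp; linarith⟩
  set τ' := min τ 1 with hτ'
  have hτ0 : 0 < τ' := lt_min hτ one_pos
  have hτr' : τ' * ‖d - e‖ < r :=
    (mul_le_mul_of_nonneg_right (min_le_left _ _) hde'.le).trans_lt hτr
  have hsmall : ∀ u : ℂ, ‖u‖ < r → e + u ∉ S := fun u hu => hball (by simpa using hu)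
  have hsmallt : ∀ u : ℂ, ‖u‖ < r → ∀ t ∈ Icc (0:ℝ) 1, e + t • u ∉ S := fun u hu t ht =>
    hsmall _ (by
      rw [norm_smul, Real.norm_of_nonneg ht.1]
      exact (mul_le_of_le_one_left (norm_nonneg _) ht.2).trans_lt hu)
  have hεn : ‖-(ε • (f - e))‖ < r := by rwa [norm_neg, norm_smul, Real.norm_of_nonneg hε.le]
  have hτn : ‖τ' • (d - e)‖ < r := by rwa [norm_smul, Real.norm_of_nonneg hτ0.le]
  refine ⟨ε, hε, fun t ht => ?_, Pivots.trans (z' := e + τ' • (d - e)) ?_ ?_⟩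
  · have := hsmallt _ hεn t ht
    rwa [smul_neg, smul_smul, ← sub_eq_add_neg] at this
  · refine pivots_of_isPreconnected hS hfe
      (T := (fun t : ℝ => e + t • (d - e)) '' Icc τ' 1)
      (isPreconnected_Icc.image _ (by fun_prop)) ?_
      ⟨1, ⟨min_le_right _ _, le_rfl⟩, by simp⟩ ⟨τ', ⟨le_rfl, min_le_right _ _⟩, rfl⟩
    rintro _ ⟨t, ht, rfl⟩
    have ht0 : 0 < t := hτ0.trans_le ht.1
    refine ⟨fun s hs h => hd.1 (t⁻¹ * s) (by positivity) ?_, fun u hu => ?_⟩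
    · rw [add_sub_cancel_left] at h
      rw [mul_smul, ← h, smul_smul, inv_mul_cancel₀ ht0.ne', one_smul]
    · rw [add_sub_cancel_left, smul_smul]
      exact hd.2 _ ⟨mul_nonneg hu.1 ht0.le, mul_le_one₀ hu.2 ht0.le ht.2⟩
  · refine pivots_of_isPreconnected hS hfe
      (T := (fun u : ℂ => e + u) '' segment ℝ (τ' • (d - e)) (-(ε • (f - e))))
      ((convex_segment _ _).isPreconnected.image _ (by fun_prop)) ?_
      ⟨_, left_mem_segment _ _ _, rfl⟩ ⟨_, right_mem_segment _ _ _, (sub_eq_add_neg _ _).symm⟩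
    rintro _ ⟨u, hu, rfl⟩
    have hur : ‖u‖ < r := by
      have := (convex_ball (0:ℂ) r).segment_subset (x := τ' • (d - e)) (y := -(ε • (f - e)))
        (by simpa using hτn) (by simpa using hεn) hu
      simpa using this
    refine ⟨fun s hs h => ?_, fun t ht => ?_⟩
    · rw [add_sub_cancel_left] at h
      obtain ⟨a, b, ha, hb, hab, rfl⟩ := hu
      rcases ha.eq_or_lt with rfl | ha
      · rw [zero_add] at hab
        subst hab
        rw [zero_smul, zero_add, one_smul, ← neg_smul] at h
        have := smul_left_injective ℝ (sub_ne_zero.2 hfe) h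
        linarith
      · refine hd.1 ((a * τ')⁻¹ * (s + b * ε)) (by positivity) ?_
        rw [mul_smul, eq_inv_smul_iff₀ (by positivity), add_smul, ← h, mul_smul a, mul_smul b]
        rw [smul_neg, neg_add_cancel_right]
    · rw [add_sub_cancel_left]
      exact hsmallt u hur t ht

end

section

open Set Topology

/-- Simple polygonal arcs with a given number of edges from a starting point to `w`. -/
inductive PolygonalArc (w : ℂ) : ℕ → Set ℂ → ℂ → Prop
  | point : PolygonalArc w 0 {w} w
  | cons {n : ℕ} {S : Set ℂ} {e d : ℂ} : PolygonalArc w n S e → d ≠ e →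
      segment ℝ e d ∩ S ⊆ {e} → PolygonalArc w (n + 1) (S ∪ segment ℝ e d) d

namespace PolygonalArc

variable {w d : ℂ} {n : ℕ} {S : Set ℂ}

theorem isCompact_segment (a b : ℂ) : IsCompact (segment ℝ a b) := by
  rw [segment_eq_image']
  exact isCompact_Icc.image (by fun_prop)

theorem isCompact (h : PolygonalArc w n S d) : IsCompact S := by
  induction h with
  | point => exact isCompact_singleton
  | cons _ _ _ ih => exact ih.union (isCompact_segment _ _)

theorem source_mem (h : PolygonalArc w n S d) : d ∈ S := by
  cases h with
  | point => rfl
  | cons => exact Or.inr (right_mem_segment _ _ _)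

theorem target_mem (h : PolygonalArc w n S d) : w ∈ S := by
  induction h with
  | point => rfl
  | cons _ _ _ ih => exact Or.inl ih

theorem segment_union_segment {e f : ℂ} {ε : ℝ} (hε : 0 < ε) :
    segment ℝ f e ∪ segment ℝ e (e - ε • (f - e)) = segment ℝ f (e - ε • (f - e)) := by
  have key : ∀ s : ℝ, f + s • (e - ε • (f - e) - f) = e + (s * (1 + ε) - 1) • (e - f) := by
    intro s
    simp only [Complex.real_smul]
    push_cast
    ring
  apply Subset.antisymm
  · refine union_subset ?_ ((convex_segment _ _).segment_subset ?_ (right_mem_segment _ _ _))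
    · refine (convex_segment _ _).segment_subset (left_mem_segment _ _ _) ?_
      rw [segment_eq_image']
      refine ⟨1 / (1 + ε), ⟨by positivity, by rw [div_le_one (by positivity)]; linarith⟩, ?_⟩
      simp only
      rw [key, div_mul_cancel₀ _ (by positivity), sub_self, zero_smul, add_zero]
    · rw [segment_eq_image']
      refine ⟨1 / (1 + ε), ⟨by positivity, by rw [div_le_one (by positivity)]; linarith⟩, ?_⟩
      simp only
      rw [key, div_mul_cancel₀ _ (by positivity), sub_self, zero_smul, add_zero]
  · rw [segment_eq_image' ℝ f (e - ε • (f - e))]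
    rintro _ ⟨s, hs, rfl⟩
    simp only
    rw [key]
    rcases le_total (s * (1 + ε)) 1 with h | h
    · left
      rw [segment_symm, segment_eq_image']
      refine ⟨1 - s * (1 + ε), ⟨by linarith, by nlinarith [hs.1]⟩, ?_⟩
      simp only [Complex.real_smul]
      push_cast
      ring
    · right
      rw [segment_eq_image']
      refine ⟨(s * (1 + ε) - 1) / ε, ⟨div_nonneg (by linarith) hε.le, ?_⟩, ?_⟩
      · rw [div_le_one hε]
        nlinarith [hs.2]
      · have : e - ε • (f - e) - e = ε • (e - f) := by
          simp only [Complex.real_smul]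
          ring
        simp only
        rw [this, smul_smul, div_mul_cancel₀ _ hε.ne']

theorem image_segment_of_pivots {φ : ℂ ≃ₜ ℂ} {e z z' : ℂ}
    (h : ∀ t ∈ Icc (0:ℝ) 1, φ (e + t • (z - e)) = e + t • (z' - e)) :
    φ '' segment ℝ e z = segment ℝ e z' := by
  rw [segment_eq_image', segment_eq_image', image_image]
  exact image_congr h

/-- A simple polygonal arc can be straightened by a homeomorphism of the plane. -/
theorem exists_homeomorph (h : PolygonalArc w (n + 1) S d) :
    ∃ φ : ℂ ≃ₜ ℂ, φ '' S = segment ℝ 0 1 ∧ φ d = 0 ∧ φ w = 1 := by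
  induction n generalizing S d with
  | zero =>
    obtain - | @⟨_, S, e, _, h, hde, -⟩ := h
    obtain - | - := h
    have hwd : w - d ≠ 0 := sub_ne_zero.2 hde.symm
    let φ : ℂ ≃ₜ ℂ := (Homeomorph.addRight (-d)).trans
        (Homeomorph.mulRight₀ (w - d)⁻¹ (inv_ne_zero hwd))
    have hφ : ∀ z, φ z = (z - d) * (w - d)⁻¹ := fun z => by simp [φ, sub_eq_add_neg]
    refine ⟨φ, ?_, by simp [hφ], by rw [hφ, mul_inv_cancel₀ hwd]⟩
    rw [union_eq_self_of_subset_left (singleton_subset_iff.2 (left_mem_segment _ _ _)),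
      segment_symm, segment_eq_image', segment_eq_image', image_image]
    refine image_congr fun t _ => ?_
    rw [hφ]
    simp only [Complex.real_smul]
    field_simp
    ring
  | succ n ih =>
    obtain - | @⟨_, S₀, e, _, h₀, hde, hS₀⟩ := h
    obtain - | @⟨_, S₁, f, _, h₁, hef, hS₁⟩ := h₀
    have hsub : segment ℝ e f ⊆ S₁ ∪ segment ℝ f e := by
      rw [segment_symm]; exact subset_union_right
    have heS : e ∉ S₁ := fun h => hef (hS₁ ⟨right_mem_segment _ _ _, h⟩)
    have hseg : ∀ t ∈ Icc (0:ℝ) 1, e + t • (d - e) ∈ segment ℝ e d := fun t ht => by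
      rw [segment_eq_image']; exact ⟨t, ht, rfl⟩
    have hd : d ∈ slitRegion S₁ e f := by
      refine ⟨fun s hs h => ?_, fun t ht h => ?_⟩
      · have hs0 : 0 < s := hs.lt_of_ne' fun h0 => hde (by simpa [h0, sub_eq_zero] using h)
        have ht0 : 0 < min 1 s⁻¹ := lt_min one_pos (inv_pos.2 hs0)
        have h2 : e + min 1 s⁻¹ • (d - e) = e := hS₀ ⟨hseg _ ⟨ht0.le, min_le_left _ _⟩, hsub (by
          rw [segment_eq_image']
          refine ⟨min 1 s⁻¹ * s, ⟨by positivity, ?_⟩, by simp only; rw [h, smul_smul]⟩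
          calc min 1 s⁻¹ * s ≤ s⁻¹ * s := by gcongr; exact min_le_right _ _
            _ = 1 := inv_mul_cancel₀ hs0.ne')⟩
        rw [add_eq_left, smul_eq_zero, sub_eq_zero] at h2
        exact h2.elim ht0.ne' hde
      · have h2 : e + t • (d - e) = e := hS₀ ⟨hseg t ht, Or.inl h⟩
        exact heS (h2 ▸ h)
    obtain ⟨ε, hε, hεS, φ, hφS, hφ⟩ := exists_pivots_opposite h₁.isCompact hef.symm hd
    set e' := e - ε • (f - e) with he'
    have hun := segment_union_segment (e := e) (f := f) hε
    have hfe : f - e ≠ 0 := sub_ne_zero.2 hef.symm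
    have harc : PolygonalArc w (n + 1) (S₁ ∪ segment ℝ f e') e' := by
      refine cons h₁ (fun h => ?_) ?_
      · rw [he', sub_eq_iff_eq_add, ← sub_eq_iff_eq_add', ← neg_sub f e,
          ← neg_one_smul ℝ (f - e)] at h
        have := smul_left_injective ℝ hfe h
        linarith
      · rw [← hun, union_inter_distrib_right]
        refine union_subset hS₁ ?_
        rintro _ ⟨hz, hzS⟩
        rw [segment_eq_image'] at hz
        obtain ⟨t, ht, rfl⟩ := hz
        refine absurd hzS ?_
        have := hεS t ht
        rw [mul_smul] at this
        simpa [smul_neg, sub_eq_add_neg] using this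
    obtain ⟨ψ, hψS, hψ0, hψ1⟩ := ih harc
    rw [segment_symm ℝ e f] at hφS
    refine ⟨φ.trans ψ, ?_, ?_, ?_⟩
    · have h1 : φ '' (S₁ ∪ segment ℝ f e) = S₁ ∪ segment ℝ f e := by
        conv_rhs => rw [← image_id (S₁ ∪ segment ℝ f e)]
        exact image_congr hφS
      rw [← hψS, show ⇑(φ.trans ψ) = ψ ∘ φ from rfl, image_comp, image_union φ, h1,
          image_segment_of_pivots hφ,
        union_assoc, hun]
    · have := hφ 1 (by simp)
      simp only [one_smul, add_sub_cancel] at this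
      rw [Homeomorph.trans_apply, this, hψ0]
    · rw [Homeomorph.trans_apply, hφS w (Or.inl h₁.target_mem), hψ1]

end PolygonalArc

namespace PolygonalArc

variable {w d e : ℂ} {n : ℕ} {S A : Set ℂ}

theorem exists_subarc (h : PolygonalArc w n S d) {q : ℂ} (hq : q ∈ S) :
    ∃ m S', S' ⊆ S ∧ PolygonalArc w m S' q := by
  induction h with
  | point => exact ⟨0, {w}, Subset.rfl, by rw [mem_singleton_iff.1 hq]; exact point⟩
  | @cons n S e d h hde hS ih =>
    rcases hq with hq | hq
    · obtain ⟨m, S', hS', h'⟩ := ih hq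
      exact ⟨m, S', hS'.trans subset_union_left, h'⟩
    · by_cases hqe : q = e
      · subst hqe
        exact ⟨n, S, subset_union_left, h⟩
      · have hsub : segment ℝ e q ⊆ segment ℝ e d :=
          (convex_segment _ _).segment_subset (left_mem_segment _ _ _) hq
        exact ⟨n + 1, _, union_subset_union_right _ hsub,
          cons h hqe ((inter_subset_inter_left _ hsub).trans hS)⟩

theorem exists_extend (h : PolygonalArc w n S e) (hS : S ⊆ A) (hd : segment ℝ e d ⊆ A) :
    ∃ m S', S' ⊆ A ∧ PolygonalArc w m S' d := by
  by_cases hdS : d ∈ S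
  · obtain ⟨m, S', hS', h'⟩ := h.exists_subarc hdS
    exact ⟨m, S', hS'.trans hS, h'⟩
  have hK : IsCompact (Icc (0:ℝ) 1 ∩ (fun t : ℝ => e + t • (d - e)) ⁻¹' S) :=
    isCompact_Icc.inter_right (h.isCompact.isClosed.preimage (by fun_prop))
  obtain ⟨t, ⟨ht, htS⟩, hmax⟩ := hK.exists_isGreatest ⟨0, by simp, by simpa using h.source_mem⟩
  obtain ⟨m, S', hS', h'⟩ := h.exists_subarc htS
  have hsub : segment ℝ (e + t • (d - e)) d ⊆ segment ℝ e d :=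
    (convex_segment _ _).segment_subset (by rw [segment_eq_image']; exact ⟨t, ht, rfl⟩)
      (right_mem_segment _ _ _)
  refine ⟨m + 1, _, union_subset (hS'.trans hS) (hsub.trans hd), cons h' ?_ ?_⟩
  · intro hE
    exact hdS (by rw [hE]; exact htS)
  · rintro z ⟨hz, hzS⟩
    rw [segment_eq_image'] at hz
    obtain ⟨s, hs, rfl⟩ := hz
    have h2 : e + t • (d - e) + s • (d - (e + t • (d - e))) = e + (t + s * (1 - t)) • (d - e) := by
      simp only [Complex.real_smul]
      push_cast
      ring
    simp only at hzS ⊢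
    rw [h2] at hzS ⊢
    have h3 : t + s * (1 - t) ≤ t := hmax ⟨⟨by nlinarith [hs.1, ht.1, ht.2],
      by nlinarith [hs.2, ht.2]⟩, hS' hzS⟩
    have h4 : 0 ≤ s * (1 - t) := mul_nonneg hs.1 (by linarith [ht.2])
    rw [show t + s * (1 - t) = t by linarith]
    rfl

/-- A curve that locally can be followed by segments inside `A` can be replaced by a simple
polygonal arc. -/
theorem exists_of_locally_segment {γ : ℝ → ℂ} (hne : γ 0 ≠ γ 1)
    (hγ : ∀ t ∈ Icc (0:ℝ) 1, ∀ᶠ u in 𝓝[Icc 0 1] t, segment ℝ (γ t) (γ u) ⊆ A) :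
    ∃ m S, S ⊆ A ∧ PolygonalArc (γ 1) (m + 1) S (γ 0) := by
  have hw : γ 1 ∈ A :=
    (hγ 1 (by simp)).self_of_nhdsWithin (by simp) (left_mem_segment _ _ _)
  let Q : ℝ → Prop := fun t => ∃ m S, S ⊆ A ∧ PolygonalArc (γ 1) m S (γ t)
  have hQ : ∀ t u, segment ℝ (γ t) (γ u) ⊆ A → Q t → Q u := fun t u htu ⟨m, S, hS, h⟩ =>
    h.exists_extend hS htu
  have hQ' : Q 1 ↔ Q 0 := isPreconnected_Icc.induction₂ (s := Icc (0:ℝ) 1) (fun t u => Q t ↔ Q u)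
    (fun t ht => (hγ t ht).mono fun u hu => ⟨hQ t u hu, hQ u t (by rwa [segment_symm])⟩)
    (fun _ _ _ _ _ _ h h' => h.trans h') (fun _ _ _ _ h => h.symm) (by simp) (by simp)
  have := hQ'.1 ⟨0, {γ 1}, singleton_subset_iff.2 hw, point⟩
  obtain ⟨m, S, hS, h⟩ := this
  cases m with
  | zero =>
    generalize γ 0 = a at h hne
    cases h
    exact absurd rfl hne
  | succ m => exact ⟨m, S, hS, h⟩

end PolygonalArc

theorem eventually_add_mul_ne_zero {a b : ℝ} (hb : b ≠ 0) : ∀ᶠ s in 𝓝[>] (0:ℝ), a + s * b ≠ 0 := by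
  have : ∀ᶠ s in 𝓝[>] (0:ℝ), s ≠ -a / b := by
    by_cases h : -a / b = 0
    · rw [h]
      filter_upwards [self_mem_nhdsWithin] with s hs using hs.ne'
    · exact (eventually_ne_nhds (Ne.symm h)).filter_mono nhdsWithin_le_nhds
  filter_upwards [this] with s hs h
  exact hs (by field_simp; linarith)

theorem im_div_ne_zero {z w : ℂ} (h : (z * (starRingEnd ℂ) w).im ≠ 0) : (z / w).im ≠ 0 := by
  intro h0
  have hw : w ≠ 0 := by rintro rfl; simp at h
  apply h
  rw [show z * (starRingEnd ℂ) w = z / w * (Complex.normSq w : ℂ) by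
    rw [← Complex.mul_conj]; field_simp]
  simp [h0]

/-- A small translation vector making all the points of a finite set, together with `1`, pairwise
non-collinear with `0`. -/
theorem exists_generic_translation {U : Set ℂ} (hU : U.Finite) {r : ℝ} (hr : 0 < r) :
    ∃ ω : ℂ, ‖ω‖ < r ∧ (∀ v ∈ U, (v + ω).im ≠ 0) ∧
      ∀ v ∈ U, ∀ v' ∈ U, v' ≠ v → ((v' + ω) / (v + ω)).im ≠ 0 := by
  obtain ⟨y, hy, hy0⟩ : ∃ y : ℝ, (∀ v ∈ U, ∀ v' ∈ U, v' ≠ v →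
      -(v' - v).im + y * (v' - v).re ≠ 0) ∧ 0 < y := by
    refine ((((hU.eventually_all).2 fun v _ => (hU.eventually_all).2 fun v' _ => ?_).and
      self_mem_nhdsWithin).exists (f := 𝓝[>] (0:ℝ)))
    by_cases hre : (v' - v).re = 0
    · refine .of_forall fun y hne h => hne (sub_eq_zero.1 (Complex.ext hre ?_))
      rw [hre, mul_zero, add_zero, neg_eq_zero] at h
      exact h
    · filter_upwards [eventually_add_mul_ne_zero (a := -(v' - v).im) hre] with y hy _ using hy
  have hlim : ∀ᶠ s : ℝ in 𝓝[>] 0, ‖(s : ℂ) * (1 + y * Complex.I)‖ < r := by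
    have : Filter.Tendsto (fun s : ℝ => ‖(s : ℂ) * (1 + y * Complex.I)‖) (𝓝 0) (𝓝 0) := by
      have h : Continuous fun s : ℝ => ‖(s : ℂ) * (1 + y * Complex.I)‖ := by fun_prop
      simpa using h.tendsto 0
    exact (this.mono_left nhdsWithin_le_nhds).eventually_lt_const hr
  have h1 : ∀ᶠ s : ℝ in 𝓝[>] 0, ∀ v ∈ U, v.im + s * y ≠ 0 :=
    hU.eventually_all.2 fun v _ => eventually_add_mul_ne_zero hy0.ne'
  have h2 : ∀ᶠ s : ℝ in 𝓝[>] 0, ∀ v ∈ U, ∀ v' ∈ U, v' ≠ v →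
      (v' * (starRingEnd ℂ) v).im + s * (-(v' - v).im + y * (v' - v).re) * (-1) ≠ 0 := by
    refine hU.eventually_all.2 fun v hv => hU.eventually_all.2 fun v' hv' => ?_
    by_cases hne : v' = v
    · exact .of_forall fun _ h => absurd hne h
    filter_upwards [eventually_add_mul_ne_zero (a := (v' * (starRingEnd ℂ) v).im)
      (neg_ne_zero.2 (hy v hv v' hv' hne))] with s hs _
    convert hs using 2
    ring
  obtain ⟨s, h1, h2, h3⟩ := (h1.and (h2.and hlim)).exists
  refine ⟨_, h3, fun v hv => ?_, fun v hv v' hv' hne => im_div_ne_zero ?_⟩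
  · simpa using h1 v hv
  · convert h2 v hv v' hv' hne using 1
    simp
    ring

/-- A homeomorphism fixing the unit segment and making the obstacles pairwise non-collinear with
`0`. -/
theorem exists_generic_homeomorph {V : Set ℂ} (hfin : V.Finite)
    (hV : ∀ v ∈ V, v ∈ segment ℝ (0:ℂ) 1 → v = 1) :
    ∃ φ : ℂ ≃ₜ ℂ, (∀ z ∈ segment ℝ (0:ℂ) 1, φ z = z) ∧
      ∀ v ∈ φ '' V, ∀ v' ∈ φ '' V, v' ≠ v → (v' / v).im ≠ 0 := by
  obtain ⟨η, hη, hηV⟩ := exists_pos_forall_lt_dist (hfin.subset (sdiff_subset (t := {1})))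
    (PolygonalArc.isCompact_segment 0 1) (by
      rw [disjoint_left]
      exact fun z hz h => h.2 (hV z h.1 hz))
  obtain ⟨ω, hω, him, hdiv⟩ := exists_generic_translation (hfin.subset (sdiff_subset (t := {1}))) hη
  have hne : (segment ℝ (0:ℂ) 1).Nonempty := ⟨_, left_mem_segment _ _ _⟩
  have hlip : LipschitzWith ‖η⁻¹ • ω‖₊
      fun z => min (Metric.infDist z (segment ℝ (0:ℂ) 1)) η • (η⁻¹ • ω) := by
    refine LipschitzWith.of_dist_le_mul fun x y => ?_
    have h1 := ((Metric.lipschitz_infDist_pt (segment ℝ (0:ℂ) 1)).min_const η).dist_le_mul x y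
    rw [NNReal.coe_one, one_mul, Real.dist_eq] at h1
    rw [dist_eq_norm, ← sub_smul, norm_smul, Real.norm_eq_abs, coe_nnnorm, mul_comm]
    gcongr
  obtain ⟨φ, hφ⟩ := hlip.exists_homeomorph_add (by
    rw [← NNReal.coe_lt_coe, coe_nnnorm, NNReal.coe_one, norm_smul, norm_inv,
      Real.norm_of_nonneg hη.le, ← div_eq_inv_mul, div_lt_one hη]
    exact hω)
  have hfix : ∀ z ∈ segment ℝ (0:ℂ) 1, φ z = z := fun z hz => by
    rw [hφ, Metric.infDist_zero_of_mem hz, min_eq_left hη.le, zero_smul, add_zero]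
  have hmove : ∀ v ∈ V \ {1}, φ v = v + ω := fun v hv => by
    rw [hφ, min_eq_right, smul_inv_smul₀ hη.ne']
    refine (Metric.le_infDist hne).2 fun z hz => ?_
    rw [dist_comm]
    linarith [hηV z hz v hv]
  have h1 : φ 1 = 1 := hfix 1 (right_mem_segment _ _ _)
  refine ⟨φ, hfix, ?_⟩
  rintro _ ⟨v, hv, rfl⟩ _ ⟨v', hv', rfl⟩ hne'
  have hvv : v' ≠ v := fun h => hne' (by rw [h])
  by_cases hv1 : v = 1
  · subst hv1
    rw [h1, div_one, hmove v' ⟨hv', hvv⟩]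
    exact him v' ⟨hv', hvv⟩
  · rw [hmove v ⟨hv, hv1⟩]
    by_cases hv1' : v' = 1
    · subst hv1'
      rw [h1]
      apply im_div_ne_zero
      rw [one_mul, Complex.conj_im]
      exact neg_ne_zero.2 (him v ⟨hv, hv1⟩)
    · rw [hmove v' ⟨hv', hv1'⟩]
      exact hdiv v ⟨hv, hv1⟩ v' ⟨hv', hv1'⟩ hvv

/-- Loops meeting a polygonal arc from their base point to an obstacle fewer than `k` times. -/
theorem PolygonalArc.card_le {n k M : ℕ} (hB : LoopBound n (5 * k) M) (hk : 1 ≤ k)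
    {V : Set ℂ} (hVn : V.ncard = n) (hfin : V.Finite) {x w : ℂ} (hx : x ∉ V) (hw : w ∈ V)
    {m : ℕ} {S : Set ℂ} (hS : PolygonalArc w (m + 1) S x) (hSV : ∀ v ∈ V, v ∈ S → v = w)
    {ι : Type*} [Fintype ι] {f : ι → ℝ → ℂ} (hf : ∀ i, IsLoopAt V x (f i))
    (hself : ∀ i, FewerThan k (selfCrossings (f i)))
    (hcross : ∀ i j, i ≠ j → FewerThan k (crossings (f i) (f j)))
    (hhit : ∀ i, FewerThan k {t | t ∈ Ioo (0:ℝ) 1 ∧ f i t ∈ S})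
    (hnh : ∀ i j, i ≠ j → ¬ RelHomotopic V (f i) (f j)) :
    Fintype.card ι ≤ 121 * k ^ 2 * M := by
  obtain ⟨ψ, hψS, hψ0, hψ1⟩ := hS.exists_homeomorph
  obtain ⟨χ, hχ, hgen⟩ := exists_generic_homeomorph (hfin.image ψ) (by
    rintro _ ⟨v, hv, rfl⟩ h
    rw [← hψS, ψ.injective.mem_set_image] at h
    rw [hSV v hv h, hψ1])
  set φ := ψ.trans χ with hφ
  have hφa : ∀ z, φ z = χ (ψ z) := fun z => rfl
  have hφ0 : φ x = 0 := by rw [hφa, hψ0, hχ 0 (left_mem_segment _ _ _)]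
  have hφ1 : φ w = 1 := by rw [hφa, hψ1, hχ 1 (right_mem_segment _ _ _)]
  have himg : χ '' (ψ '' V) = φ '' V := image_image _ _ _
  rw [himg] at hgen
  refine card_le_of_unitSegment hB hk (V := φ '' V) ?_ (hfin.image φ) ?_ hgen ⟨w, hw, hφ1⟩
    (f := fun i => φ ∘ f i) (fun i => ⟨φ.continuous.comp (hf i).continuous, ?_, ?_, ?_⟩)
    (fun i => (hself i).mono ?_) (fun i j hij => (hcross i j hij).mono ?_)
    (fun i => (hhit i).mono ?_) (fun i j hij h => hnh i j hij
      ((relHomotopic_comp_homeomorph_iff φ).1 h))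
  · rw [ncard_image_of_injective _ φ.injective, hVn]
  · rw [← hφ0, φ.injective.mem_set_image]
    exact hx
  · rw [Function.comp_apply, (hf i).source, hφ0]
  · rw [Function.comp_apply, (hf i).target, hφ0]
  · intro t ht
    rw [Function.comp_apply, φ.injective.mem_set_image]
    exact (hf i).notMem t ht
  · rintro p ⟨h1, h2, h3, h4⟩
    exact ⟨h1, h2, h3, φ.injective h4⟩
  · rintro p ⟨h1, h2, h3⟩
    exact ⟨h1, h2, φ.injective h3⟩
  · rintro t ⟨ht, s, hs, h⟩
    refine ⟨ht, ?_⟩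
    have hs' : (s : ℂ) ∈ segment ℝ (0:ℂ) 1 := by
      rw [segment_eq_image']
      exact ⟨s, Ico_subset_Icc_self hs, by simp⟩
    have h' : χ (ψ (f i t)) = χ s := by rw [hχ _ hs']; exact h
    rw [← ψ.injective.mem_set_image, hψS, χ.injective h']
    exact hs'

theorem FewerThan.image {α β : Type*} {k : ℕ} {S : Set α} (h : FewerThan k S) (g : α → β) :
    FewerThan k (g '' S) := by
  classical
  obtain ⟨J, hJ, hJ'⟩ := h
  exact ⟨J.image g, Finset.card_image_le.trans_lt hJ, by
    rw [Finset.coe_image]; exact image_mono hJ'⟩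

theorem IsLoopAt.notMem_of_mem_Icc {V : Set ℂ} {x : ℂ} {f : ℝ → ℂ} (hf : IsLoopAt V x f)
    (hx : x ∉ V) {t : ℝ} (ht : t ∈ Icc (0:ℝ) 1) : f t ∉ V := by
  rcases ht.1.eq_or_lt with rfl | h
  · rwa [hf.source]
  rcases ht.2.eq_or_lt with rfl | h'
  · rwa [hf.target]
  exact hf.notMem t ⟨h, h'⟩

theorem LinearNear.eventually_segment_subset {γ : ℝ → ℂ} {t : ℝ} (h : LinearNear γ t) :
    ∀ᶠ u in 𝓝[Icc 0 1] t, t ∈ Icc (0:ℝ) 1 → segment ℝ (γ t) (γ u) ⊆ γ '' Icc 0 1 := by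
  obtain ⟨ε, hε, d, hd⟩ := h
  filter_upwards [self_mem_nhdsWithin,
    mem_nhdsWithin_of_mem_nhds (Metric.closedBall_mem_nhds t hε)] with u hu hut ht
  rw [Metric.mem_closedBall, Real.dist_eq] at hut
  obtain ⟨e, he, heu⟩ : ∃ e : ℝ, (e = 1 ∨ e = -1) ∧ u = t + e * |u - t| := by
    rcases abs_cases (u - t) with ⟨h, -⟩ | ⟨h, -⟩
    · exact ⟨1, .inl rfl, by linarith⟩
    · exact ⟨-1, .inr rfl, by linarith⟩
  set s := |u - t| with hs
  have hs0 : 0 ≤ s := abs_nonneg _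
  have hu' : γ u = γ t + s * d e := by
    conv_lhs => rw [heu]
    exact hd e he s ⟨hs0, hut⟩ (heu ▸ hu)
  rw [segment_eq_image']
  rintro _ ⟨θ, hθ, rfl⟩
  have hm : t + e * (θ * s) ∈ Icc (0:ℝ) 1 := by
    have : t + e * (θ * s) = t + θ • (u - t) := by rw [heu, smul_eq_mul]; ring
    rw [this]
    exact (convex_Icc (0:ℝ) 1 : Convex ℝ _).segment_subset ht hu
      (by rw [segment_eq_image']; exact ⟨θ, hθ, rfl⟩)
  refine ⟨_, hm, ?_⟩
  beta_reduce
  rw [hd e he (θ * s) ⟨mul_nonneg hθ.1 hs0, by nlinarith [hθ.2]⟩ hm, hu', add_sub_cancel_left,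
    Complex.real_smul, Complex.ofReal_mul, mul_assoc]

/-- Loops meeting a path from their base point to an obstacle fewer than `k` times. -/
theorem card_le_of_path {n k M : ℕ} (hB : LoopBound n (5 * k) M) (hk : 1 ≤ k)
    {V : Set ℂ} (hVn : V.ncard = n) (hfin : V.Finite) {x w : ℂ} (hx : x ∉ V) (hw : w ∈ V)
    {β : ℝ → ℂ} (hβ : Continuous β) (hβ0 : β 0 = x) (hβ1 : β 1 = w)
    (hβV : ∀ t ∈ Icc (0:ℝ) 1, ∀ v ∈ V, β t = v → v = w) (hβself : (selfCrossings β).Finite)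
    {ι : Type*} [Fintype ι] {f : ι → ℝ → ℂ} (hf : ∀ i, IsLoopAt V x (f i))
    (hself : ∀ i, FewerThan k (selfCrossings (f i)))
    (hcross : ∀ i j, i ≠ j → FewerThan k (crossings (f i) (f j)))
    (hhit : ∀ i, FewerThan k {t | t ∈ Ioo (0:ℝ) 1 ∧ f i t ∈ β '' Icc 0 1})
    (hnh : ∀ i j, i ≠ j → ¬ RelHomotopic V (f i) (f j)) :
    Fintype.card ι ≤ 121 * k ^ 2 * M := by
  have hnotMem : ∀ i, ∀ t ∈ Icc (0:ℝ) 1, f i t ∉ V := fun i t ht =>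
    (hf i).notMem_of_mem_Icc hx ht
  have hxw : x ≠ w := fun h => hx (h ▸ hw)
  obtain ⟨η₁, hη₁, hη₁V⟩ := exists_pos_forall_lt_dist hfin
    (isCompact_iUnion fun i => (isCompact_Icc (a := (0:ℝ)) (b := 1)).image (hf i).continuous)
    (by
      rw [disjoint_left]
      rintro z hz hzV
      obtain ⟨i, t, ht, rfl⟩ := mem_iUnion.1 hz
      exact hnotMem i t ht hzV)
  obtain ⟨η₂, hη₂, hη₂V⟩ := exists_pos_forall_lt_dist (hfin.subset (sdiff_subset (t := {w})))
    ((isCompact_Icc (a := (0:ℝ)) (b := 1)).image hβ)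
    (by
      rw [disjoint_left]
      rintro _ ⟨t, ht, rfl⟩ h
      exact h.2 (hβV t ht _ h.1 rfl))
  set η := min η₁ η₂ with hηdef
  have hη : 0 < η := lt_min hη₁ hη₂
  let c : Option ι → ℝ → ℂ := fun o => o.elim β f
  have hc : ∀ o, Continuous (c o) := by
    rintro (_ | i)
    · exact hβ
    · exact (hf i).continuous
  have hselfc : ∀ o, (selfCrossings (c o)).Finite := by
    rintro (_ | i)
    · exact hβself
    · exact (hself i).finite
  have hβcross : ∀ i, (crossings (f i) β).Finite := by
    intro i
    refine ((hhit i).finite.biUnion fun t _ =>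
      (finite_singleton t).prod (finite_fiber hβself (f i t))).subset ?_
    rintro ⟨t, u⟩ ⟨ht, hu, h⟩
    exact mem_biUnion (x := t) ⟨ht, u, Ioo_subset_Icc_self hu, h.symm⟩ ⟨rfl, hu, h.symm⟩
  have hfinc : (Coincidences c).Finite := by
    refine coincidences_finite (finite_interior_coincidences hselfc ?_) fun i j => ?_
    · rintro (_ | i) (_ | j) hij
      · exact absurd rfl hij
      · refine ((hβcross j).image Prod.swap).subset ?_
        rintro ⟨t, u⟩ ⟨ht, hu, h⟩
        exact ⟨(u, t), ⟨hu, ht, h.symm⟩, rfl⟩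
      · exact hβcross i
      · exact (hcross i j fun h => hij (congrArg some h)).finite
    · refine ((finite_fiber (hselfc i) (c j 0)).union (finite_fiber (hselfc i) (c j 1))).subset ?_
      rintro t ⟨ht, h | h⟩
      · exact Or.inl ⟨ht, h⟩
      · exact Or.inr ⟨ht, h⟩
  let Z : Set ℂ := insert w (insert x
    (⋃ i, f i '' {t | t ∈ Ioo (0:ℝ) 1 ∧ f i t ∈ β '' Icc 0 1}))
  have hZ : Z.Finite := ((finite_iUnion fun i => (hhit i).finite.image _).insert _).insert _
  have hZβ : Z ⊆ β '' Icc 0 1 := by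
    rintro z (rfl | rfl | hz)
    · exact ⟨1, by simp, hβ1⟩
    · exact ⟨0, by simp, hβ0⟩
    · obtain ⟨i, t, ht, rfl⟩ := mem_iUnion.1 hz
      exact ht.2
  have hfZ : ∀ i, ∀ t ∈ Icc (0:ℝ) 1, f i t ∈ β '' Icc 0 1 → f i t ∈ Z := by
    intro i t ht h
    rcases ht.1.eq_or_lt with rfl | h0
    · rw [(hf i).source]; exact Or.inr (Or.inl rfl)
    rcases ht.2.eq_or_lt with rfl | h1
    · rw [(hf i).target]; exact Or.inr (Or.inl rfl)
    exact Or.inr (Or.inr (mem_iUnion.2 ⟨i, t, ⟨⟨h0, h1⟩, h⟩, rfl⟩))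
  obtain ⟨c', hc', hsub, hend, hiff, hlin, hclose, -⟩ := exists_radialization hc hfinc hZ hη
  have hiffZ : ∀ o, ∀ t ∈ Icc (0:ℝ) 1, c' o t ∈ Z → c o t ∈ Z := fun o t ht h => by
    rw [(hiff o t ht _ h).1 rfl]; exact h
  have hdist : ∀ o, ∀ t ∈ Icc (0:ℝ) 1, dist (c' o t) (c o t) ≤ 2 * η := by
    intro o t ht
    by_cases h : c' o t = c o t
    · rw [h, dist_self]; positivity
    · obtain ⟨z, -, h1, h2⟩ := hclose o t ht h
      have := dist_triangle_right (c' o t) (c o t) z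
      exact this.trans (by linarith)
  have hhom : ∀ i, RelHomotopic V (f i) (c' (some i)) := fun i =>
    relHomotopic_of_close (hf i).continuous (hc' _) (hend (some i)).1 (hend (some i)).2
      (fun t ht v hv => (mul_le_mul_of_nonneg_left (min_le_left _ _) zero_le_two).trans_lt
        (hη₁V _ (mem_iUnion.2 ⟨i, t, ht, rfl⟩) v hv)) (hdist (some i))
  have hends : ∀ i, c' (some i) 0 = x ∧ c' (some i) 1 = x := fun i =>
    ⟨(hend (some i)).1.trans (hf i).source, (hend (some i)).2.trans (hf i).target⟩
  have hloop : ∀ i, IsLoopAt V x (c' (some i)) := by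
    intro i
    obtain ⟨H, -, hH, -, hHV⟩ := hhom i
    refine ⟨hc' _, (hends i).1, (hends i).2, fun t ht => ?_⟩
    rw [← (hH t (Ioo_subset_Icc_self ht)).2]
    exact hHV 1 (by simp) t ht
  set O : Set ℂ := ((⋃ i, c' (some i) '' Icc 0 1) ∪ V)ᶜ with hO
  have hOopen : IsOpen O := by
    refine ((IsCompact.isClosed ?_).union hfin.isClosed).isOpen_compl
    exact isCompact_iUnion fun i => isCompact_Icc.image (hc' _)
  have hβA : c' none '' Icc 0 1 ⊆ O ∪ Z := by
    rintro _ ⟨t, ht, rfl⟩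
    by_cases h : c' none t ∈ O
    · exact Or.inl h
    · right
      rw [hO, notMem_compl_iff] at h
      rcases h with h | h
      · obtain ⟨i, u, hu, h⟩ := mem_iUnion.1 h
        have h2 : f i u = β t := (@hsub ((some i, u), (none, t)) ⟨hu, ht, by simp, h⟩).2.2.2
        have h3 := hfZ i u hu ⟨t, ht, h2.symm⟩
        rwa [← h, (hiff (some i) u hu _ h3).2 rfl]
      · left
        by_contra hne
        have h2 := hη₂V _ ⟨t, ht, rfl⟩ _ ⟨h, hne⟩
        have h3 : dist (c' none t) (β t) ≤ 2 * η := hdist none t ht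
        rw [dist_comm] at h3
        linarith [min_le_right η₁ η₂]
  have h01 : c' none 0 = x ∧ c' none 1 = w :=
    ⟨(hend none).1.trans hβ0, (hend none).2.trans hβ1⟩
  obtain ⟨m, S, hSA, hS⟩ := PolygonalArc.exists_of_locally_segment (A := O ∪ Z) (γ := c' none)
    (by rwa [h01.1, h01.2]) (by
      intro t ht
      rcases hβA ⟨t, ht, rfl⟩ with h | h
      · obtain ⟨r, hr, hball⟩ := Metric.isOpen_iff.1 hOopen _ h
        have hev := ((hc' none).tendsto t).eventually (Metric.ball_mem_nhds _ hr)
        refine (hev.filter_mono nhdsWithin_le_nhds).mono fun u hu => ?_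
        exact ((convex_ball _ _).segment_subset (Metric.mem_ball_self hr) hu).trans
          (hball.trans subset_union_left)
      · exact (hlin none t ht (hiffZ none t ht h)).eventually_segment_subset.mono
          fun u hu => (hu ht).trans hβA)
  rw [h01.1, h01.2] at hS
  refine hS.card_le hB hk hVn hfin hx hw ?_ (f := fun i => c' (some i)) hloop
    (fun i => (hself i).selfCrossings_of_coincidences (i := some i) hsub)
    (fun i j hij => (hcross i j hij).crossings_of_coincidences (i := some i) (j := some j) hsub
      (by simpa using hij))
    (fun i => (hhit i).mono ?_) ?_
  · intro v hv hvS
    rcases hSA hvS with h | h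
    · exact absurd (Or.inr hv) h
    · obtain ⟨t, ht, h⟩ := hZβ h
      exact hβV t ht v hv h
  · rintro t ⟨ht, h⟩
    have ht' := Ioo_subset_Icc_self ht
    rcases hSA h with h | h
    · exact absurd (Or.inl (mem_iUnion.2 ⟨i, mem_image_of_mem _ ht'⟩)) h
    · exact ⟨ht, hZβ (hiffZ (some i) t ht' h)⟩
  · intro i j hij h
    refine hnh i j hij ((hhom i).trans (h.trans ((hhom j).symm ?_ ?_)))
    · rw [(hf j).source, (hends j).1]
    · rw [(hf j).target, (hends j).2]

/-- Loops none of which passes through its base point, or all of which do. -/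
theorem card_le_of_passes {n k M : ℕ} (hB : LoopBound n (5 * k) M) (hk : 1 ≤ k)
    {V : Set ℂ} (hVn : V.ncard = n) (hfin : V.Finite) (hne : V.Nonempty) {x : ℂ} (hx : x ∉ V)
    {ι : Type*} [Fintype ι] {f : ι → ℝ → ℂ} (hf : ∀ i, IsLoopAt V x (f i))
    (hself : ∀ i, FewerThan k (selfCrossings (f i)))
    (hcross : ∀ i j, i ≠ j → FewerThan k (crossings (f i) (f j)))
    (hnh : ∀ i j, i ≠ j → ¬ RelHomotopic V (f i) (f j))
    (hpass : (∀ i, ∀ t ∈ Ioo (0:ℝ) 1, f i t ≠ x) ∨ ∀ i, ∃ t ∈ Ioo (0:ℝ) 1, f i t = x) :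
    Fintype.card ι ≤ 121 * k ^ 2 * M + 1 := by
  classical
  rcases isEmpty_or_nonempty ι with hι | ⟨⟨i₀⟩⟩
  · simp
  obtain ⟨w, hw, hmin⟩ := Set.exists_min_image V (fun v => dist v x) hfin hne
  have hxw : x ≠ w := fun h => hx (h ▸ hw)
  let σ : ℝ → ℂ := fun t => w + t * (x - w)
  have hσ : Continuous σ := by fun_prop
  set K : Set ℂ := ⋃ i, f i '' Icc 0 1 with hK
  have hKc : IsCompact K := isCompact_iUnion fun i => isCompact_Icc.image (hf i).continuous
  have hcomp : IsCompact (Icc (0:ℝ) 1 ∩ σ ⁻¹' K) :=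
    isCompact_Icc.inter_right (hKc.isClosed.preimage hσ)
  obtain ⟨r, ⟨hr, hrK⟩, hrmin⟩ := hcomp.exists_isLeast ⟨1, by simp, by
    refine mem_iUnion.2 ⟨i₀, 0, by simp, ?_⟩
    simp [σ, (hf i₀).source]⟩
  have hbelow : ∀ s ∈ Ico (0:ℝ) r, σ s ∉ K := fun s hs h =>
    absurd (hrmin ⟨⟨hs.1, hs.2.le.trans hr.2⟩, h⟩) (not_le.2 hs.2)
  have hr0 : 0 < r := by
    refine lt_of_le_of_ne hr.1 fun h => ?_
    obtain ⟨i, t, ht, h'⟩ := mem_iUnion.1 hrK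
    refine (hf i).notMem_of_mem_Icc hx ht ?_
    rw [h', ← h]
    simpa [σ] using hw
  obtain ⟨j, τ, hτ, hjτ⟩ : ∃ j, ∃ τ ∈ Ico (0:ℝ) 1, f j τ = σ r := by
    obtain ⟨j, t, ht, h⟩ := mem_iUnion.1 hrK
    rcases ht.2.eq_or_lt with rfl | h1
    · exact ⟨j, 0, by simp, by rw [(hf j).source, ← h, (hf j).target]⟩
    · exact ⟨j, t, ⟨ht.1, h1⟩, h⟩
  let ψ : ℝ → ℝ := fun s => r * ((1 - s) / (1 - τ / 2))
  have hτ2 : 0 < 1 - τ / 2 := by linarith [hτ.2]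
  have hψ : ∀ s ∈ Icc (0:ℝ) 1, τ / 2 < s → ψ s ∈ Ico (0:ℝ) r := fun s hs h =>
    ⟨mul_nonneg hr.1 (div_nonneg (sub_nonneg.2 hs.2) hτ2.le),
      mul_lt_of_lt_one_right hr0 ((div_lt_one hτ2).2 (by linarith))⟩
  let β : ℝ → ℂ := fun s => if s ≤ τ / 2 then f j (2 * s) else σ (ψ s)
  have hβ : Continuous β := by
    have := (hf j).continuous
    refine Continuous.if_le (by fun_prop) (by fun_prop) continuous_id continuous_const ?_
    rintro s rfl
    simp only [ψ]
    rw [mul_div_cancel₀ _ two_ne_zero, hjτ, div_self hτ2.ne', mul_one]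
  have hβ1 : ∀ {s : ℝ}, s ≤ τ / 2 → β s = f j (2 * s) := fun h => if_pos h
  have hβ2 : ∀ {s : ℝ}, τ / 2 < s → β s = σ (ψ s) := fun h => if_neg (not_le.2 h)
  have hseg : ∀ s ∈ Icc (0:ℝ) 1, τ / 2 < s → β s ∉ K := fun s hs h => by
    rw [hβ2 h]; exact hbelow _ (hψ s hs h)
  have hfK : ∀ i, ∀ t ∈ Icc (0:ℝ) 1, f i t ∈ K := fun i t ht => mem_iUnion.2 ⟨i, t, ht, rfl⟩
  have hσinj : Function.Injective σ := fun a b h => by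
    have h2 := mul_right_cancel₀ (sub_ne_zero.2 hxw) (add_left_cancel h)
    exact_mod_cast h2
  have hβV : ∀ t ∈ Icc (0:ℝ) 1, ∀ v ∈ V, β t = v → v = w := by
    intro t ht v hv h
    by_cases hle : t ≤ τ / 2
    · rw [hβ1 hle] at h
      exact absurd (h ▸ hv) ((hf j).notMem_of_mem_Icc hx ⟨by linarith [ht.1], by linarith [hτ.2]⟩)
    · rw [not_le] at hle
      rw [hβ2 hle] at h
      have hs := hψ t ht hle
      set s := ψ t
      have h1 : dist v x = (1 - s) * dist w x := by
        rw [← h, dist_eq_norm, dist_eq_norm,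
            ← abs_of_nonneg (a := 1 - s) (by linarith [hs.2, hr.2]),
          ← Real.norm_eq_abs, ← Complex.norm_real, ← norm_mul]
        congr 1
        simp only [σ]
        push_cast
        ring
      have h2 := hmin v hv
      have h3 : 0 < dist w x := dist_pos.2 hxw.symm
      have h4 : s = 0 := le_antisymm (by nlinarith) hs.1
      rw [← h, h4]
      simp [σ]
  have hβself : (selfCrossings β).Finite := by
    refine ((hself j).finite.image fun p => (p.1 / 2, p.2 / 2)).subset ?_
    rintro ⟨s, u⟩ ⟨hs, hu, hsu, h⟩
    simp only at hs hu hsu h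
    by_cases hu' : u ≤ τ / 2
    · rw [hβ1 hu', hβ1 (hsu.le.trans hu')] at h
      refine ⟨(2 * s, 2 * u), ⟨⟨by linarith [hs.1], by linarith [hτ.2]⟩,
        ⟨by linarith [hu.1], by linarith [hτ.2]⟩, by simpa using hsu, h⟩, by simp⟩
    rw [not_le] at hu'
    by_cases hs' : s ≤ τ / 2
    · refine absurd (hfK j (2 * s) ⟨by linarith [hs.1], by linarith [hτ.2]⟩) ?_
      rw [← hβ1 hs', h]
      exact hseg u (Ioo_subset_Icc_self hu) hu'
    · rw [not_le] at hs'
      rw [hβ2 hs', hβ2 hu'] at h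
      have h2 := (div_left_inj' hτ2.ne').1 (mul_left_cancel₀ hr0.ne' (hσinj h))
      exact absurd h2 (by linarith)
  have hhit : ∀ i, i ≠ j → FewerThan k {t | t ∈ Ioo (0:ℝ) 1 ∧ f i t ∈ β '' Icc 0 1} := by
    intro i hij
    refine ((hcross i j hij).image Prod.fst).mono ?_
    rintro t ⟨ht, s, hs, h⟩
    by_cases hs' : s ≤ τ / 2
    · rw [hβ1 hs'] at h
      rcases hs.1.eq_or_lt with rfl | hs0
      · rw [mul_zero, (hf j).source] at h
        rcases hpass with hp | hp
        · exact absurd h.symm (hp i t ht)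
        · obtain ⟨u, hu, h'⟩ := hp j
          exact ⟨(t, u), ⟨ht, hu, h.symm.trans h'.symm⟩, rfl⟩
      · exact ⟨(t, 2 * s), ⟨ht, ⟨by linarith, by linarith [hτ.2]⟩, h.symm⟩, rfl⟩
    · exact absurd (h ▸ hfK i t (Ioo_subset_Icc_self ht)) (hseg s hs (not_le.1 hs'))
  have hmain := card_le_of_path hB hk hVn hfin hx hw hβ
    (by rw [hβ1 (by linarith [hτ.1]), mul_zero, (hf j).source])
    (by rw [hβ2 (by linarith [hτ.2])]; simp [ψ, σ]) hβV hβself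
    (ι := {i // i ≠ j}) (f := fun i => f i) (fun i => hf i) (fun i => hself i)
    (fun a b h => hcross a b fun h' => h (Subtype.ext h')) (fun i => hhit i i.2)
    (fun a b h => hnh a b fun h' => h (Subtype.ext h'))
  have hcard := Fintype.card_subtype_compl (fun i => i = j)
  rw [Fintype.card_subtype_eq] at hcard
  have : Fintype.card {i // i ≠ j} = Fintype.card ι - 1 := hcard
  omega

theorem LoopBound.card_le_of_notMem {n k M : ℕ} (hB : LoopBound n (5 * k) M) (hk : 1 ≤ k)
    {V : Set ℂ} (hVn : V.ncard = n) (hfin : V.Finite) (hne : V.Nonempty) {x : ℂ} (hx : x ∉ V)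
    {ι : Type*} [Fintype ι] {f : ι → ℝ → ℂ} (hf : ∀ i, IsLoopAt V x (f i))
    (hself : ∀ i, FewerThan k (selfCrossings (f i)))
    (hcross : ∀ i j, i ≠ j → FewerThan k (crossings (f i) (f j)))
    (hnh : ∀ i j, i ≠ j → ¬ RelHomotopic V (f i) (f j)) :
    Fintype.card ι ≤ 242 * k ^ 2 * M + 2 := by
  classical
  let p : ι → Prop := fun i => ∃ t ∈ Ioo (0:ℝ) 1, f i t = x
  have h1 := card_le_of_passes hB hk hVn hfin hne hx (ι := {i // p i}) (f := fun i => f i)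
    (fun i => hf i) (fun i => hself i) (fun a b h => hcross a b fun h' => h (Subtype.ext h'))
    (fun a b h => hnh a b fun h' => h (Subtype.ext h')) (Or.inr fun i => i.2)
  have h2 := card_le_of_passes hB hk hVn hfin hne hx (ι := {i // ¬ p i}) (f := fun i => f i)
    (fun i => hf i) (fun i => hself i) (fun a b h => hcross a b fun h' => h (Subtype.ext h'))
    (fun a b h => hnh a b fun h' => h (Subtype.ext h'))
    (Or.inl fun i t ht h => i.2 ⟨t, ht, h⟩)
  have h3 := Fintype.card_subtype_compl p
  have h4 := Fintype.card_subtype_le p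
  have : 242 * k ^ 2 * M = 2 * (121 * k ^ 2 * M) := by ring
  omega

/-- A small circle is a loop with no self-intersections. -/
theorem LoopBound.one_le {n k M : ℕ} (hB : LoopBound n k M) (hk : 1 ≤ k)
    {V : Set ℂ} (hVn : V.ncard = n) (hfin : V.Finite) (hne : V.Nonempty) : 1 ≤ M := by
  obtain ⟨v, hv⟩ := hne
  obtain ⟨r, hr, hball⟩ : ∃ r > 0, ∀ z ∈ V, dist z v < 2 * r → z = v := by
    obtain ⟨η, hη, h⟩ := Metric.isOpen_iff.1
        (hfin.subset (sdiff_subset (t := {v}))).isClosed.isOpen_compl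
      v (by simp)
    refine ⟨η / 2, by positivity, fun z hz hd => ?_⟩
    by_contra hne
    exact h (show z ∈ Metric.ball v η by rw [Metric.mem_ball]; linarith) ⟨hz, hne⟩
  let c : ℝ → ℂ := fun t => v + (t * (1 - t) : ℝ) * (r : ℂ) * (1 + t * Complex.I)
  have hinj : ∀ t ∈ Ioo (0:ℝ) 1, ∀ u ∈ Ioo (0:ℝ) 1, c t = c u → t = u := by
    intro t ht u hu h
    have h1 := congrArg Complex.re (add_left_cancel h)
    have h2 := congrArg Complex.im (add_left_cancel h)
    simp at h1 h2
    have hr' := hr.ne'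
    rcases h1 with h1 | h1
    · rw [h1] at h2
      have : u * (1 - u) ≠ 0 := (mul_pos hu.1 (sub_pos.2 hu.2)).ne'
      simp_all
    · exact absurd h1 hr'
  refine hB V hVn v hv 1 (fun _ => c) (fun _ => ⟨by fun_prop, by simp [c], by simp [c], ?_⟩)
    (fun _ => ⟨∅, by rwa [Finset.card_empty], ?_⟩) (fun i j h => absurd (Subsingleton.elim i j) h)
    (fun i j h => absurd (Subsingleton.elim i j) h)
  · intro t ht h
    have h0 : 0 < t * (1 - t) := mul_pos ht.1 (sub_pos.2 ht.2)
    have h1 : t * (1 - t) < 1 := by nlinarith [ht.1, ht.2]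
    have h2 := hball _ h (by
      rw [dist_eq_norm]
      have e : c t - v = (t * (1 - t) : ℝ) * (r : ℂ) * (1 + t * Complex.I) := by simp [c]
      rw [e, norm_mul, norm_mul, Complex.norm_real, Complex.norm_real, Real.norm_of_nonneg h0.le,
        Real.norm_of_nonneg hr.le]
      have h3 : ‖(1 + t * Complex.I : ℂ)‖ ≤ 2 := by
        refine (norm_add_le _ _).trans ?_
        rw [norm_one, norm_mul, Complex.norm_I, Complex.norm_real, Real.norm_of_nonneg ht.1.le]
        linarith [ht.2]
      nlinarith [mul_nonneg h0.le hr.le, mul_pos (sub_pos.2 h1) hr])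
    have h3 := congrArg Complex.re (sub_eq_zero.2 h2)
    simp [c] at h3
    rcases h3 with (h3 | h3) | h3 <;> linarith [ht.1, ht.2]
  · rintro ⟨t, u⟩ ⟨ht, hu, htu, h⟩
    exact absurd (hinj t ht u hu h) htu.ne

end

open Set Topology

theorem fewerThan_iff {α : Type*} {k : ℕ} {S : Set α} :
    FewerThan k S ↔ S.Finite ∧ S.ncard < k := by
  refine ⟨fun h => ⟨h.finite, ?_⟩, fun ⟨h, hk⟩ => ⟨h.toFinset, ?_, by simp⟩⟩
  · obtain ⟨J, hJ, hS⟩ := h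
    refine (ncard_le_ncard hS J.finite_toSet).trans_lt ?_
    rwa [ncard_coe_finset]
  · rwa [← ncard_eq_toFinset_card S h]

/-- The plane as the complex numbers. -/
noncomputable def planeHomeo : ℂ ≃ₜ ℝ × ℝ := Complex.equivRealProdCLM.toHomeomorph

theorem selfIntersections_planeHomeo (f : ℝ → ℂ) :
    SelfIntersections (planeHomeo ∘ f) = selfCrossings f := by
  ext p
  simp [SelfIntersections, selfCrossings, planeHomeo.injective.eq_iff]

theorem intersections_planeHomeo (f g : ℝ → ℂ) :
    Intersections (planeHomeo ∘ f) (planeHomeo ∘ g) = crossings f g := by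
  ext p
  simp [Intersections, crossings, planeHomeo.injective.eq_iff]

theorem mem_image_planeHomeo {V : Set ℂ} {z : ℂ} : planeHomeo z ∈ planeHomeo '' V ↔ z ∈ V :=
  planeHomeo.injective.mem_set_image

theorem IsLoopAt.isLoop {V : Set ℂ} {x : ℂ} {f : ℝ → ℂ} (hf : IsLoopAt V x f) :
    IsLoop (planeHomeo '' V) (planeHomeo x) (planeHomeo ∘ f) :=
  ⟨(planeHomeo.continuous.comp hf.continuous).continuousOn, congrArg planeHomeo hf.source,
    congrArg planeHomeo hf.target, fun t ht h => hf.notMem t ht (mem_image_planeHomeo.1 h)⟩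

theorem RelHomotopic.loopHomotopic {V : Set ℂ} {x : ℂ} {f g : ℝ → ℂ} (hf : IsLoopAt V x f)
    (h : RelHomotopic V f g) :
    LoopHomotopic (planeHomeo '' V) (planeHomeo x) (planeHomeo ∘ f) (planeHomeo ∘ g) := by
  obtain ⟨H, hH, h01, hends, hV⟩ := h
  refine ⟨fun s t => planeHomeo (H s t), planeHomeo.continuous.comp_continuousOn hH,
    fun t ht => ⟨congrArg planeHomeo (h01 t ht).1, congrArg planeHomeo (h01 t ht).2⟩,
    fun s hs => ⟨?_, ?_⟩, fun s hs t ht h' => hV s (Ioo_subset_Icc_self hs) t ht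
      (mem_image_planeHomeo.1 h')⟩
  · exact congrArg planeHomeo ((hends s hs).1.trans hf.source)
  · exact congrArg planeHomeo ((hends s hs).2.trans hf.target)

theorem IsLoopAt.relHomotopic_of_loopHomotopic {V : Set ℂ} {x : ℂ} {f g : ℝ → ℂ}
    (hf : IsLoopAt V x f) (hg : IsLoopAt V x g)
    (h : LoopHomotopic (planeHomeo '' V) (planeHomeo x) (planeHomeo ∘ f) (planeHomeo ∘ g)) :
    RelHomotopic V f g := by
  obtain ⟨H, hH, h01, hends, hV⟩ := h
  have e : ∀ {z : ℝ × ℝ} {w : ℂ}, z = planeHomeo w → planeHomeo.symm z = w := fun h => by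
    rw [h, planeHomeo.symm_apply_apply]
  refine ⟨fun s t => planeHomeo.symm (H s t), planeHomeo.symm.continuous.comp_continuousOn hH,
    fun t ht => ⟨e (h01 t ht).1, e (h01 t ht).2⟩, fun s hs => ⟨?_, ?_⟩, fun s hs t ht h' => ?_⟩
  · exact (e (hends s hs).1).trans hf.source.symm
  · exact (e (hends s hs).2).trans hf.target.symm
  · beta_reduce at h'
    rcases hs.1.eq_or_lt with rfl | h0
    · rw [e (h01 t (Ioo_subset_Icc_self ht)).1] at h'
      exact hf.notMem t ht h'
    rcases hs.2.eq_or_lt with rfl | h1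
    · rw [e (h01 t (Ioo_subset_Icc_self ht)).2] at h'
      exact hg.notMem t ht h'
    · exact hV s ⟨h0, h1⟩ t ht ⟨_, h', planeHomeo.apply_symm_apply _⟩

/-- A loop extended continuously to the whole line, as a curve in the complex plane. -/
noncomputable def extendLoop (f : ℝ → ℝ × ℝ) (t : ℝ) : ℂ :=
  planeHomeo.symm (f (projIcc 0 1 zero_le_one t))

theorem planeHomeo_extendLoop {f : ℝ → ℝ × ℝ} {t : ℝ} (ht : t ∈ Icc (0:ℝ) 1) :
    planeHomeo (extendLoop f t) = f t := by
  rw [extendLoop, planeHomeo.apply_symm_apply, projIcc_of_mem _ ht]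

theorem IsLoop.isLoopAt_extendLoop {V : Set (ℝ × ℝ)} {x : ℝ × ℝ} {f : ℝ → ℝ × ℝ}
    (hf : IsLoop V x f) : IsLoopAt (planeHomeo ⁻¹' V) (planeHomeo.symm x) (extendLoop f) := by
  obtain ⟨hc, h0, h1, hV⟩ := hf
  refine ⟨?_, ?_, ?_, fun t ht => ?_⟩
  · exact planeHomeo.symm.continuous.comp
      (hc.comp_continuous (by fun_prop) fun t => (projIcc _ _ _ t).2)
  · rw [← h0, ← planeHomeo_extendLoop (f := f) (by simp), planeHomeo.symm_apply_apply]
  · rw [← h1, ← planeHomeo_extendLoop (f := f) (by simp), planeHomeo.symm_apply_apply]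
  · rw [mem_preimage, planeHomeo_extendLoop (Ioo_subset_Icc_self ht)]
    exact hV t ht

theorem selfCrossings_extendLoop (f : ℝ → ℝ × ℝ) :
    selfCrossings (extendLoop f) = SelfIntersections f := by
  rw [← selfIntersections_planeHomeo]
  ext p
  simp only [SelfIntersections, mem_ofPred_eq, Function.comp]
  refine and_congr_right fun h1 => and_congr_right fun h2 => ?_
  rw [planeHomeo_extendLoop (Ioo_subset_Icc_self h1),
      planeHomeo_extendLoop (Ioo_subset_Icc_self h2)]

theorem crossings_extendLoop (f g : ℝ → ℝ × ℝ) :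
    crossings (extendLoop f) (extendLoop g) = Intersections f g := by
  rw [← intersections_planeHomeo]
  ext p
  simp only [Intersections, mem_ofPred_eq, Function.comp]
  refine and_congr_right fun h1 => and_congr_right fun h2 => ?_
  rw [planeHomeo_extendLoop (Ioo_subset_Icc_self h1),
      planeHomeo_extendLoop (Ioo_subset_Icc_self h2)]

theorem LoopHomotopic.congr {V : Set (ℝ × ℝ)} {x : ℝ × ℝ} {f g f' g' : ℝ → ℝ × ℝ}
    (h : LoopHomotopic V x f g) (hf : EqOn f f' (Icc 0 1)) (hg : EqOn g g' (Icc 0 1)) :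
    LoopHomotopic V x f' g' := by
  obtain ⟨H, hH, h01, h⟩ := h
  exact ⟨H, hH, fun t ht => ⟨(h01 t ht).1.trans (hf ht), (h01 t ht).2.trans (hg ht)⟩, h⟩

/-- If every finite family of pairwise non-homotopic `v`-loops (w.r.t. any set of `n`
obstacles, base point an obstacle) with fewer than `5k` self-intersections per loop and
fewer than `5k` pairwise intersections has at most `M` members, then every finite family
of pairwise non-homotopic `x`-loops (base point not an obstacle) with fewer than `k`
self-intersections per loop and fewer than `k` pairwise intersections has at most
`484·k²·M` members; i.e., `f(n,k) ≤ 484·k²·g(n,5k)`. -/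
theorem f_le_mul_g (n k M : ℕ) (hn : 1 ≤ n) (hk : 1 ≤ k)
    (hg : ∀ V' : Set (ℝ × ℝ), V'.ncard = n → ∀ v ∈ V',
      ∀ m : ℕ, ∀ L : Fin m → (ℝ → ℝ × ℝ),
        (∀ i, IsLoop V' v (L i)) →
        (∀ i, FewerSelfInterThan (5 * k) (L i)) →
        (∀ i j, i ≠ j → FewerInterThan (5 * k) (L i) (L j)) →
        (∀ i j, i ≠ j → ¬ LoopHomotopic V' v (L i) (L j)) →
        m ≤ M) :
    ∀ V : Set (ℝ × ℝ), V.ncard = n → ∀ x : ℝ × ℝ, x ∉ V →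
      ∀ m : ℕ, ∀ L : Fin m → (ℝ → ℝ × ℝ),
        (∀ i, IsLoop V x (L i)) →
        (∀ i, FewerSelfInterThan k (L i)) →
        (∀ i j, i ≠ j → FewerInterThan k (L i) (L j)) →
        (∀ i j, i ≠ j → ¬ LoopHomotopic V x (L i) (L j)) →
        m ≤ 484 * k ^ 2 * M := by
  intro V hV x hx m L hL hself hcross hnh
  have hB : LoopBound n (5 * k) M := by
    intro V' hV' v hv m L hL hself hcross hnh
    refine hg (planeHomeo '' V') (by rw [ncard_image_of_injective _ planeHomeo.injective, hV'])
      (planeHomeo v) ⟨v, hv, rfl⟩ m (fun i => planeHomeo ∘ L i) (fun i => (hL i).isLoop)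
      (fun i => ?_) (fun i j hij => ?_)
      (fun i j hij h => hnh i j hij ((hL i).relHomotopic_of_loopHomotopic (hL j) h))
    · rw [FewerSelfInterThan, selfIntersections_planeHomeo, ← fewerThan_iff]
      exact hself i
    · rw [FewerInterThan, intersections_planeHomeo, ← fewerThan_iff]
      exact hcross i j hij
  have hVn : (planeHomeo ⁻¹' V).ncard = n := by
    rw [← hV, ← planeHomeo.image_symm, ncard_image_of_injective _ planeHomeo.symm.injective]
  have hpos : 0 < (planeHomeo ⁻¹' V).ncard := by omega
  have hfin := finite_of_ncard_pos hpos
  have hne := nonempty_of_ncard_ne_zero hpos.ne'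
  have hM := hB.one_le (by omega) hVn hfin hne
  have hcard := hB.card_le_of_notMem hk hVn hfin hne (x := planeHomeo.symm x) (by simpa using hx)
    (f := fun i => extendLoop (L i)) (fun i => (hL i).isLoopAt_extendLoop)
    (fun i => by rw [selfCrossings_extendLoop, fewerThan_iff]; exact hself i)
    (fun i j hij => by rw [crossings_extendLoop, fewerThan_iff]; exact hcross i j hij)
    (fun i j hij h => hnh i j hij (by
      have h' := h.loopHomotopic (hL i).isLoopAt_extendLoop
      rw [image_preimage_eq _ planeHomeo.surjective, planeHomeo.apply_symm_apply] at h'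
      exact h'.congr (fun t ht => planeHomeo_extendLoop ht) (fun t ht => planeHomeo_extendLoop ht)))
  rw [Fintype.card_fin] at hcard
  have h1 : 1 ≤ k ^ 2 * M := Nat.mul_pos (pow_pos hk 2) hM
  nlinarith
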